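/- arXiv:1805.11153 — 6 statements merged into one kernel-verified Lean document; each statement's English description precedes it below -/
import Mathlib

section
/- Let X be a bipartite graph with finite partite sets A and B, and suppose Σ_{b ∈ B} deg b > 0. Then #{a ∈ A : ω(a) = 0} ≤ |A|² · (Σ_{b₁,b₂ ∈ B} n(b₁,b₂)) / (Σ_{b ∈ B} deg b)² − |A|, where the double sum runs over all ordered pairs (b₁,b₂) ∈ B × B. -/
theorem natCard_subtype_eq_sum_ite {A : Type*} [Fintype A] (p : A → Prop) [DecidablePred p] :
    (Nat.card {a : A // p a} : ℝ) = ∑ a : A, if p a then 1 else 0 := by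
  rw [Nat.card_eq_fintype_card, Fintype.card_subtype, Finset.sum_boole]

/-- Bounds the number of zeros of `w` by its second moment about the mean. -/
theorem card_zeros_add_card_mul_sq_sum_le {A : Type*} [Fintype A] (w : A → ℝ)
    [DecidablePred fun a => w a = 0] :
    ((∑ a : A, if w a = 0 then (1 : ℝ) else 0) + Fintype.card A) * (∑ a, w a) ^ 2 ≤
      (Fintype.card A : ℝ) ^ 2 * ∑ a, w a ^ 2 := by
  set S := ∑ a, w a with hS
  set n := (Fintype.card A : ℝ) with hn
  have hvar : ∑ a, (n * w a - S) ^ 2 = n ^ 2 * ∑ a, w a ^ 2 - n * S ^ 2 := by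
    have hexpand : ∀ a, (n * w a - S) ^ 2 = n ^ 2 * w a ^ 2 - 2 * n * S * w a + S ^ 2 :=
      fun a => by ring
    simp only [hexpand, Finset.sum_add_distrib, Finset.sum_sub_distrib, ← Finset.mul_sum,
      Finset.sum_const, Finset.card_univ, nsmul_eq_mul, ← hS, ← hn]
    ring
  have hzeros : (∑ a : A, if w a = 0 then (1 : ℝ) else 0) * S ^ 2 ≤
      ∑ a, (n * w a - S) ^ 2 := by
    rw [Finset.sum_mul]
    refine Finset.sum_le_sum fun a _ => ?_
    split_ifs with h
    · simp [h]
    · simpa using sq_nonneg (n * w a - S)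
  linarith

/-- **The Turán sieve.** For a bipartite graph with finite partite sets `A` and `B`
(given by a relation `R` between `A` and `B`), assuming `∑_{b ∈ B} deg b > 0`, the number
of `a ∈ A` with `ω(a) = 0` is at most
`|A|² · (∑_{b₁,b₂ ∈ B} n(b₁,b₂)) / (∑_{b ∈ B} deg b)² - |A|`. -/
theorem turan_sieve {A B : Type*} [Fintype A] [Fintype B] (R : A → B → Prop)
    (hdeg : 0 < ∑ b : B, (Nat.card {a : A // R a b} : ℝ)) :
    (Nat.card {a : A // ∀ b : B, ¬ R a b} : ℝ) ≤
      (Fintype.card A : ℝ) ^ 2 *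
        (∑ b₁ : B, ∑ b₂ : B, (Nat.card {a : A // R a b₁ ∧ R a b₂} : ℝ)) /
          (∑ b : B, (Nat.card {a : A // R a b} : ℝ)) ^ 2
        - (Fintype.card A : ℝ) := by
  classical
  let w : A → ℝ := fun a => ∑ b : B, if R a b then 1 else 0
  have hS : ∑ b : B, (Nat.card {a : A // R a b} : ℝ) = ∑ a, w a := by
    simp only [natCard_subtype_eq_sum_ite]
    exact Finset.sum_comm
  have hQ : ∑ b₁ : B, ∑ b₂ : B, (Nat.card {a : A // R a b₁ ∧ R a b₂} : ℝ) =
      ∑ a, w a ^ 2 := by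
    have hw : ∀ a, w a ^ 2 = ∑ b₁ : B, ∑ b₂ : B, if R a b₁ ∧ R a b₂ then (1 : ℝ) else 0 := by
      intro a
      simp only [w, sq, Finset.sum_mul_sum, ite_and, ite_mul, one_mul, zero_mul]
    simp only [natCard_subtype_eq_sum_ite, hw]
    rw [Finset.sum_comm (s := (Finset.univ : Finset A))]
    exact Finset.sum_congr rfl fun _ _ => Finset.sum_comm
  have hZ : (Nat.card {a : A // ∀ b : B, ¬ R a b} : ℝ) =
      ∑ a, if w a = 0 then (1 : ℝ) else 0 := by
    have hw : ∀ a, w a = 0 ↔ ∀ b, ¬ R a b := by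
      intro a
      rw [Finset.sum_eq_zero_iff_of_nonneg fun b _ => by positivity]
      simp
    simp only [natCard_subtype_eq_sum_ite, hw]
  rw [hS] at hdeg
  rw [hS, hQ, hZ, le_sub_iff_add_le, le_div_iff₀ (by positivity)]
  exact card_zeros_add_card_mul_sq_sum_le w
end

section
/- For every n ∈ ℕ with n ≥ 2 and every p ∈ [0,1], the probability P(n,p) that a random graph on n vertices with edge probability p has diameter at most 2 satisfies P(n,p) ≥ 1 − n²(1−p²)^{n−2}(1−p)/2. -/
open scoped Classical

/-- The probability that a random simple graph on `n` labelled vertices, in which each of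
the `n.choose 2` possible edges is included independently with probability `p`, is
connected with diameter at most `2`. -/
noncomputable def diam2Prob (n : ℕ) (p : ℝ) : ℝ :=
  ∑ G : SimpleGraph (Fin n),
    if G.Connected ∧ ∀ u v : Fin n, G.dist u v ≤ 2 then
      p ^ Nat.card G.edgeSet * (1 - p) ^ (n.choose 2 - Nat.card G.edgeSet)
    else 0

open Finset in
/-- A `p`-random subset of `U` contains a fixed `R ⊆ U` with probability `p ^ #R`. -/
theorem sum_powerset_weight_superset {α : Type*} (p : ℝ) (U R : Finset α) (hR : R ⊆ U) :
    ∑ S ∈ U.powerset, (if R ⊆ S then p ^ #S * (1 - p) ^ (#U - #S) else 0) = p ^ #R := by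
  have h := Finset.prod_add (fun _ : α => p) (fun a => if a ∈ R then 0 else 1 - p) U
  have hl : ∏ a ∈ U, (p + if a ∈ R then 0 else 1 - p) = p ^ #R := by
    calc ∏ a ∈ U, (p + if a ∈ R then 0 else 1 - p) = ∏ a ∈ U, if a ∈ R then p else 1 :=
          prod_congr rfl fun a _ => by split_ifs <;> ring
      _ = p ^ #R := by
          rw [prod_ite_mem, inter_eq_right.2 hR, prod_const]
  rw [← hl, h]
  refine sum_congr rfl fun S hS => ?_
  rw [mem_powerset] at hS
  rw [prod_const]
  split_ifs with hRS
  · rw [← card_sdiff_of_subset hS, prod_congr rfl (g := fun _ => 1 - p), prod_const]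
    intro a ha
    rw [if_neg fun haR => (mem_sdiff.1 ha).2 (hRS haR)]
  · obtain ⟨a, haR, haS⟩ := not_subset.1 hRS
    have h0 : ∏ b ∈ U \ S, (if b ∈ R then 0 else 1 - p) = 0 :=
      prod_eq_zero (mem_sdiff.2 ⟨hR haR, haS⟩) (if_pos haR)
    rw [h0, mul_zero]

open Finset in
/-- For pairwise disjoint `T i ⊆ U`, also disjoint from `R`, the events that a `p`-random subset
of `U` contains `R` and that it does not contain `T i` are independent. -/
theorem sum_powerset_weight_avoid {α ι : Type*} (p : ℝ) (U : Finset α) (T : ι → Finset α)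
    (I : Finset ι) (hT : ∀ i ∈ I, T i ⊆ U) (hI : (I : Set ι).PairwiseDisjoint T)
    (R : Finset α) (hR : R ⊆ U) (hRT : ∀ i ∈ I, Disjoint R (T i)) :
    ∑ S ∈ U.powerset, (if R ⊆ S ∧ ∀ i ∈ I, ¬ T i ⊆ S then p ^ #S * (1 - p) ^ (#U - #S) else 0) =
      p ^ #R * ∏ i ∈ I, (1 - p ^ #(T i)) := by
  induction I using Finset.induction_on generalizing R with
  | empty => simpa using sum_powerset_weight_superset p U R hR
  | insert j I hj ih =>
    have hTI : ∀ i ∈ I, T i ⊆ U := fun i hi => hT i (mem_insert_of_mem hi)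
    have hII : (I : Set ι).PairwiseDisjoint T := hI.subset (by simp)
    have h₁ := ih hTI hII R hR fun i hi => hRT i (mem_insert_of_mem hi)
    have h₂ := ih hTI hII (R ∪ T j) (union_subset hR (hT j (mem_insert_self _ _))) fun i hi =>
      disjoint_union_left.2 ⟨hRT i (mem_insert_of_mem hi),
        hI (by simp) (by simp [hi]) fun h => hj (h ▸ hi)⟩
    rw [card_union_of_disjoint (hRT j (mem_insert_self _ _)), pow_add] at h₂
    have h₃ : p ^ #R * ∏ i ∈ insert j I, (1 - p ^ #(T i)) = p ^ #R * ∏ i ∈ I, (1 - p ^ #(T i)) -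
        p ^ #R * p ^ #(T j) * ∏ i ∈ I, (1 - p ^ #(T i)) := by
      rw [prod_insert hj]; ring
    rw [h₃, ← h₁, ← h₂, ← sum_sub_distrib]
    refine sum_congr rfl fun S _ => ?_
    by_cases hA : R ⊆ S <;> by_cases hB : T j ⊆ S <;> by_cases hC : ∀ i ∈ I, ¬ T i ⊆ S <;>
      simp [hA, hB, hC, union_subset_iff]

namespace SimpleGraph

/-- Sums over graphs are sums over sets of edges of the complete graph. -/
theorem sum_eq_sum_powerset_edgeFinset_top {V : Type*} [Fintype V] (f : Finset (Sym2 V) → ℝ) :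
    ∑ G : SimpleGraph V, f G.edgeFinset =
      ∑ S ∈ (⊤ : SimpleGraph V).edgeFinset.powerset, f S := by
  refine Finset.sum_bij (fun G _ => G.edgeFinset) (fun G _ => ?_) (fun G _ H _ h => ?_)
    (fun S hS => ?_) fun _ _ => rfl
  · rw [Finset.mem_powerset, edgeFinset_subset_edgeFinset]
    exact le_top
  · exact edgeFinset_inj.1 h
  · refine ⟨fromEdgeSet S, Finset.mem_univ _, ?_⟩
    ext e
    rw [Finset.mem_powerset] at hS
    have hmem (G : SimpleGraph V) : e ∈ G.edgeFinset ↔ e ∈ G.edgeSet := mem_edgeFinset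
    rw [hmem, edgeSet_fromEdgeSet]
    refine ⟨fun h => h.1, fun h => ⟨h, ?_⟩⟩
    have := hS h
    rw [mem_edgeFinset] at this
    exact not_isDiag_of_mem_edgeSet _ this

/-- If any two distinct vertices are adjacent or have a common neighbour, then the graph is
connected with diameter at most `2`. -/
theorem connected_and_dist_le_two {V : Type*} [Nonempty V] (G : SimpleGraph V)
    (h : ∀ u v, u ≠ v → G.Adj u v ∨ ∃ w, G.Adj u w ∧ G.Adj v w) :
    G.Connected ∧ ∀ u v, G.dist u v ≤ 2 := by
  have hw : ∀ u v, ∃ q : G.Walk u v, q.length ≤ 2 := fun u v => by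
    by_cases huv : u = v
    · subst huv
      exact ⟨.nil, by simp⟩
    obtain huv | ⟨w, hu, hv⟩ := h u v huv
    · exact ⟨.cons huv .nil, by simp⟩
    · exact ⟨.cons hu (.cons hv.symm .nil), by simp⟩
  refine ⟨(connected_iff _).2 ⟨fun u v => (hw u v).choose.reachable, ‹_›⟩, fun u v => ?_⟩
  obtain ⟨q, hq⟩ := hw u v
  exact (dist_le q).trans hq

/-- The weights of the random graph distribution sum to `1`. -/
theorem sum_weight (V : Type*) [Fintype V] (p : ℝ) :
    ∑ G : SimpleGraph V, p ^ Nat.card G.edgeSet *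
      (1 - p) ^ ((Fintype.card V).choose 2 - Nat.card G.edgeSet) = 1 := by
  have h := sum_powerset_weight_superset p (⊤ : SimpleGraph V).edgeFinset ∅ (by simp)
  rw [← sum_eq_sum_powerset_edgeFinset_top] at h
  have hcard : (⊤ : SimpleGraph V).edgeFinset.card = (Fintype.card V).choose 2 := by
    convert card_edgeFinset_top_eq_card_choose_two (V := V)
  rw [hcard, Finset.card_empty, pow_zero] at h
  refine (Finset.sum_congr rfl fun G _ => ?_).trans h
  rw [if_pos (Finset.empty_subset _), Nat.card_eq_fintype_card, ← edgeFinset_card]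

/-- The probability that `u ≠ v` are nonadjacent without common neighbours in a random graph. -/
theorem sum_weight_not_adj_no_common_neighbor {V : Type*} [Fintype V] (p : ℝ) {u v : V} (huv : u ≠ v) :
    ∑ G : SimpleGraph V, (if ¬ G.Adj u v ∧ ∀ w, ¬ (G.Adj u w ∧ G.Adj v w) then
      p ^ Nat.card G.edgeSet * (1 - p) ^ ((Fintype.card V).choose 2 - Nat.card G.edgeSet)
      else 0) =
      (1 - p ^ 2) ^ (Fintype.card V - 2) * (1 - p) := by
  let T : V → Finset (Sym2 V) := fun w => if w = u then {s(u, v)} else {s(u, w), s(v, w)}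
  have hU := sum_powerset_weight_avoid p (⊤ : SimpleGraph V).edgeFinset T (Finset.univ.erase v)
    (fun w hw => by
      simp only [Finset.mem_erase] at hw
      intro e he
      simp only [T] at he
      split_ifs at he with h <;> simp at he <;> aesop)
    (fun w hw x hx hwx => by
      simp only [Finset.coe_erase, Finset.coe_univ, Set.mem_sdiff, Set.mem_singleton_iff] at hw hx
      simp only [Function.onFun, T, Finset.disjoint_left]
      intro e he hf
      split_ifs at he hf <;> simp at he hf <;> aesop)
    ∅ (by simp) (by simp)
  rw [← sum_eq_sum_powerset_edgeFinset_top] at hU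
  have hcard : (⊤ : SimpleGraph V).edgeFinset.card = (Fintype.card V).choose 2 := by
    convert card_edgeFinset_top_eq_card_choose_two (V := V)
  rw [hcard] at hU
  have hu : u ∈ Finset.univ.erase v := by simp [huv]
  have hprod : ∏ w ∈ (Finset.univ.erase v).erase u, (1 - p ^ (T w).card) =
      (1 - p ^ 2) ^ (Fintype.card V - 2) := by
    rw [Finset.prod_congr rfl (g := fun _ => 1 - p ^ 2), Finset.prod_const,
      Finset.card_erase_of_mem hu, Finset.card_erase_of_mem (Finset.mem_univ _),
      Finset.card_univ, Nat.sub_sub]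
    intro w hw
    simp only [Finset.mem_erase] at hw
    simp only [T, if_neg hw.1]
    rw [Finset.card_pair]
    aesop
  rw [← Finset.mul_prod_erase _ _ hu, hprod] at hU
  have hTu : (T u).card = 1 := by simp [T]
  rw [hTu, Finset.card_empty, pow_zero, pow_one, one_mul, mul_comm] at hU
  rw [← hU]
  refine Finset.sum_congr rfl fun G _ => ?_
  rw [Nat.card_eq_fintype_card, ← edgeFinset_card]
  congr 1
  rw [eq_iff_iff]
  simp only [Finset.empty_subset, true_and, Finset.mem_erase, Finset.mem_univ, and_true]
  constructor
  · rintro ⟨h, hw⟩ w hwv hs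
    by_cases hwu : w = u
    · simp [T, hwu] at hs
      exact h hs
    · simp [T, hwu, Finset.insert_subset_iff] at hs
      exact hw w hs
  · intro h
    refine ⟨fun ha => h u huv (by simpa [T] using ha), fun w hw => ?_⟩
    refine h w hw.2.ne' ?_
    simpa [T, hw.1.ne', Finset.insert_subset_iff] using hw

/-- Union bound over the pairs of vertices that are nonadjacent without common neighbours. -/
theorem sum_weight_connected_dist_le_two_lower (V : Type*) [Fintype V] [Nonempty V]
    (p : ℝ) (hp0 : 0 ≤ p) (hp1 : p ≤ 1) :
    1 - (Fintype.card V : ℝ) ^ 2 * (1 - p ^ 2) ^ (Fintype.card V - 2) * (1 - p) / 2 ≤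
      ∑ G : SimpleGraph V, if G.Connected ∧ ∀ u v : V, G.dist u v ≤ 2 then
        p ^ Nat.card G.edgeSet * (1 - p) ^ ((Fintype.card V).choose 2 - Nat.card G.edgeSet)
      else 0 := by
  set w : SimpleGraph V → ℝ := fun G =>
    p ^ Nat.card G.edgeSet * (1 - p) ^ ((Fintype.card V).choose 2 - Nat.card G.edgeSet)
  have hw0 : ∀ G, 0 ≤ w G := fun G =>
    mul_nonneg (pow_nonneg hp0 _) (pow_nonneg (sub_nonneg.2 hp1) _)
  let bad (G : SimpleGraph V) (x : V × V) : Prop :=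
    ¬ G.Adj x.1 x.2 ∧ ∀ y, ¬ (G.Adj x.1 y ∧ G.Adj x.2 y)
  have hpoint : ∀ G, 2 * (w G - if G.Connected ∧ ∀ u v : V, G.dist u v ≤ 2 then w G else 0) ≤
      ∑ x ∈ (Finset.univ : Finset V).offDiag, if bad G x then w G else 0 := by
    intro G
    split_ifs with hG
    · simpa using Finset.sum_nonneg fun x _ => by split_ifs <;> simp [hw0 G]
    · obtain ⟨u, v, huv, hadj, hcom⟩ : ∃ u v, u ≠ v ∧ ¬ G.Adj u v ∧
          ∀ y, ¬ (G.Adj u y ∧ G.Adj v y) := by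
        by_contra! h
        refine hG (G.connected_and_dist_le_two fun u v huv => ?_)
        by_cases hadj : G.Adj u v
        · exact .inl hadj
        · exact .inr (h u v huv hadj)
      rw [← Finset.sum_filter, Finset.sum_const, nsmul_eq_mul, sub_zero]
      refine mul_le_mul_of_nonneg_right ?_ (hw0 G)
      have : 1 < (((Finset.univ : Finset V).offDiag).filter (bad G)).card :=
        Finset.one_lt_card.2 ⟨(u, v), by simp [bad, huv, hadj]; simpa using hcom, (v, u),
          by simp [bad, huv.symm, G.adj_comm v u, hadj]; exact fun y h h' => hcom y ⟨h', h⟩,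
          by simp [huv]⟩
      exact_mod_cast this
  have hpair : ∀ x ∈ (Finset.univ : Finset V).offDiag,
      ∑ G, (if bad G x then w G else 0) = (1 - p ^ 2) ^ (Fintype.card V - 2) * (1 - p) := by
    intro x hx
    convert sum_weight_not_adj_no_common_neighbor p (Finset.mem_offDiag.1 hx).2.2
  have hsum := Finset.sum_le_sum fun G (_ : G ∈ Finset.univ) => hpoint G
  rw [← Finset.mul_sum, Finset.sum_sub_distrib, sum_weight V p, Finset.sum_comm,
    Finset.sum_congr rfl hpair, Finset.sum_const, nsmul_eq_mul, Finset.offDiag_card,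
    Finset.card_univ] at hsum
  have hq : 0 ≤ (1 - p ^ 2) ^ (Fintype.card V - 2) * (1 - p) :=
    mul_nonneg (pow_nonneg (by nlinarith) _) (sub_nonneg.2 hp1)
  have hn2 : ((Fintype.card V * Fintype.card V - Fintype.card V : ℕ) : ℝ) ≤
      (Fintype.card V : ℝ) ^ 2 := by
    exact_mod_cast (Nat.sub_le _ _).trans_eq (sq _).symm
  nlinarith [mul_le_mul_of_nonneg_right hn2 hq]

end SimpleGraph

/-- Simple-sieve lower bound: `P(n,p) ≥ 1 - n²(1-p²)^{n-2}(1-p)/2`. -/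
theorem diam2Prob_lower (n : ℕ) (hn : 2 ≤ n) (p : ℝ) (hp0 : 0 ≤ p) (hp1 : p ≤ 1) :
    1 - (n : ℝ) ^ 2 * (1 - p ^ 2) ^ (n - 2) * (1 - p) / 2 ≤ diam2Prob n p := by
  have : Nonempty (Fin n) := ⟨⟨0, by omega⟩⟩
  rw [diam2Prob]
  convert SimpleGraph.sum_weight_connected_dist_le_two_lower (Fin n) p hp0 hp1 <;>
    exact (Fintype.card_fin n).symm
end

section
/- For every n ∈ ℕ with n ≥ 2 and every p ∈ (0,1), the probability P(n,p) that a random graph on n vertices with edge probability p has diameter at most 2 satisfies P(n,p) ≤ 2/((n−1)²(1−p²)ⁿ(1−p)) + (8/n)(1 + p³/(1−p)²)ⁿ. -/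
open scoped Classical

namespace Diam2

variable {n : ℕ} {p : ℝ}

/-- The possible edges of a graph on `Fin n`. -/
noncomputable def possibleEdges (n : ℕ) : Finset (Sym2 (Fin n)) :=
  Finset.univ.filter fun e => ¬ e.IsDiag

lemma mem_possibleEdges {e : Sym2 (Fin n)} : e ∈ possibleEdges n ↔ ¬ e.IsDiag := by
  simp [possibleEdges]

lemma card_possibleEdges : (possibleEdges n).card = n.choose 2 := by
  have h := Sym2.card_subtype_not_diag (α := Fin n)
  rw [Fintype.card_fin, Fintype.card_subtype] at h
  rw [possibleEdges, ← h]

/-- The probability of the graph `G` in the random graph model. -/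
noncomputable def weight (p : ℝ) (G : SimpleGraph (Fin n)) : ℝ :=
  ∏ e ∈ possibleEdges n, if e ∈ G.edgeSet then p else 1 - p

lemma weight_eq (p : ℝ) (G : SimpleGraph (Fin n)) :
    weight p G = p ^ Nat.card G.edgeSet * (1 - p) ^ (n.choose 2 - Nat.card G.edgeSet) := by
  have hc : ((possibleEdges n).filter (· ∈ G.edgeSet)).card = Nat.card G.edgeSet := by
    rw [Nat.card_eq_fintype_card, ← Set.toFinset_card]
    congr 1
    ext e
    simp only [Finset.mem_filter, mem_possibleEdges, Set.mem_toFinset]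
    exact ⟨fun h => h.2, fun h => ⟨G.not_isDiag_of_mem_edgeSet h, h⟩⟩
  have hs := Finset.card_filter_add_card_filter_not (s := possibleEdges n) (· ∈ G.edgeSet)
  rw [hc, card_possibleEdges] at hs
  rw [weight, Finset.prod_ite, Finset.prod_const, Finset.prod_const, hc, ← hs,
    Nat.add_sub_cancel_left]

lemma weight_nonneg (hp0 : 0 ≤ p) (hp1 : p ≤ 1) (G : SimpleGraph (Fin n)) :
    0 ≤ weight p G :=
  Finset.prod_nonneg fun e _ => by split_ifs <;> linarith

/-- Summing a product over edges against all graphs. -/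
lemma sum_prod_edges (f g : Sym2 (Fin n) → ℝ) :
    ∑ G : SimpleGraph (Fin n), ∏ e ∈ possibleEdges n, (if e ∈ G.edgeSet then f e else g e) =
      ∏ e ∈ possibleEdges n, (f e + g e) := by
  rw [Finset.prod_add]
  refine Finset.sum_bij' (fun G _ => (possibleEdges n).filter (· ∈ G.edgeSet))
    (fun s _ => SimpleGraph.fromEdgeSet (s : Set (Sym2 (Fin n)))) ?_ ?_ ?_ ?_ ?_
  · intro G _
    simp
  · simp
  · intro G _
    rw [← SimpleGraph.edgeSet_inj, SimpleGraph.edgeSet_fromEdgeSet]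
    ext e
    have := G.not_isDiag_of_mem_edgeSet (e := e)
    simp [mem_possibleEdges]
    tauto
  · intro s hs
    rw [Finset.mem_powerset] at hs
    ext e
    have h1 : e ∈ s → ¬ e.IsDiag := fun h => mem_possibleEdges.1 (hs h)
    simp [mem_possibleEdges]
    tauto
  · intro G _
    rw [Finset.prod_ite]
    congr 1
    apply Finset.prod_congr _ fun _ _ => rfl
    ext e
    simp
    tauto

/-- Expectation over the random graph. -/
noncomputable def expect (p : ℝ) (F : SimpleGraph (Fin n) → ℝ) : ℝ :=
  ∑ G, weight p G * F G

lemma expect_add (F F' : SimpleGraph (Fin n) → ℝ) :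
    expect p (fun G => F G + F' G) = expect p F + expect p F' := by
  simp only [expect, mul_add, Finset.sum_add_distrib]

lemma expect_sub (F F' : SimpleGraph (Fin n) → ℝ) :
    expect p (fun G => F G - F' G) = expect p F - expect p F' := by
  simp only [expect, mul_sub, Finset.sum_sub_distrib]

lemma expect_const_mul (c : ℝ) (F : SimpleGraph (Fin n) → ℝ) :
    expect p (fun G => c * F G) = c * expect p F := by
  simp only [expect, Finset.mul_sum, mul_left_comm]

lemma expect_sum {ι : Type*} (s : Finset ι) (F : ι → SimpleGraph (Fin n) → ℝ) :
    expect p (fun G => ∑ i ∈ s, F i G) = ∑ i ∈ s, expect p (F i) := by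
  simp only [expect, Finset.mul_sum]
  exact Finset.sum_comm

lemma expect_mono (hp0 : 0 ≤ p) (hp1 : p ≤ 1) {F F' : SimpleGraph (Fin n) → ℝ}
    (h : ∀ G, F G ≤ F' G) : expect p F ≤ expect p F' :=
  Finset.sum_le_sum fun G _ => mul_le_mul_of_nonneg_left (h G) (weight_nonneg hp0 hp1 G)

/-- The indicator of an edge. -/
noncomputable def edgeInd (e : Sym2 (Fin n)) (G : SimpleGraph (Fin n)) : ℝ :=
  if e ∈ G.edgeSet then 1 else 0

lemma edgeInd_eq_zero_or_one (e : Sym2 (Fin n)) (G : SimpleGraph (Fin n)) :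
    edgeInd e G = 0 ∨ edgeInd e G = 1 := by
  unfold edgeInd
  split_ifs <;> simp

lemma expect_prod_edgeInd (T : Finset (Sym2 (Fin n))) (hT : ∀ e ∈ T, ¬ e.IsDiag) :
    expect p (fun G => ∏ e ∈ T, edgeInd e G) = p ^ T.card := by
  have hT' : T ⊆ possibleEdges n := fun e he => mem_possibleEdges.2 (hT e he)
  have key : ∀ G : SimpleGraph (Fin n), weight p G * ∏ e ∈ T, edgeInd e G =
      ∏ e ∈ possibleEdges n,
        if e ∈ G.edgeSet then p else (if e ∈ T then 0 else 1 - p) := by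
    intro G
    have : ∏ e ∈ T, edgeInd e G =
        ∏ e ∈ possibleEdges n, if e ∈ T then edgeInd e G else 1 := by
      rw [Finset.prod_ite_mem, Finset.inter_eq_right.2 hT']
    rw [this, weight, ← Finset.prod_mul_distrib]
    refine Finset.prod_congr rfl fun e _ => ?_
    unfold edgeInd
    split_ifs <;> simp
  rw [expect, Finset.sum_congr rfl fun G _ => key G,
    sum_prod_edges (fun _ => p) fun e => if e ∈ T then 0 else 1 - p]
  have : ∀ e, p + (if e ∈ T then 0 else 1 - p) = if e ∈ T then p else 1 := by
    intro e
    split_ifs <;> ring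
  simp only [this]
  rw [Finset.prod_ite_mem, Finset.inter_eq_right.2 hT', Finset.prod_const]

lemma expect_one : expect p (fun _ : SimpleGraph (Fin n) => 1) = 1 := by
  simpa using expect_prod_edgeInd (n := n) (p := p) ∅ (by simp)

/-- `F` depends only on which edges from `A` are present. -/
def DependsOnEdges (A : Set (Sym2 (Fin n))) (F : SimpleGraph (Fin n) → ℝ) : Prop :=
  ∀ G H : SimpleGraph (Fin n), (∀ e ∈ A, e ∈ G.edgeSet ↔ e ∈ H.edgeSet) → F G = F H

lemma DependsOnEdges.mono {A A' : Set (Sym2 (Fin n))} {F : SimpleGraph (Fin n) → ℝ}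
    (hF : DependsOnEdges A F) (h : A ⊆ A') : DependsOnEdges A' F :=
  fun G H hGH => hF G H fun e he => hGH e (h he)

lemma DependsOnEdges.mul {A : Set (Sym2 (Fin n))} {F F' : SimpleGraph (Fin n) → ℝ}
    (hF : DependsOnEdges A F) (hF' : DependsOnEdges A F') :
    DependsOnEdges A fun G => F G * F' G :=
  fun G H hGH => by simp only [hF G H hGH, hF' G H hGH]

lemma DependsOnEdges.prod {ι : Type*} {A : Set (Sym2 (Fin n))} {s : Finset ι}
    {F : ι → SimpleGraph (Fin n) → ℝ} (hF : ∀ i ∈ s, DependsOnEdges A (F i)) :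
    DependsOnEdges A fun G => ∏ i ∈ s, F i G :=
  fun G H hGH => Finset.prod_congr rfl fun i hi => hF i hi G H hGH

/-- The graph which agrees with `G` on `A` and with `H` off `A`. -/
def mix (A : Set (Sym2 (Fin n))) (G H : SimpleGraph (Fin n)) : SimpleGraph (Fin n) :=
  SimpleGraph.fromEdgeSet (A ∩ G.edgeSet ∪ Aᶜ ∩ H.edgeSet)

lemma mem_edgeSet_mix {A : Set (Sym2 (Fin n))} {G H : SimpleGraph (Fin n)} {e : Sym2 (Fin n)} :
    e ∈ (mix A G H).edgeSet ↔ e ∈ A ∧ e ∈ G.edgeSet ∨ e ∉ A ∧ e ∈ H.edgeSet := by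
  have h1 := G.not_isDiag_of_mem_edgeSet (e := e)
  have h2 := H.not_isDiag_of_mem_edgeSet (e := e)
  simp only [mix, SimpleGraph.edgeSet_fromEdgeSet, Set.mem_sdiff, Set.mem_union, Set.mem_inter_iff,
    Set.mem_compl_iff, Sym2.mem_diagSet]
  tauto

lemma mix_mix (A : Set (Sym2 (Fin n))) (G H : SimpleGraph (Fin n)) :
    mix A (mix A G H) (mix A H G) = G := by
  rw [← SimpleGraph.edgeSet_inj]
  ext e
  simp only [mem_edgeSet_mix]
  tauto

lemma weight_mul_weight_mix (A : Set (Sym2 (Fin n))) (G H : SimpleGraph (Fin n)) :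
    weight p (mix A G H) * weight p (mix A H G) = weight p G * weight p H := by
  simp only [weight, ← Finset.prod_mul_distrib, mem_edgeSet_mix]
  refine Finset.prod_congr rfl fun e _ => ?_
  by_cases h : e ∈ A <;> simp [h, mul_comm]

lemma expect_mul {A A' : Set (Sym2 (Fin n))} (hA : Disjoint A A')
    {F F' : SimpleGraph (Fin n) → ℝ} (hF : DependsOnEdges A F) (hF' : DependsOnEdges A' F') :
    expect p (fun G => F G * F' G) = expect p F * expect p F' := by
  have h1 : expect p F * expect p F' =
      ∑ x : SimpleGraph (Fin n) × SimpleGraph (Fin n),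
        (weight p x.1 * F x.1) * (weight p x.2 * F' x.2) := by
    rw [expect, expect, Fintype.sum_mul_sum, Fintype.sum_prod_type]
  have h2 : expect p (fun G => F G * F' G) * expect p (fun _ : SimpleGraph (Fin n) => 1) =
      ∑ x : SimpleGraph (Fin n) × SimpleGraph (Fin n),
        (weight p x.1 * (F x.1 * F' x.1)) * (weight p x.2 * 1) := by
    rw [expect, expect, Fintype.sum_mul_sum, Fintype.sum_prod_type]
  rw [← mul_one (expect p fun G => F G * F' G), ← expect_one (n := n) (p := p), h1, h2]
  refine Finset.sum_bij' (fun x _ => (mix A x.1 x.2, mix A x.2 x.1))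
    (fun x _ => (mix A x.1 x.2, mix A x.2 x.1)) (by simp) (by simp)
    (fun x _ => by simp [mix_mix]) (fun x _ => by simp [mix_mix]) ?_
  rintro ⟨G, H⟩ _
  have e1 : F (mix A G H) = F G := hF _ _ fun e he => by simp [mem_edgeSet_mix, he]
  have e2 : F' (mix A H G) = F' G := hF' _ _ fun e he => by
    have : e ∉ A := fun h => Set.disjoint_left.1 hA h he
    simp [mem_edgeSet_mix, this]
  simp only [e1, e2]
  linear_combination (- F G * F' G) * weight_mul_weight_mix (p := p) A G H

/-- The edges inside `T`. -/
def innerEdges (T : Finset (Fin n)) : Set (Sym2 (Fin n)) := {e | ∀ v ∈ e, v ∈ T}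

/-- The edges between `w` and `T`. -/
def starEdges (T : Finset (Fin n)) (w : Fin n) : Set (Sym2 (Fin n)) :=
  {e | ∃ v ∈ T, e = s(v, w)}

lemma disjoint_innerEdges_starEdges {T : Finset (Fin n)} {w : Fin n} (hw : w ∉ T) :
    Disjoint (innerEdges T) (starEdges T w) := by
  rw [Set.disjoint_left]
  rintro e he ⟨v, _, rfl⟩
  exact hw (he w (by simp))

lemma disjoint_starEdges {T : Finset (Fin n)} {w w' : Fin n} (hw : w ∉ T) (h : w ≠ w') :
    Disjoint (starEdges T w) (starEdges T w') := by
  rw [Set.disjoint_left]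
  rintro e ⟨v, hv, rfl⟩ ⟨v', hv', h'⟩
  rw [Sym2.eq_iff] at h'
  rcases h' with ⟨_, h'⟩ | ⟨_, rfl⟩
  · exact h h'
  · exact hw hv'

lemma expect_mul_prod {T : Finset (Fin n)} {F : SimpleGraph (Fin n) → ℝ}
    {f : Fin n → SimpleGraph (Fin n) → ℝ} (hF : DependsOnEdges (innerEdges T) F)
    (hf : ∀ w, DependsOnEdges (starEdges T w) (f w)) (s : Finset (Fin n)) (hs : Disjoint s T) :
    expect p (fun G => F G * ∏ w ∈ s, f w G) = expect p F * ∏ w ∈ s, expect p (f w) := by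
  induction s using Finset.induction_on with
  | empty => simp
  | insert w s hws ih =>
    rw [Finset.disjoint_insert_left] at hs
    rw [Finset.prod_insert hws, mul_left_comm, ← ih hs.2, mul_comm]
    simp only [Finset.prod_insert hws]
    rw [← expect_mul (A := innerEdges T ∪ ⋃ v ∈ s, starEdges T v) (A' := starEdges T w) ?_ ?_ (hf w)]
    · congr 1
      ext G
      ring
    · rw [Set.disjoint_union_left, Set.disjoint_iUnion₂_left]
      refine ⟨disjoint_innerEdges_starEdges hs.1, fun v hv => ?_⟩
      exact disjoint_starEdges (fun h => Finset.disjoint_left.1 hs.2 hv h)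
        (by rintro rfl; exact hws hv)
    · refine (hF.mono Set.subset_union_left).mul (DependsOnEdges.prod fun v hv => ?_)
      exact (hf v).mono
        ((Set.subset_biUnion_of_mem (u := fun v => starEdges T v) hv).trans
          Set.subset_union_right)

lemma expect_edgeInd {e : Sym2 (Fin n)} (he : ¬ e.IsDiag) : expect p (edgeInd e) = p := by
  simpa using expect_prod_edgeInd (p := p) {e} (by simpa using he)

lemma expect_edgeInd₂ {e f : Sym2 (Fin n)} (he : ¬ e.IsDiag) (hf : ¬ f.IsDiag) (hef : e ≠ f) :
    expect p (fun G => edgeInd e G * edgeInd f G) = p ^ 2 := by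
  simpa [hef] using expect_prod_edgeInd (p := p) {e, f} (by simp [he, hf])

lemma expect_edgeInd₃ {e f g : Sym2 (Fin n)} (he : ¬ e.IsDiag) (hf : ¬ f.IsDiag)
    (hg : ¬ g.IsDiag) (hef : e ≠ f) (heg : e ≠ g) (hfg : f ≠ g) :
    expect p (fun G => edgeInd e G * (edgeInd f G * edgeInd g G)) = p ^ 3 := by
  simpa [hef, heg, hfg] using expect_prod_edgeInd (p := p) {e, f, g} (by simp [he, hf, hg])

lemma expect_edgeInd₄ {e f g h : Sym2 (Fin n)} (he : ¬ e.IsDiag) (hf : ¬ f.IsDiag)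
    (hg : ¬ g.IsDiag) (hh : ¬ h.IsDiag) (hef : e ≠ f) (heg : e ≠ g) (heh : e ≠ h)
    (hfg : f ≠ g) (hfh : f ≠ h) (hgh : g ≠ h) :
    expect p (fun G => edgeInd e G * (edgeInd f G * (edgeInd g G * edgeInd h G))) = p ^ 4 := by
  simpa [hef, heg, heh, hfg, hfh, hgh] using
    expect_prod_edgeInd (p := p) {e, f, g, h} (by simp [he, hf, hg, hh])

lemma expect_nonedge {e : Sym2 (Fin n)} (he : ¬ e.IsDiag) :
    expect p (fun G => 1 - edgeInd e G) = 1 - p := by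
  rw [expect_sub, expect_one, expect_edgeInd he]

lemma expect_nonedge₂ {e f : Sym2 (Fin n)} (he : ¬ e.IsDiag) (hf : ¬ f.IsDiag) (hef : e ≠ f) :
    expect p (fun G => (1 - edgeInd e G) * (1 - edgeInd f G)) = (1 - p) ^ 2 := by
  have h : (fun G => (1 - edgeInd e G) * (1 - edgeInd f G)) =
      fun G => 1 - edgeInd e G - edgeInd f G + edgeInd e G * edgeInd f G := by
    ext G
    ring
  rw [h, expect_add, expect_sub, expect_sub, expect_one, expect_edgeInd he, expect_edgeInd hf,
    expect_edgeInd₂ he hf hef]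
  ring

lemma expect_noncherry {e f : Sym2 (Fin n)} (he : ¬ e.IsDiag) (hf : ¬ f.IsDiag) (hef : e ≠ f) :
    expect p (fun G => 1 - edgeInd e G * edgeInd f G) = 1 - p ^ 2 := by
  rw [expect_sub, expect_one, expect_edgeInd₂ he hf hef]

lemma expect_noncherry_noncherry_common {e f g : Sym2 (Fin n)} (he : ¬ e.IsDiag)
    (hf : ¬ f.IsDiag) (hg : ¬ g.IsDiag) (hef : e ≠ f) (heg : e ≠ g) (hfg : f ≠ g) :
    expect p (fun G => (1 - edgeInd e G * edgeInd f G) * (1 - edgeInd e G * edgeInd g G)) =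
      1 - 2 * p ^ 2 + p ^ 3 := by
  have h : (fun G => (1 - edgeInd e G * edgeInd f G) * (1 - edgeInd e G * edgeInd g G)) =
      fun G => 1 - edgeInd e G * edgeInd f G - edgeInd e G * edgeInd g G +
        edgeInd e G * (edgeInd f G * edgeInd g G) := by
    ext G
    rcases edgeInd_eq_zero_or_one e G with h | h <;> rw [h] <;> ring
  rw [h, expect_add, expect_sub, expect_sub, expect_one, expect_edgeInd₂ he hf hef,
    expect_edgeInd₂ he hg heg, expect_edgeInd₃ he hf hg hef heg hfg]
  ring

lemma expect_noncherry_noncherry {e f g h : Sym2 (Fin n)} (he : ¬ e.IsDiag) (hf : ¬ f.IsDiag)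
    (hg : ¬ g.IsDiag) (hh : ¬ h.IsDiag) (hef : e ≠ f) (heg : e ≠ g) (heh : e ≠ h)
    (hfg : f ≠ g) (hfh : f ≠ h) (hgh : g ≠ h) :
    expect p (fun G => (1 - edgeInd e G * edgeInd f G) * (1 - edgeInd g G * edgeInd h G)) =
      (1 - p ^ 2) ^ 2 := by
  have hh' : (fun G => (1 - edgeInd e G * edgeInd f G) * (1 - edgeInd g G * edgeInd h G)) =
      fun G => 1 - edgeInd e G * edgeInd f G - edgeInd g G * edgeInd h G +
        edgeInd e G * (edgeInd f G * (edgeInd g G * edgeInd h G)) := by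
    ext G
    ring
  rw [hh', expect_add, expect_sub, expect_sub, expect_one, expect_edgeInd₂ he hf hef,
    expect_edgeInd₂ hg hh hgh, expect_edgeInd₄ he hf hg hh hef heg heh hfg hfh hgh]
  ring

/-- The four edges `e, f, g, h` in cyclic order contain no two cyclically consecutive ones. -/
lemma expect_noncherry_cycle {e f g h : Sym2 (Fin n)} (he : ¬ e.IsDiag) (hf : ¬ f.IsDiag)
    (hg : ¬ g.IsDiag) (hh : ¬ h.IsDiag) (hef : e ≠ f) (heg : e ≠ g) (heh : e ≠ h)
    (hfg : f ≠ g) (hfh : f ≠ h) (hgh : g ≠ h) :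
    expect p (fun G => (1 - edgeInd e G * edgeInd f G) * (1 - edgeInd f G * edgeInd g G) *
      (1 - edgeInd g G * edgeInd h G) * (1 - edgeInd h G * edgeInd e G)) =
      1 - 4 * p ^ 2 + 4 * p ^ 3 - p ^ 4 := by
  have hh' : (fun G => (1 - edgeInd e G * edgeInd f G) * (1 - edgeInd f G * edgeInd g G) *
      (1 - edgeInd g G * edgeInd h G) * (1 - edgeInd h G * edgeInd e G)) =
      fun G => 1 - edgeInd e G * edgeInd f G - edgeInd f G * edgeInd g G -
        edgeInd g G * edgeInd h G - edgeInd h G * edgeInd e G +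
        edgeInd e G * (edgeInd f G * edgeInd g G) + edgeInd f G * (edgeInd g G * edgeInd h G) +
        edgeInd g G * (edgeInd h G * edgeInd e G) + edgeInd h G * (edgeInd e G * edgeInd f G) -
        edgeInd e G * (edgeInd f G * (edgeInd g G * edgeInd h G)) := by
    ext G
    rcases edgeInd_eq_zero_or_one e G with h1 | h1 <;>
    rcases edgeInd_eq_zero_or_one f G with h2 | h2 <;>
    rcases edgeInd_eq_zero_or_one g G with h3 | h3 <;>
    rcases edgeInd_eq_zero_or_one h G with h4 | h4 <;>
    rw [h1, h2, h3, h4] <;> ring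
  rw [hh']
  simp only [expect_add, expect_sub]
  rw [expect_one, expect_edgeInd₂ he hf hef, expect_edgeInd₂ hf hg hfg,
    expect_edgeInd₂ hg hh hgh, expect_edgeInd₂ hh he heh.symm,
    expect_edgeInd₃ he hf hg hef heg hfg, expect_edgeInd₃ hf hg hh hfg hfh hgh,
    expect_edgeInd₃ hg hh he hgh heg.symm heh.symm, expect_edgeInd₃ hh he hf heh.symm hfh.symm hef,
    expect_edgeInd₄ he hf hg hh hef heg heh hfg hfh hgh]
  ring

lemma dependsOnEdges_edgeInd {A : Set (Sym2 (Fin n))} {e : Sym2 (Fin n)} (he : e ∈ A) :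
    DependsOnEdges A (edgeInd e) :=
  fun G H hGH => by simp only [edgeInd, hGH e he]

lemma DependsOnEdges.one_sub {A : Set (Sym2 (Fin n))} {F : SimpleGraph (Fin n) → ℝ}
    (hF : DependsOnEdges A F) : DependsOnEdges A fun G => 1 - F G :=
  fun G H hGH => by simp only [hF G H hGH]

lemma mk_mem_innerEdges {T : Finset (Fin n)} {a b : Fin n} (ha : a ∈ T) (hb : b ∈ T) :
    s(a, b) ∈ innerEdges T := by
  simp [innerEdges, ha, hb]

lemma mk_mem_starEdges {T : Finset (Fin n)} {a : Fin n} (w : Fin n) (ha : a ∈ T) :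
    s(a, w) ∈ starEdges T w :=
  ⟨a, ha, rfl⟩

/-- The indicator that `a` and `b` are neither adjacent nor have a common neighbour. -/
noncomputable def farInd (a b : Fin n) (G : SimpleGraph (Fin n)) : ℝ :=
  (1 - edgeInd s(a, b) G) * ∏ w ∈ ({a, b} : Finset (Fin n))ᶜ,
    (1 - edgeInd s(a, w) G * edgeInd s(b, w) G)

lemma noncherry_mem_Icc (e f : Sym2 (Fin n)) (G : SimpleGraph (Fin n)) :
    1 - edgeInd e G * edgeInd f G ∈ Set.Icc (0 : ℝ) 1 := by
  rcases edgeInd_eq_zero_or_one e G with h | h <;>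
  rcases edgeInd_eq_zero_or_one f G with h' | h' <;> simp [h, h']

lemma nonedge_mem_Icc (e : Sym2 (Fin n)) (G : SimpleGraph (Fin n)) :
    1 - edgeInd e G ∈ Set.Icc (0 : ℝ) 1 := by
  rcases edgeInd_eq_zero_or_one e G with h | h <;> simp [h]

lemma farInd_comm (a b : Fin n) : farInd a b = farInd b a := by
  ext G
  simp only [farInd, Sym2.eq_swap (a := a) (b := b), Finset.pair_comm a b]
  congr 1
  exact Finset.prod_congr rfl fun w _ => by ring

lemma farInd_mem_Icc (a b : Fin n) (G : SimpleGraph (Fin n)) :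
    farInd a b G ∈ Set.Icc (0 : ℝ) 1 := by
  have h := nonedge_mem_Icc s(a, b) G
  have h0 : 0 ≤ ∏ w ∈ ({a, b} : Finset (Fin n))ᶜ, (1 - edgeInd s(a, w) G * edgeInd s(b, w) G) :=
    Finset.prod_nonneg fun w _ => (noncherry_mem_Icc _ _ G).1
  have h1 : ∏ w ∈ ({a, b} : Finset (Fin n))ᶜ, (1 - edgeInd s(a, w) G * edgeInd s(b, w) G) ≤ 1 :=
    Finset.prod_le_one (fun w _ => (noncherry_mem_Icc _ _ G).1)
      fun w _ => (noncherry_mem_Icc _ _ G).2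
  exact ⟨mul_nonneg h.1 h0, mul_le_one₀ h.2 h0 h1⟩

lemma expect_farInd {a b : Fin n} (hab : a ≠ b) :
    expect p (farInd a b) = (1 - p) * (1 - p ^ 2) ^ (n - 2) := by
  unfold farInd
  rw [expect_mul_prod (T := {a, b})
    (dependsOnEdges_edgeInd (mk_mem_innerEdges (by simp) (by simp))).one_sub
    (fun w => ((dependsOnEdges_edgeInd (mk_mem_starEdges w (by simp))).mul
      (dependsOnEdges_edgeInd (mk_mem_starEdges w (by simp)))).one_sub) _ disjoint_compl_left,
    expect_nonedge (by simpa using hab), Finset.prod_congr rfl (g := fun _ => 1 - p ^ 2) ?_,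
    Finset.prod_const, Finset.card_compl, Finset.card_pair hab, Fintype.card_fin]
  intro w hw
  simp only [Finset.mem_compl, Finset.mem_insert, Finset.mem_singleton, not_or] at hw
  exact expect_noncherry (by simpa using Ne.symm hw.1) (by simpa using Ne.symm hw.2)
    (by simpa using ⟨hab, fun h => absurd h.symm hw.1⟩)

lemma farInd_mul_self_le (a b : Fin n) (G : SimpleGraph (Fin n)) :
    farInd a b G * farInd a b G ≤ farInd a b G :=
  mul_le_of_le_one_left (farInd_mem_Icc a b G).1 (farInd_mem_Icc a b G).2

/-- The part of the product defining `farInd` over a smaller set of vertices is larger. -/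
lemma prod_noncherry_le {s t : Finset (Fin n)} (hst : s ⊆ t) (a b : Fin n)
    (G : SimpleGraph (Fin n)) :
    ∏ w ∈ t, (1 - edgeInd s(a, w) G * edgeInd s(b, w) G) ≤
      ∏ w ∈ s, (1 - edgeInd s(a, w) G * edgeInd s(b, w) G) := by
  rw [← Finset.prod_sdiff hst]
  exact mul_le_of_le_one_left (Finset.prod_nonneg fun w _ => (noncherry_mem_Icc _ _ G).1)
    (Finset.prod_le_one (fun w _ => (noncherry_mem_Icc _ _ G).1)
      fun w _ => (noncherry_mem_Icc _ _ G).2)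

lemma expect_farInd_mul_farInd_common (hp0 : 0 ≤ p) (hp1 : p ≤ 1) {a b c : Fin n}
    (hab : a ≠ b) (hac : a ≠ c) (hbc : b ≠ c) :
    expect p (fun G => farInd a b G * farInd a c G) ≤
      (1 - p) ^ 2 * (1 - 2 * p ^ 2 + p ^ 3) ^ (n - 3) := by
  set T : Finset (Fin n) := {a, b, c} with hT
  have hcard : T.card = 3 := by simp [hT, hab, hac, hbc]
  have hle : ∀ G, farInd a b G * farInd a c G ≤
      ((1 - edgeInd s(a, b) G) * (1 - edgeInd s(a, c) G)) *
        ∏ w ∈ Tᶜ, ((1 - edgeInd s(a, w) G * edgeInd s(b, w) G) *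
          (1 - edgeInd s(a, w) G * edgeInd s(c, w) G)) := by
    intro G
    have h1 := prod_noncherry_le (s := Tᶜ) (t := {a, b}ᶜ) (by
      rw [Finset.compl_subset_compl]; intro x; simp [hT]; tauto) a b G
    have h2 := prod_noncherry_le (s := Tᶜ) (t := {a, c}ᶜ) (by
      rw [Finset.compl_subset_compl]; intro x; simp [hT]; tauto) a c G
    rw [Finset.prod_mul_distrib, mul_mul_mul_comm]
    refine mul_le_mul (mul_le_mul_of_nonneg_left h1 (nonedge_mem_Icc _ G).1)
      (mul_le_mul_of_nonneg_left h2 (nonedge_mem_Icc _ G).1) (farInd_mem_Icc a c G).1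
      (mul_nonneg (nonedge_mem_Icc _ G).1
        (Finset.prod_nonneg fun w _ => (noncherry_mem_Icc _ _ G).1))
  refine (expect_mono hp0 hp1 hle).trans_eq ?_
  have hin : ∀ {u v}, u ∈ T → v ∈ T → DependsOnEdges (innerEdges T) (edgeInd s(u, v)) :=
    fun hu hv => dependsOnEdges_edgeInd (mk_mem_innerEdges hu hv)
  have hst : ∀ w, ∀ {u}, u ∈ T → DependsOnEdges (starEdges T w) (edgeInd s(u, w)) :=
    fun w _ hu => dependsOnEdges_edgeInd (mk_mem_starEdges w hu)
  have ha : a ∈ T := by simp [hT]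
  have hb : b ∈ T := by simp [hT]
  have hc : c ∈ T := by simp [hT]
  rw [expect_mul_prod (T := T) ((hin ha hb).one_sub.mul (hin ha hc).one_sub)
    (fun w => ((hst w ha).mul (hst w hb)).one_sub.mul ((hst w ha).mul (hst w hc)).one_sub) _
    disjoint_compl_left,
    expect_nonedge₂ (by simpa using hab) (by simpa using hac) (by simp [hbc, hac]),
    Finset.prod_congr rfl (g := fun _ => 1 - 2 * p ^ 2 + p ^ 3) ?_,
    Finset.prod_const, Finset.card_compl, hcard, Fintype.card_fin]
  intro w hw
  simp only [hT, Finset.mem_compl, Finset.mem_insert, Finset.mem_singleton, not_or] at hw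
  obtain ⟨hwa, hwb, hwc⟩ := hw
  refine expect_noncherry_noncherry_common ?_ ?_ ?_ ?_ ?_ ?_ <;>
    simp [Ne.symm hwa, Ne.symm hwb, Ne.symm hwc, hab, hac, hbc]

lemma expect_farInd_mul_farInd_disjoint {a b c d : Fin n}
    (hab : a ≠ b) (hac : a ≠ c) (had : a ≠ d) (hbc : b ≠ c) (hbd : b ≠ d) (hcd : c ≠ d) :
    expect p (fun G => farInd a b G * farInd c d G) =
      (1 - p) ^ 2 * (1 - 4 * p ^ 2 + 4 * p ^ 3 - p ^ 4) * ((1 - p ^ 2) ^ 2) ^ (n - 4) := by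
  set T : Finset (Fin n) := {a, b, c, d} with hT
  have hcard : T.card = 4 := by simp [hT, hab, hac, had, hbc, hbd, hcd]
  have heq : (fun G => farInd a b G * farInd c d G) = fun G =>
      (((1 - edgeInd s(a, b) G) * (1 - edgeInd s(c, d) G)) *
        ((1 - edgeInd s(a, c) G * edgeInd s(b, c) G) *
          (1 - edgeInd s(b, c) G * edgeInd s(b, d) G) *
          (1 - edgeInd s(b, d) G * edgeInd s(a, d) G) *
          (1 - edgeInd s(a, d) G * edgeInd s(a, c) G))) *
        ∏ w ∈ Tᶜ, ((1 - edgeInd s(a, w) G * edgeInd s(b, w) G) *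
          (1 - edgeInd s(c, w) G * edgeInd s(d, w) G)) := by
    ext G
    have h1 : ({a, b} : Finset (Fin n))ᶜ = insert c (insert d Tᶜ) := by
      ext x
      simp only [hT, Finset.mem_compl, Finset.mem_insert, Finset.mem_singleton]
      grind
    have h2 : ({c, d} : Finset (Fin n))ᶜ = insert a (insert b Tᶜ) := by
      ext x
      simp only [hT, Finset.mem_compl, Finset.mem_insert, Finset.mem_singleton]
      grind
    rw [farInd, farInd, h1, h2, Finset.prod_insert (by simp [hT, hcd]),
      Finset.prod_insert (by simp [hT]), Finset.prod_insert (by simp [hT, hab]),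
      Finset.prod_insert (by simp [hT]), Finset.prod_mul_distrib,
      Sym2.eq_swap (a := c) (b := a), Sym2.eq_swap (a := d) (b := a),
      Sym2.eq_swap (a := c) (b := b), Sym2.eq_swap (a := d) (b := b)]
    ring
  have hin : ∀ {u v}, u ∈ T → v ∈ T → DependsOnEdges (innerEdges T) (edgeInd s(u, v)) :=
    fun hu hv => dependsOnEdges_edgeInd (mk_mem_innerEdges hu hv)
  have hst : ∀ w, ∀ {u}, u ∈ T → DependsOnEdges (starEdges T w) (edgeInd s(u, w)) :=
    fun w _ hu => dependsOnEdges_edgeInd (mk_mem_starEdges w hu)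
  have ha : a ∈ T := by simp [hT]
  have hb : b ∈ T := by simp [hT]
  have hc : c ∈ T := by simp [hT]
  have hd : d ∈ T := by simp [hT]
  have hA : ∀ {A : Set (Sym2 (Fin n))} {e}, e ∈ A → DependsOnEdges A (edgeInd e) :=
    dependsOnEdges_edgeInd
  rw [heq, expect_mul_prod (T := T)
    (((hin ha hb).one_sub.mul (hin hc hd).one_sub).mul
      (((((hin ha hc).mul (hin hb hc)).one_sub.mul ((hin hb hc).mul (hin hb hd)).one_sub).mul
        ((hin hb hd).mul (hin ha hd)).one_sub).mul ((hin ha hd).mul (hin ha hc)).one_sub))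
    (fun w => ((hst w ha).mul (hst w hb)).one_sub.mul ((hst w hc).mul (hst w hd)).one_sub) _
    disjoint_compl_left,
    expect_mul (A := {s(a, b), s(c, d)}) (A' := {s(a, c), s(b, c), s(b, d), s(a, d)}) ?_
      ((hA (by simp)).one_sub.mul (hA (by simp)).one_sub)
      (((((hA (by simp)).mul (hA (by simp))).one_sub.mul
        ((hA (by simp)).mul (hA (by simp))).one_sub).mul
        ((hA (by simp)).mul (hA (by simp))).one_sub).mul
        ((hA (by simp)).mul (hA (by simp))).one_sub),
    expect_nonedge₂ (by simpa using hab) (by simpa using hcd) (by simp [hac, had]),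
    expect_noncherry_cycle, Finset.prod_congr rfl (g := fun _ => (1 - p ^ 2) ^ 2) ?_,
    Finset.prod_const, Finset.card_compl, hcard, Fintype.card_fin]
  · intro w hw
    simp only [hT, Finset.mem_compl, Finset.mem_insert, Finset.mem_singleton, not_or] at hw
    obtain ⟨hwa, hwb, hwc, hwd⟩ := hw
    refine expect_noncherry_noncherry ?_ ?_ ?_ ?_ ?_ ?_ ?_ ?_ ?_ ?_ <;>
      simp [Ne.symm hwa, Ne.symm hwb, Ne.symm hwc, Ne.symm hwd, hab, hac, had, hbc, hbd, hcd]
  all_goals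
    simp [hab, hac, had, hbc, hbd, hcd, hab.symm, hac.symm, had.symm, hbc.symm, hbd.symm,
      hcd.symm]

/-- Two distinct vertices of a graph of diameter at most two are adjacent or have a common
neighbour. -/
lemma farInd_eq_zero {G : SimpleGraph (Fin n)} (hG : G.Connected) (hd : ∀ u v, G.dist u v ≤ 2)
    {a b : Fin n} (hab : a ≠ b) : farInd a b G = 0 := by
  by_cases hadj : G.Adj a b
  · simp [farInd, edgeInd, hadj]
  obtain ⟨w, haw, hwb⟩ : ∃ w, G.Adj a w ∧ G.Adj w b := by
    obtain ⟨q, hq⟩ := hG.exists_walk_length_eq_dist a b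
    have hq2 := hq.trans_le (hd a b)
    match q, hq2 with
    | .nil, _ => exact absurd rfl hab
    | .cons h .nil, _ => exact absurd h hadj
    | .cons h (.cons h' .nil), _ => exact ⟨_, h, h'⟩
    | .cons _ (.cons _ (.cons _ q)), hl => simp at hl
  refine mul_eq_zero_of_right _ (Finset.prod_eq_zero (i := w) ?_ ?_)
  · simp [haw.ne', hwb.ne]
  · simp [edgeInd, haw, hwb.symm]

/-- The number of ordered pairs of distinct vertices which are neither adjacent nor have a
common neighbour. -/
noncomputable def farCount (G : SimpleGraph (Fin n)) : ℝ :=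
  ∑ x ∈ (Finset.univ : Finset (Fin n)).offDiag, farInd x.1 x.2 G

lemma card_offDiag (n : ℕ) :
    ((Finset.univ : Finset (Fin n)).offDiag.card : ℝ) = n * (n - 1) := by
  rw [Finset.offDiag_card, Finset.card_univ, Fintype.card_fin, Nat.cast_sub (Nat.le_mul_self n)]
  push_cast
  ring

lemma expect_farCount :
    expect p (farCount (n := n)) = n * (n - 1) * ((1 - p) * (1 - p ^ 2) ^ (n - 2)) := by
  unfold farCount
  rw [expect_sum, Finset.sum_congr rfl
    (g := fun _ => (1 - p) * (1 - p ^ 2) ^ (n - 2)) fun x hx => ?_, Finset.sum_const,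
    nsmul_eq_mul, card_offDiag]
  exact expect_farInd (Finset.mem_offDiag.1 hx).2.2

lemma diam2Prob_mul_le (hp0 : 0 ≤ p) (hp1 : p ≤ 1) :
    diam2Prob n p * expect p (farCount (n := n)) ^ 2 ≤
      expect p (fun G : SimpleGraph (Fin n) => farCount G * farCount G) -
        expect p (farCount (n := n)) ^ 2 := by
  set μ := expect p (farCount (n := n)) with hμ
  have h1 : diam2Prob n p * μ ^ 2 ≤
      expect p fun G : SimpleGraph (Fin n) => (farCount G * farCount G - 2 * μ * farCount G) +
        μ ^ 2 * 1 := by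
    rw [diam2Prob, Finset.sum_mul]
    refine Finset.sum_le_sum fun G _ => ?_
    have hw := weight_nonneg hp0 hp1 G
    split_ifs with h
    · have h0 : farCount G = 0 := Finset.sum_eq_zero fun x hx =>
        farInd_eq_zero h.1 h.2 (Finset.mem_offDiag.1 hx).2.2
      simp [h0, weight_eq]
    · rw [zero_mul]
      refine mul_nonneg hw ?_
      nlinarith [sq_nonneg (farCount G - μ)]
  rw [expect_add, expect_sub, expect_const_mul, expect_const_mul, expect_one, ← hμ] at h1
  linarith

/-- Bound for the correlation of two pairs, by the way in which they overlap. -/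
lemma expect_farInd_mul_farInd_le (hp0 : 0 ≤ p) (hp1 : p ≤ 1) {a b c d : Fin n} (hab : a ≠ b)
    (hcd : c ≠ d) {D S m : ℝ}
    (hD : D = (1 - p) ^ 2 * (1 - 4 * p ^ 2 + 4 * p ^ 3 - p ^ 4) * ((1 - p ^ 2) ^ 2) ^ (n - 4))
    (hS : S = (1 - p) ^ 2 * (1 - 2 * p ^ 2 + p ^ 3) ^ (n - 3))
    (hm : m = (1 - p) * (1 - p ^ 2) ^ (n - 2)) (hD0 : 0 ≤ D) (hS0 : 0 ≤ S) :
    expect p (fun G => farInd a b G * farInd c d G) ≤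
      D + ((if c = a then S else 0) + (if c = b then S else 0) + (if d = a then S else 0) +
        (if d = b then S else 0)) +
        ((if c = a then if d = b then m else 0 else 0) +
          (if c = b then if d = a then m else 0 else 0)) := by
  have hsame : expect p (fun G => farInd a b G * farInd a b G) ≤ m := by
    rw [hm, ← expect_farInd hab]
    exact expect_mono hp0 hp1 (farInd_mul_self_le a b)
  have hcommon : ∀ {a b c : Fin n}, a ≠ b → a ≠ c → b ≠ c →
      expect p (fun G => farInd a b G * farInd a c G) ≤ S := fun h1 h2 h3 =>
    hS ▸ expect_farInd_mul_farInd_common hp0 hp1 h1 h2 h3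
  by_cases hca : c = a
  · subst hca
    by_cases hdb : d = b
    · subst hdb
      simp [hab, hab.symm]
      linarith
    · have := hcommon hab hcd (Ne.symm hdb)
      simp [hab, hdb, hcd.symm]
      linarith
  by_cases hcb : c = b
  · subst hcb
    rw [farInd_comm a c]
    by_cases hda : d = a
    · subst hda
      rw [farInd_comm d c] at hsame
      simp [hab, hab.symm]
      linarith
    · have := hcommon hab.symm hcd (Ne.symm hda)
      simp [hab.symm, hda, hcd.symm]
      linarith
  rw [farInd_comm c d]
  by_cases hda : d = a
  · subst hda
    have := hcommon hab hcd.symm (Ne.symm hcb)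
    simp [hca, hcb, hab]
    linarith
  by_cases hdb : d = b
  · subst hdb
    rw [farInd_comm a d]
    have := hcommon hab.symm hcd.symm (Ne.symm hca)
    simp [hca, hcb, hda]
    linarith
  rw [farInd_comm d c, expect_farInd_mul_farInd_disjoint hab (Ne.symm hca) (Ne.symm hda)
    (Ne.symm hcb) (Ne.symm hdb) hcd, ← hD]
  simp [hca, hcb, hda, hdb]

lemma sum_offDiag (f : Fin n → Fin n → ℝ) :
    ∑ x ∈ (Finset.univ : Finset (Fin n)).offDiag, f x.1 x.2 =
      ∑ c, ∑ d ∈ Finset.univ.erase c, f c d :=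
  Finset.sum_finset_product _ _ _ (by simp [eq_comm])

lemma sum_offDiag_fst (a : Fin n) (S : ℝ) :
    ∑ x ∈ (Finset.univ : Finset (Fin n)).offDiag, (if x.1 = a then S else 0) = (n - 1) * S := by
  have hn : 1 ≤ n := a.pos
  rw [sum_offDiag fun c _ => if c = a then S else 0]
  simp [Finset.card_erase_of_mem, Nat.cast_sub hn]

lemma sum_offDiag_snd (a : Fin n) (S : ℝ) :
    ∑ x ∈ (Finset.univ : Finset (Fin n)).offDiag, (if x.2 = a then S else 0) = (n - 1) * S := by
  rw [← sum_offDiag_fst a S]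
  exact Finset.sum_bij' (fun x _ => x.swap) (fun x _ => x.swap) (by simp [eq_comm])
    (by simp [eq_comm]) (by simp) (by simp) (by simp)

lemma sum_offDiag_pair {a b : Fin n} (hab : a ≠ b) (m : ℝ) :
    ∑ x ∈ (Finset.univ : Finset (Fin n)).offDiag,
      (if x.1 = a then if x.2 = b then m else 0 else 0) = m := by
  rw [Finset.sum_eq_single (a, b)]
  · simp
  · rintro ⟨c, d⟩ _ h
    by_cases hc : c = a <;> by_cases hd : d = b <;> simp_all
  · simp [hab]

lemma expect_farCount_sq_le (hp0 : 0 ≤ p) (hp1 : p ≤ 1) {D S m : ℝ}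
    (hD : D = (1 - p) ^ 2 * (1 - 4 * p ^ 2 + 4 * p ^ 3 - p ^ 4) * ((1 - p ^ 2) ^ 2) ^ (n - 4))
    (hS : S = (1 - p) ^ 2 * (1 - 2 * p ^ 2 + p ^ 3) ^ (n - 3))
    (hm : m = (1 - p) * (1 - p ^ 2) ^ (n - 2)) (hD0 : 0 ≤ D) (hS0 : 0 ≤ S) :
    expect p (fun G : SimpleGraph (Fin n) => farCount G * farCount G) ≤
      n * (n - 1) * (n * (n - 1) * D + 4 * ((n - 1) * S) + 2 * m) := by
  simp only [farCount, Finset.sum_mul_sum]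
  rw [expect_sum, ← card_offDiag, ← nsmul_eq_mul]
  refine Finset.sum_le_card_nsmul _ _ _ fun x hx => ?_
  have hx' := (Finset.mem_offDiag.1 hx).2.2
  rw [expect_sum]
  refine (Finset.sum_le_sum fun y hy => expect_farInd_mul_farInd_le hp0 hp1 hx'
    (Finset.mem_offDiag.1 hy).2.2 hD hS hm hD0 hS0).trans_eq ?_
  simp only [Finset.sum_add_distrib, sum_offDiag_fst, sum_offDiag_snd, sum_offDiag_pair hx',
    sum_offDiag_pair hx'.symm, Finset.sum_const, nsmul_eq_mul]
  ring

lemma diam2Prob_le_one (hp0 : 0 ≤ p) (hp1 : p ≤ 1) : diam2Prob n p ≤ 1 := by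
  rw [← expect_one (n := n) (p := p)]
  refine Finset.sum_le_sum fun G _ => ?_
  rw [mul_one, weight_eq]
  split_ifs
  · exact le_rfl
  · rw [← weight_eq]
    exact weight_nonneg hp0 hp1 G

lemma variance_coeff_le (hp0 : 0 < p) (hp1 : p < 1) :
    (4 + p - 2 * p ^ 2 - p ^ 3) / (1 + p) ^ 4 +
      4 * (1 / ((1 + p) ^ 2 * ((1 - p) ^ 2 + p ^ 3))) ≤ 8 := by
  have hs : 0 < (1 - p) ^ 2 + p ^ 3 := by positivity
  have h1 : 1 + ((1 - p) ^ 2 + p ^ 3) ≤ 2 * (1 + p) ^ 2 * ((1 - p) ^ 2 + p ^ 3) := by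
    have : 0 ≤ p * (2 - 5 * p + p ^ 2 + 6 * p ^ 3 + 2 * p ^ 4) := by
      refine mul_nonneg hp0.le ?_
      nlinarith [mul_nonneg hp0.le (sq_nonneg (2 * p - 1)), sq_nonneg (2 * p - 1),
        pow_pos hp0 3, pow_pos hp0 4, sq_nonneg (5 * p - 2)]
    nlinarith
  have h2 : 4 + p - 2 * p ^ 2 - p ^ 3 ≤ 4 * (1 + p) ^ 2 := by nlinarith [pow_pos hp0 3]
  calc _ ≤ 4 * (1 + p) ^ 2 / (1 + p) ^ 4 +
        4 * (1 / ((1 + p) ^ 2 * ((1 - p) ^ 2 + p ^ 3))) := by gcongr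
    _ = 4 * (1 + ((1 - p) ^ 2 + p ^ 3)) / ((1 + p) ^ 2 * ((1 - p) ^ 2 + p ^ 3)) := by
        field_simp
        ring
    _ ≤ 8 := by
        rw [div_le_iff₀ (by positivity)]
        linarith

end Diam2

/-- Turán-sieve upper bound:
`P(n,p) ≤ 2/((n-1)²(1-p²)ⁿ(1-p)) + (8/n)(1 + p³/(1-p)²)ⁿ`. -/
theorem diam2Prob_upper (n : ℕ) (hn : 2 ≤ n) (p : ℝ) (hp0 : 0 < p) (hp1 : p < 1) :
    diam2Prob n p ≤
      2 / (((n : ℝ) - 1) ^ 2 * (1 - p ^ 2) ^ n * (1 - p)) +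
        (8 / (n : ℝ)) * (1 + p ^ 3 / (1 - p) ^ 2) ^ n := by
  have hn0 : (2 : ℝ) ≤ n := by exact_mod_cast hn
  have hq : 0 < 1 - p := by linarith
  have hr : 0 < 1 - p ^ 2 := by nlinarith
  have hr1 : 1 - p ^ 2 ≤ 1 := by nlinarith
  set t := p ^ 3 / (1 - p) ^ 2 with ht
  have ht0 : 0 < t := by positivity
  have hN : (0 : ℝ) < n * (n - 1) := by nlinarith
  have hfirst : 0 < 2 / (((n : ℝ) - 1) ^ 2 * (1 - p ^ 2) ^ n * (1 - p)) := by
    have : (0 : ℝ) < n - 1 := by linarith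
    positivity
  rcases lt_or_ge n 9 with hn9 | hn9
  · have h8 : (n : ℝ) ≤ 8 := by exact_mod_cast Nat.le_of_lt_succ hn9
    have h1 : 1 ≤ 8 / (n : ℝ) := (one_le_div (by linarith)).2 h8
    have h2 : 1 ≤ (1 + t) ^ n := one_le_pow₀ (by linarith)
    nlinarith [Diam2.diam2Prob_le_one (n := n) hp0.le hp1.le]
  obtain ⟨k, rfl⟩ : ∃ k, n = k + 4 := ⟨n - 4, by omega⟩
  set N : ℝ := ((k + 4 : ℕ) : ℝ) with hNdef
  have hz : 0 < 1 - 4 * p ^ 2 + 4 * p ^ 3 - p ^ 4 := by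
    have : 1 - 4 * p ^ 2 + 4 * p ^ 3 - p ^ 4 = (1 - p) ^ 2 * (1 + p * (2 - p)) := by ring
    rw [this]
    have : 0 < p * (2 - p) := mul_pos hp0 (by linarith)
    positivity
  have hy : 0 < 1 - 2 * p ^ 2 + p ^ 3 := by
    have : 1 - 2 * p ^ 2 + p ^ 3 = (1 - p ^ 2) ^ 2 + p ^ 3 * (1 - p) := by ring
    rw [this]
    positivity
  obtain ⟨D, hD⟩ : ∃ D, D = (1 - p) ^ 2 * (1 - 4 * p ^ 2 + 4 * p ^ 3 - p ^ 4) *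
    ((1 - p ^ 2) ^ 2) ^ (k + 4 - 4) := ⟨_, rfl⟩
  obtain ⟨S, hS⟩ : ∃ S, S = (1 - p) ^ 2 * (1 - 2 * p ^ 2 + p ^ 3) ^ (k + 4 - 3) := ⟨_, rfl⟩
  obtain ⟨m, hm⟩ : ∃ m, m = (1 - p) * (1 - p ^ 2) ^ (k + 4 - 2) := ⟨_, rfl⟩
  have hD0 : 0 ≤ D := by rw [hD]; positivity
  have hS0 : 0 ≤ S := by rw [hS]; positivity
  have hm0 : 0 < m := by rw [hm]; positivity
  have hvar := Diam2.diam2Prob_mul_le (n := k + 4) hp0.le hp1.le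
  have hsq := Diam2.expect_farCount_sq_le (n := k + 4) hp0.le hp1.le hD hS hm hD0 hS0
  rw [Diam2.expect_farCount, ← hm, ← hNdef] at hvar
  rw [← hNdef] at hsq
  set c := (4 + p - 2 * p ^ 2 - p ^ 3) / (1 + p) ^ 4 with hc
  set K := 1 / ((1 + p) ^ 2 * ((1 - p) ^ 2 + p ^ 3)) with hK
  have hcK : c + 4 * K ≤ 8 := Diam2.variance_coeff_le hp0 hp1
  have hc0 : 0 ≤ c := by
    have : 0 < 4 + p - 2 * p ^ 2 - p ^ 3 := by nlinarith [pow_lt_one₀ hp0.le hp1 three_ne_zero]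
    positivity
  have hK0 : 0 ≤ K := by positivity
  have hr' : 1 - p ^ 2 = (1 - p) * (1 + p) := by ring
  have hDm : D = m ^ 2 * (1 + c * t) := by
    have : 1 - 4 * p ^ 2 + 4 * p ^ 3 - p ^ 4 = (1 - p ^ 2) ^ 4 * (1 + c * t) := by
      rw [hr', hc, ht]
      field_simp
      ring
    rw [hD, hm, this, Nat.add_sub_cancel, show k + 4 - 2 = k + 2 from rfl]
    generalize 1 - p ^ 2 = r
    ring
  have hSm : S ≤ m ^ 2 * (K * (1 + t) ^ (k + 4)) := by
    have h1 : 1 - 2 * p ^ 2 + p ^ 3 ≤ (1 - p ^ 2) ^ 2 * (1 + t) := by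
      have : (1 - p ^ 2) ^ 2 * (1 + t) = (1 - p ^ 2) ^ 2 + p ^ 3 * (1 + p) ^ 2 := by
        rw [hr', ht]
        field_simp
      rw [this]
      nlinarith [mul_pos (pow_pos hp0 3) hp0, mul_pos (pow_pos hp0 3) (pow_pos hp0 2)]
    have h2 : (1 - p ^ 2) ^ 2 * (K * (1 + t)) = 1 := by
      have : 0 < (1 - p) ^ 2 + p ^ 3 := by positivity
      rw [hr', hK, ht]
      field_simp
    calc S ≤ (1 - p) ^ 2 * ((1 - p ^ 2) ^ 2 * (1 + t)) ^ (k + 1) := by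
          rw [hS, show k + 4 - 3 = k + 1 from rfl]
          gcongr
      _ = (1 - p) ^ 2 * ((1 - p ^ 2) ^ 2 * (1 + t)) ^ (k + 1) *
            ((1 - p ^ 2) ^ 2 * (K * (1 + t))) := by rw [h2, mul_one]
      _ = m ^ 2 * (K * (1 + t) ^ (k + 2)) := by
          rw [hm, show k + 4 - 2 = k + 2 from rfl, mul_pow _ (1 + t)]
          generalize 1 - p ^ 2 = r
          generalize 1 + t = u
          ring
      _ ≤ m ^ 2 * (K * (1 + t) ^ (k + 4)) := by
          gcongr
          · linarith
          · norm_num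
  have hbern : N * t ≤ (1 + t) ^ (k + 4) := by
    have := one_add_mul_le_pow (a := t) (by linarith) (k + 4)
    rw [← hNdef] at this
    linarith
  have hN0 : 0 < N := by linarith
  have hN1 : 0 < N - 1 := by linarith
  have hle : diam2Prob (k + 4) p ≤
      c * t + 4 / N * (K * (1 + t) ^ (k + 4)) + 2 / (N * (N - 1) * m) := by
    refine le_of_mul_le_mul_right (a := (N * (N - 1) * m) ^ 2) ?_ (by positivity)
    have h1 : (c * t + 4 / N * (K * (1 + t) ^ (k + 4)) + 2 / (N * (N - 1) * m)) *
        (N * (N - 1) * m) ^ 2 = N * (N - 1) * (N * (N - 1) * (m ^ 2 * (1 + c * t)) +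
          4 * ((N - 1) * (m ^ 2 * (K * (1 + t) ^ (k + 4)))) + 2 * m) -
          (N * (N - 1) * m) ^ 2 := by
      field_simp
      ring
    rw [h1, ← hDm]
    refine hvar.trans (sub_le_sub_right (hsq.trans ?_) _)
    gcongr
  have hlast : 2 / (N * (N - 1) * m) ≤ 2 / ((N - 1) ^ 2 * (1 - p ^ 2) ^ (k + 4) * (1 - p)) := by
    have h1 : (1 - p ^ 2) ^ (k + 4) ≤ (1 - p ^ 2) ^ (k + 4 - 2) :=
      pow_le_pow_of_le_one hr.le hr1 (by omega)
    have h2 : (N - 1) ^ 2 ≤ N * (N - 1) := by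
      rw [sq]
      exact mul_le_mul_of_nonneg_right (by linarith) hN1.le
    rw [hm, mul_comm (1 - p), ← mul_assoc]
    gcongr
  have hmain : c * t + 4 / N * (K * (1 + t) ^ (k + 4)) ≤ 8 / N * (1 + t) ^ (k + 4) := by
    have h1 : c * t ≤ c / N * (1 + t) ^ (k + 4) := by
      rw [div_mul_eq_mul_div c N, le_div_iff₀ hN0, mul_assoc, mul_comm t]
      exact mul_le_mul_of_nonneg_left hbern hc0
    calc _ ≤ c / N * (1 + t) ^ (k + 4) + 4 / N * (K * (1 + t) ^ (k + 4)) := by gcongr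
      _ = (c + 4 * K) / N * (1 + t) ^ (k + 4) := by ring
      _ ≤ _ := by gcongr
  linarith
end

section
/- Let p : ℕ → (0,1) be a sequence of edge probabilities with p(n) → 0 as n → ∞. Then for every ε > 0 there exists N such that for all n ≥ N, P(n,p(n)) ≥ 1 − (1+ε)·(n²/2)·e^{−n·p(n)²}. -/
open scoped Classical

open Finset in
/-- The expectation of `F` evaluated at a random subset of `T` that contains each element
independently with probability `p`. -/
noncomputable def randomSubsetExp {α : Type*} (p : ℝ) (T : Finset α) (F : Finset α → ℝ) : ℝ :=
  ∑ s ∈ T.powerset, p ^ #s * (1 - p) ^ (#T - #s) * F s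

open Finset in
theorem randomSubsetExp_congr {α : Type*} {p : ℝ} {T : Finset α} {F G : Finset α → ℝ}
    (h : ∀ s ⊆ T, F s = G s) : randomSubsetExp p T F = randomSubsetExp p T G :=
  sum_congr rfl fun s hs => by rw [h s (mem_powerset.1 hs)]

open Finset in
theorem randomSubsetExp_one {α : Type*} (p : ℝ) (T : Finset α) :
    randomSubsetExp p T (fun _ => 1) = 1 := by
  simp [randomSubsetExp, sum_pow_mul_eq_add_pow]

open Finset in
theorem randomSubsetExp_zero {α : Type*} (p : ℝ) (T : Finset α) :
    randomSubsetExp p T (fun _ => 0) = 0 := by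
  simp [randomSubsetExp]

open Finset in
theorem randomSubsetExp_insert {α : Type*} [DecidableEq α] (p : ℝ) {T : Finset α} {a : α} (ha : a ∉ T)
    (F : Finset α → ℝ) :
    randomSubsetExp p (insert a T) F =
      (1 - p) * randomSubsetExp p T F + p * randomSubsetExp p T (fun s => F (insert a s)) := by
  unfold randomSubsetExp
  rw [sum_powerset_insert ha, mul_sum, mul_sum]
  congr 1
  · refine sum_congr rfl fun s hs => ?_
    have := card_le_card (mem_powerset.1 hs)
    rw [card_insert_of_notMem ha, Nat.sub_add_comm this, pow_succ]
    ring
  · refine sum_congr rfl fun s hs => ?_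
    rw [card_insert_of_notMem ha, card_insert_of_notMem fun h => ha (mem_powerset.1 hs h),
      Nat.add_sub_add_right, pow_succ]
    ring

open Finset in
/-- The probability that a random subset contains none of `#W` disjoint pairs
`{a w, b w}` is `(1 - p ^ 2) ^ #W`. -/
theorem randomSubsetExp_no_pair {α ι : Type*} [DecidableEq α] (p : ℝ) (R : Finset α)
    (a b : ι → α) (ha : a.Injective) (hb : b.Injective) (hab : ∀ i j, a i ≠ b j) (W : Finset ι)
    (haR : ∀ w ∈ W, a w ∉ R) (hbR : ∀ w ∈ W, b w ∉ R) :
    randomSubsetExp p (R ∪ (W.image a ∪ W.image b))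
      (fun s => if ∀ w ∈ W, ¬ (a w ∈ s ∧ b w ∈ s) then 1 else 0) = (1 - p ^ 2) ^ #W := by
  induction W using Finset.induction_on with
  | empty => simp [randomSubsetExp_one]
  | insert w W hw ih =>
    have ih := ih (fun x hx => haR x (mem_insert_of_mem hx))
      (fun x hx => hbR x (mem_insert_of_mem hx))
    set T := R ∪ (W.image a ∪ W.image b) with hT
    have haW : ∀ x ∈ W, a x ≠ a w := fun x hx h => hw (ha h ▸ hx)
    have hbW : ∀ x ∈ W, b x ≠ b w := fun x hx h => hw (hb h ▸ hx)
    have haT : a w ∉ T := by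
      simp only [hT, mem_union, mem_image, not_or, not_exists, not_and]
      exact ⟨haR w (mem_insert_self _ _), haW, fun x _ h => hab _ _ h.symm⟩
    have hbT : b w ∉ T := by
      simp only [hT, mem_union, mem_image, not_or, not_exists, not_and]
      exact ⟨hbR w (mem_insert_self _ _), fun x _ h => hab _ _ h, hbW⟩
    have hset : R ∪ ((insert w W).image a ∪ (insert w W).image b) =
        insert (a w) (insert (b w) T) := by
      ext x
      simp only [hT, mem_union, mem_image, mem_insert, exists_eq_or_imp]
      grind
    have haT' : a w ∉ insert (b w) T := by simp [hab, haT]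
    rw [hset, randomSubsetExp_insert p haT', randomSubsetExp_insert p hbT,
      randomSubsetExp_insert p hbT, card_insert_of_notMem hw, pow_succ, ← ih]
    have key : ∀ f : Finset α → Finset α,
        (∀ s ⊆ T, (∀ x ∈ W, a x ∈ f s ↔ a x ∈ s) ∧ (∀ x ∈ W, b x ∈ f s ↔ b x ∈ s) ∧
          ¬ (a w ∈ f s ∧ b w ∈ f s)) →
        randomSubsetExp p T (fun s => if ∀ x ∈ insert w W, ¬ (a x ∈ f s ∧ b x ∈ f s)
          then (1 : ℝ) else 0) =
        randomSubsetExp p T (fun s => if ∀ x ∈ W, ¬ (a x ∈ s ∧ b x ∈ s)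
          then (1 : ℝ) else 0) := by
      intro f hf
      refine randomSubsetExp_congr fun s hs => ?_
      obtain ⟨h1, h2, h3⟩ := hf s hs
      refine if_congr ?_ rfl rfl
      rw [forall_mem_insert]
      refine (and_iff_right h3).trans (forall₂_congr fun x hx => ?_)
      rw [h1 x hx, h2 x hx]
    have k0 := key (fun s => s) fun s hs =>
      ⟨fun _ _ => Iff.rfl, fun _ _ => Iff.rfl, fun h => haT (hs h.1)⟩
    have k1 := key (fun s => insert (b w) s) fun s hs =>
      ⟨fun x _ => by simp [hab], fun x hx => by simp [hbW x hx],
        fun h => haT' (insert_subset_insert _ hs h.1)⟩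
    have k2 := key (fun s => insert (a w) s) fun s hs =>
      ⟨fun x hx => by simp [haW x hx], fun x _ => by simp [(hab _ _).symm],
        fun h => by
          rcases mem_insert.1 h.2 with h | h
          · exact hab _ _ h.symm
          · exact hbT (hs h)⟩
    have k3 : randomSubsetExp p T (fun s => if ∀ x ∈ insert w W,
        ¬ (a x ∈ insert (a w) (insert (b w) s) ∧ b x ∈ insert (a w) (insert (b w) s))
          then (1 : ℝ) else 0) = 0 := by
      refine (randomSubsetExp_congr fun s _ => ?_).trans (randomSubsetExp_zero p T)
      rw [if_neg]
      intro h
      exact h w (mem_insert_self _ _) (by simp)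
    rw [k0, k1, k2, k3]
    ring

open Finset in
/-- Summing over graphs on `Fin n` amounts to summing over subsets of the edges of the
complete graph. -/
theorem sum_simpleGraph_eq_randomSubsetExp (n : ℕ) (p : ℝ) (F : Finset (Sym2 (Fin n)) → ℝ) :
    ∑ G : SimpleGraph (Fin n), p ^ Nat.card G.edgeSet *
        (1 - p) ^ (n.choose 2 - Nat.card G.edgeSet) * F G.edgeFinset =
      randomSubsetExp p (⊤ : SimpleGraph (Fin n)).edgeFinset F := by
  unfold randomSubsetExp
  refine sum_bij (fun G _ => G.edgeFinset) (fun G _ => ?_) (fun G _ H _ h => ?_)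
    (fun s hs => ?_) (fun G _ => ?_)
  · rw [mem_powerset]
    exact SimpleGraph.edgeFinset_mono le_top
  · exact SimpleGraph.edgeFinset_inj.1 h
  · refine ⟨SimpleGraph.fromEdgeSet (s : Set (Sym2 (Fin n))), mem_univ _, ?_⟩
    ext e
    have hmem := fun h : e ∈ s => mem_powerset.1 hs h
    simpa using hmem
  · rw [SimpleGraph.card_edgeFinset_top_eq_card_choose_two, Fintype.card_fin,
      Nat.card_eq_fintype_card, SimpleGraph.edgeFinset_card]

open Finset in
/-- The probability that two given vertices of the random graph are neither adjacent nor have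
a common neighbour. -/
theorem sum_simpleGraph_not_adj_no_common_neighbor {n : ℕ} (p : ℝ) {u v : Fin n}
    (huv : u ≠ v) :
    ∑ G : SimpleGraph (Fin n), p ^ Nat.card G.edgeSet *
        (1 - p) ^ (n.choose 2 - Nat.card G.edgeSet) *
        (if ¬ G.Adj u v ∧ ∀ w, ¬ (G.Adj u w ∧ G.Adj v w) then 1 else 0) =
      (1 - p) * (1 - p ^ 2) ^ (n - 2) := by
  let W : Finset {w : Fin n // w ≠ u ∧ w ≠ v} := univ
  let a : {w : Fin n // w ≠ u ∧ w ≠ v} → Sym2 (Fin n) := fun w => s(u, w)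
  let b : {w : Fin n // w ≠ u ∧ w ≠ v} → Sym2 (Fin n) := fun w => s(v, w)
  have hW : #W = n - 2 := by
    have : #(({u, v} : Finset (Fin n))ᶜ) = n - 2 := by
      rw [card_compl, card_pair huv, Fintype.card_fin]
    rw [← this, card_univ, Fintype.card_subtype]
    congr 1
    ext w
    simp
  have ha : a.Injective := fun x y h => Subtype.ext (Sym2.congr_right.1 h)
  have hb : b.Injective := fun x y h => Subtype.ext (Sym2.congr_right.1 h)
  have hab : ∀ i j, a i ≠ b j := by
    intro i j h
    rcases Sym2.eq_iff.1 h with h | h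
    · exact huv h.1
    · exact j.2.1 h.1.symm
  have hea : ∀ w, a w ≠ s(u, v) := fun w h => w.2.2 (Sym2.congr_right.1 h)
  have heb : ∀ w, b w ≠ s(u, v) := fun w h =>
    w.2.1 (Sym2.congr_right.1 (h.trans Sym2.eq_swap))
  let E := (⊤ : SimpleGraph (Fin n)).edgeFinset
  let R := (E.erase s(u, v)) \ (W.image a ∪ W.image b)
  have hE : E = insert s(u, v) (R ∪ (W.image a ∪ W.image b)) := by
    rw [sdiff_union_of_subset, insert_erase]
    · simp [E, huv]
    · intro e he
      simp only [mem_union, mem_image] at he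
      rcases he with ⟨w, _, rfl⟩ | ⟨w, _, rfl⟩
      · simpa [E, hea, a] using w.2.1.symm
      · simpa [E, heb, b] using w.2.2.symm
  have he : s(u, v) ∉ R ∪ (W.image a ∪ W.image b) := by
    simp [R, hea, heb]
  have hpair := randomSubsetExp_no_pair p R a b ha hb hab W (fun w hw h => by
    simp only [R, mem_sdiff, mem_union, not_or] at h
    exact h.2.1 (mem_image_of_mem _ hw)) (fun w hw h => by
    simp only [R, mem_sdiff, mem_union, not_or] at h
    exact h.2.2 (mem_image_of_mem _ hw))
  have hsum := sum_simpleGraph_eq_randomSubsetExp n p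
    (fun s => if s(u, v) ∉ s ∧ ∀ w ∈ W, ¬ (a w ∈ s ∧ b w ∈ s) then 1 else 0)
  calc _ = _ := sum_congr rfl fun G _ => by
        congr 1
        refine if_congr ?_ rfl rfl
        simp only [SimpleGraph.mem_edgeFinset, SimpleGraph.mem_edgeSet, a, b]
        refine and_congr_right fun _ => ⟨fun h w _ => h w, fun h w hw => ?_⟩
        exact h ⟨w, hw.1.ne', hw.2.ne'⟩ (mem_univ _) hw
    _ = _ := hsum
    _ = _ := by
      change randomSubsetExp p E _ = _
      rw [hE, randomSubsetExp_insert p he, ← hW, ← hpair]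
      have h0 : randomSubsetExp p (R ∪ (W.image a ∪ W.image b)) (fun s =>
          if s(u, v) ∉ insert s(u, v) s ∧ ∀ w ∈ W,
            ¬ (a w ∈ insert s(u, v) s ∧ b w ∈ insert s(u, v) s) then (1 : ℝ) else 0) = 0 := by
        simp [randomSubsetExp_zero]
      rw [h0, mul_zero, add_zero]
      congr 1
      refine randomSubsetExp_congr fun s hs => ?_
      have : s(u, v) ∉ s := fun h => he (hs h)
      simp [this]

/-- A nonempty graph in which any two distinct vertices are adjacent or have a common neighbour
is connected with diameter at most `2`. -/
theorem SimpleGraph.connected_and_dist_le_two_s5 {V : Type*} [Nonempty V] (G : SimpleGraph V)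
    (h : ∀ u v, u ≠ v → G.Adj u v ∨ ∃ w, G.Adj u w ∧ G.Adj v w) :
    G.Connected ∧ ∀ u v, G.dist u v ≤ 2 := by
  have hwalk : ∀ u v, ∃ W : G.Walk u v, W.length ≤ 2 := by
    intro u v
    by_cases huv : u = v
    · subst huv
      exact ⟨.nil, by simp⟩
    · rcases h u v huv with h | ⟨w, h1, h2⟩
      · exact ⟨.cons h .nil, by simp⟩
      · exact ⟨.cons h1 (.cons h2.symm .nil), by simp⟩
  refine ⟨⟨fun u v => ?_⟩, fun u v => ?_⟩
  · obtain ⟨W, -⟩ := hwalk u v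
    exact ⟨W⟩
  · obtain ⟨W, hW⟩ := hwalk u v
    exact (SimpleGraph.dist_le W).trans hW

open Finset in
/-- The union bound for the event of having diameter at most `2`. -/
theorem one_sub_le_diam2Prob {n : ℕ} (hn : 0 < n) {p : ℝ} (hp0 : 0 ≤ p) (hp1 : p ≤ 1) :
    1 - (n : ℝ) ^ 2 / 2 * ((1 - p) * (1 - p ^ 2) ^ (n - 2)) ≤ diam2Prob n p := by
  have : Nonempty (Fin n) := ⟨⟨0, hn⟩⟩
  let wt : SimpleGraph (Fin n) → ℝ := fun G =>
    p ^ Nat.card G.edgeSet * (1 - p) ^ (n.choose 2 - Nat.card G.edgeSet)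
  let bad : SimpleGraph (Fin n) → Fin n × Fin n → ℝ := fun G x =>
    if ¬ G.Adj x.1 x.2 ∧ ∀ w, ¬ (G.Adj x.1 w ∧ G.Adj x.2 w) then 1 else 0
  have hwt : ∀ G, 0 ≤ wt G := fun G =>
    mul_nonneg (pow_nonneg hp0 _) (pow_nonneg (sub_nonneg.2 hp1) _)
  have hbad : ∀ G x, 0 ≤ bad G x := fun G x => by
    simp only [bad]; split_ifs <;> norm_num
  have htotal : ∑ G, wt G = 1 := by
    have h := sum_simpleGraph_eq_randomSubsetExp n p (fun _ => 1)
    rw [randomSubsetExp_one] at h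
    simpa [wt] using h
  have hpoint : ∀ G : SimpleGraph (Fin n), wt G ≤
      (if G.Connected ∧ ∀ u v : Fin n, G.dist u v ≤ 2 then wt G else 0) +
        1 / 2 * ∑ x ∈ (univ : Finset (Fin n)).offDiag, wt G * bad G x := by
    intro G
    have hs : 0 ≤ ∑ x ∈ (univ : Finset (Fin n)).offDiag, wt G * bad G x :=
      sum_nonneg fun x _ => mul_nonneg (hwt G) (hbad G x)
    split_ifs with h
    · linarith
    · have h' := mt (G.connected_and_dist_le_two_s5) h
      push Not at h'
      obtain ⟨u, v, huv, h1, h2⟩ := h'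
      have hle : ∑ x ∈ {(u, v), (v, u)}, wt G * bad G x ≤
          ∑ x ∈ (univ : Finset (Fin n)).offDiag, wt G * bad G x := by
        refine sum_le_sum_of_subset_of_nonneg ?_ fun x _ _ => mul_nonneg (hwt G) (hbad G x)
        intro x hx
        simp only [mem_insert, mem_singleton] at hx
        rcases hx with rfl | rfl
        · simpa using huv
        · simpa using huv.symm
      have hb1 : bad G (u, v) = 1 := if_pos ⟨h1, fun w hw => h2 w hw.1 hw.2⟩
      have hb2 : bad G (v, u) = 1 :=
        if_pos ⟨fun h => h1 h.symm, fun w hw => h2 w hw.2 hw.1⟩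
      rw [sum_pair (by simp [huv]), hb1, hb2] at hle
      linarith
  have hsum := sum_le_sum fun G (_ : G ∈ (univ : Finset (SimpleGraph (Fin n)))) => hpoint G
  rw [htotal, sum_add_distrib, ← mul_sum, sum_comm] at hsum
  have hpair : ∑ x ∈ (univ : Finset (Fin n)).offDiag, ∑ G, wt G * bad G x =
      ((n * n - n : ℕ) : ℝ) * ((1 - p) * (1 - p ^ 2) ^ (n - 2)) := by
    rw [sum_congr rfl fun x hx =>
      sum_simpleGraph_not_adj_no_common_neighbor p (mem_offDiag.1 hx).2.2]
    rw [sum_const, offDiag_card, card_univ, Fintype.card_fin, nsmul_eq_mul]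
  rw [hpair] at hsum
  have hcard : ((n * n - n : ℕ) : ℝ) ≤ (n : ℝ) ^ 2 := by
    rw [sq]
    exact_mod_cast Nat.sub_le _ _
  have hnonneg : 0 ≤ (1 - p) * (1 - p ^ 2) ^ (n - 2) :=
    mul_nonneg (sub_nonneg.2 hp1) (pow_nonneg (by nlinarith) _)
  have := mul_le_mul_of_nonneg_right hcard hnonneg
  change _ ≤ ∑ G : SimpleGraph (Fin n), _
  linarith

/-- If `p(n) → 0`, then for every `ε > 0`, for all large `n`,
`P(n,p(n)) ≥ 1 - (1+ε)(n²/2)e^{-n p(n)²}`. -/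
theorem diam2Prob_lower_asymptotic (p : ℕ → ℝ) (hp : ∀ n, p n ∈ Set.Ioo (0 : ℝ) 1)
    (hp0 : Filter.Tendsto p Filter.atTop (nhds 0)) :
    ∀ ε > (0 : ℝ), ∃ N : ℕ, ∀ n ≥ N,
      1 - (1 + ε) * ((n : ℝ) ^ 2 / 2) * Real.exp (-(n * (p n) ^ 2)) ≤ diam2Prob n (p n) := by
  intro ε hε
  have hlim : Filter.Tendsto (fun n => Real.exp (2 * p n ^ 2)) Filter.atTop (nhds 1) := by
    simpa [Function.comp_def] using
      Real.continuous_exp.continuousAt.tendsto.comp ((hp0.pow 2).const_mul 2)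
  obtain ⟨N, hN⟩ := Filter.eventually_atTop.1
    (hlim.eventually (ge_mem_nhds (by linarith : (1 : ℝ) < 1 + ε)))
  refine ⟨max N 2, fun n hn => ?_⟩
  have hn2 : 2 ≤ n := le_of_max_le_right hn
  have hexp := hN n (le_of_max_le_left hn)
  obtain ⟨h0, h1⟩ := hp n
  refine le_trans ?_ (one_sub_le_diam2Prob (by lia) h0.le h1.le)
  have hbase : (1 - p n ^ 2) ^ (n - 2) ≤ Real.exp (2 * p n ^ 2) * Real.exp (-(n * p n ^ 2)) := by
    calc (1 - p n ^ 2) ^ (n - 2) ≤ Real.exp (-(p n ^ 2)) ^ (n - 2) :=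
          pow_le_pow_left₀ (by nlinarith) (Real.one_sub_le_exp_neg _) _
      _ = Real.exp (2 * p n ^ 2) * Real.exp (-(n * p n ^ 2)) := by
          rw [← Real.exp_nat_mul, ← Real.exp_add, Nat.cast_sub hn2]
          congr 1
          push_cast
          ring
  have hpos : 0 ≤ (1 - p n ^ 2) ^ (n - 2) := pow_nonneg (by nlinarith) _
  have hprod : (1 - p n) * (1 - p n ^ 2) ^ (n - 2) ≤ (1 + ε) * Real.exp (-(n * p n ^ 2)) :=
    calc (1 - p n) * (1 - p n ^ 2) ^ (n - 2) ≤ (1 - p n ^ 2) ^ (n - 2) :=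
          mul_le_of_le_one_left hpos (by linarith)
      _ ≤ _ := hbase.trans (mul_le_mul_of_nonneg_right hexp (Real.exp_pos _).le)
  have := mul_le_mul_of_nonneg_left hprod (by positivity : (0 : ℝ) ≤ (n : ℝ) ^ 2 / 2)
  linarith
end

section
/- Let p : ℕ → (0,1) be a sequence of edge probabilities with p(n) → 0 as n → ∞. Then for every ε > 0 there exists N such that for all n ≥ N, P(n,p(n)) ≤ (1+ε)·(2/n²)·e^{n·p(n)²}·(1 + 4n·e^{n·p(n)²·(p(n)²−1)}). -/
open scoped Classical

namespace RandomGraph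

open Finset

variable {V : Type*}

/-- The indicator of adjacency of `u` and `v`. -/
noncomputable def adjInd (G : SimpleGraph V) (u v : V) : ℝ := if G.Adj u v then 1 else 0

/-- `f` depends only on which of the pairs in `S` are edges. -/
def DependsOnPairs (f : SimpleGraph V → ℝ) (S : Set (Sym2 V)) : Prop :=
  ∀ G H : SimpleGraph V, (∀ e ∈ S, e ∈ G.edgeSet ↔ e ∈ H.edgeSet) → f G = f H

/-- The graph agreeing with `G` on the pairs in `S` and with `H` elsewhere. -/
def splice (S : Set (Sym2 V)) (G H : SimpleGraph V) : SimpleGraph V where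
  Adj u v := (s(u, v) ∈ S ∧ G.Adj u v) ∨ (s(u, v) ∉ S ∧ H.Adj u v)
  symm := ⟨fun u v h => by rwa [Sym2.eq_swap, G.adj_comm, H.adj_comm] at h⟩
  loopless := ⟨fun u h => by simp at h⟩

lemma mem_edgeSet_splice (S : Set (Sym2 V)) (G H : SimpleGraph V) (e : Sym2 V) :
    e ∈ (splice S G H).edgeSet ↔ (e ∈ S ∧ e ∈ G.edgeSet) ∨ (e ∉ S ∧ e ∈ H.edgeSet) := by
  induction e using Sym2.ind with
  | _ u v => rfl

lemma splice_splice (S : Set (Sym2 V)) (G H : SimpleGraph V) :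
    splice S (splice S G H) (splice S H G) = G := by
  ext u v
  simp only [splice]
  tauto

lemma DependsOnPairs.prod {ι : Type*} {s : Finset ι} {f : ι → SimpleGraph V → ℝ}
    {S : ι → Set (Sym2 V)} (h : ∀ i ∈ s, DependsOnPairs (f i) (S i)) :
    DependsOnPairs (fun G => ∏ i ∈ s, f i G) (⋃ i ∈ s, S i) := by
  intro G H hGH
  refine Finset.prod_congr rfl fun i hi => h i hi G H fun e he => hGH e ?_
  exact Set.mem_biUnion (s := {i | i ∈ s}) hi he

lemma dependsOnPairs_congr_adj {f : SimpleGraph V → ℝ} {S : Set (Sym2 V)}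
    (h : ∀ G H : SimpleGraph V, (∀ u v, s(u, v) ∈ S → adjInd G u v = adjInd H u v) → f G = f H) :
    DependsOnPairs f S := by
  intro G H hGH
  refine h G H fun u v huv => ?_
  have := hGH _ huv
  simp only [SimpleGraph.mem_edgeSet] at this
  simp [adjInd, this]

lemma adjInd_comm (G : SimpleGraph V) (u v : V) : adjInd G u v = adjInd G v u := by
  simp [adjInd, G.adj_comm]

lemma adjInd_self (G : SimpleGraph V) (u : V) : adjInd G u u = 0 := by
  simp [adjInd]

lemma adjInd_eq (G : SimpleGraph V) (u v : V) : adjInd G u v = 0 ∨ adjInd G u v = 1 := by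
  unfold adjInd
  split_ifs <;> simp

/-- The pairs inside `T`. -/
def pairsInside (T : Finset V) : Set (Sym2 V) := {e | ∀ x ∈ e, x ∈ T}

/-- The pairs joining `z` to `T`. -/
def pairsTo (T : Finset V) (z : V) : Set (Sym2 V) := {e | ∃ t ∈ T, e = s(t, z)}

/-- The indicator that `x` is not a common neighbour of `u` and `v`. -/
noncomputable def noPath (G : SimpleGraph V) (u v x : V) : ℝ := 1 - adjInd G u x * adjInd G v x

lemma noPath_left (G : SimpleGraph V) (u v : V) : noPath G u v u = 1 := by
  simp [noPath, adjInd_self]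

lemma noPath_right (G : SimpleGraph V) (u v : V) : noPath G u v v = 1 := by
  simp [noPath, adjInd_self]

lemma noPath_eq (G : SimpleGraph V) (u v x : V) : noPath G u v x = 0 ∨ noPath G u v x = 1 := by
  rcases adjInd_eq G u x with h | h <;> rcases adjInd_eq G v x with h' | h' <;>
    simp [noPath, h, h']

lemma noPath_nonneg (G : SimpleGraph V) (u v x : V) : 0 ≤ noPath G u v x := by
  rcases noPath_eq G u v x with h | h <;> simp [h]

lemma noPath_le_one (G : SimpleGraph V) (u v x : V) : noPath G u v x ≤ 1 := by
  rcases noPath_eq G u v x with h | h <;> simp [h]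

/-- The core factor, on four vertices, of the event that two disjoint pairs are both far. -/
noncomputable def core (G : SimpleGraph V) (u v w x : V) : ℝ :=
  (1 - adjInd G u v) * (1 - adjInd G w x) *
    (noPath G u v w * noPath G u v x * (noPath G w x u * noPath G w x v))

lemma core_eq (G : SimpleGraph V) (u v w x : V) :
    core G u v w x = (1 - (adjInd G u v + adjInd G w x - adjInd G u v * adjInd G w x)) *
      (1 - (adjInd G u w + adjInd G v x - adjInd G u w * adjInd G v x) *
        (adjInd G v w + adjInd G u x - adjInd G v w * adjInd G u x)) := by
  rw [core, show ∀ a b : ℝ, 1 - (a + b - a * b) = (1 - a) * (1 - b) by intro a b; ring]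
  congr 1
  simp only [noPath, adjInd_comm G w u, adjInd_comm G x u, adjInd_comm G w v, adjInd_comm G x v]
  rcases adjInd_eq G u w with h | h <;> rcases adjInd_eq G v x with h' | h' <;>
    rcases adjInd_eq G v w with h2 | h2 <;> rcases adjInd_eq G u x with h3 | h3 <;>
    simp [h, h', h2, h3]

variable [Fintype V]

/-- The indicator that `u` and `v` are neither adjacent nor have a common neighbour. -/
noncomputable def far (G : SimpleGraph V) (u v : V) : ℝ :=
  (1 - adjInd G u v) * ∏ x, noPath G u v x

lemma far_comm (G : SimpleGraph V) (u v : V) : far G u v = far G v u := by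
  simp only [far, noPath, adjInd_comm G u v, mul_comm]

lemma far_mul_self (G : SimpleGraph V) (u v : V) : far G u v * far G u v = far G u v := by
  rw [far, mul_mul_mul_comm, ← Finset.prod_mul_distrib]
  congr 1
  · rcases adjInd_eq G u v with h | h <;> simp [h]
  · refine Finset.prod_congr rfl fun x _ => ?_
    rcases noPath_eq G u v x with h | h <;> simp [h]

lemma card_offDiag_univ :
    (((univ : Finset V).offDiag.card : ℕ) : ℝ) = Fintype.card V * (Fintype.card V - 1) := by
  rw [Finset.offDiag_card, Finset.card_univ, Nat.cast_sub (Nat.le_mul_self _)]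
  push_cast
  ring

/-- The number of ordered pairs of distinct vertices that are neither adjacent nor have a common
neighbour. -/
noncomputable def farCount (G : SimpleGraph V) : ℝ := ∑ q ∈ univ.offDiag, far G q.1 q.2

lemma farCount_eq_zero {G : SimpleGraph V} (hG : G.Connected) (h : ∀ u v : V, G.dist u v ≤ 2) :
    farCount G = 0 := by
  refine Finset.sum_eq_zero ?_
  rintro ⟨u, v⟩ huv
  have huv : u ≠ v := (Finset.mem_offDiag.1 huv).2.2
  obtain ⟨W, hW⟩ := hG.exists_walk_length_eq_dist u v
  have hle := h u v
  rw [← hW] at hle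
  show far G u v = 0
  match W, hle with
  | .nil, _ => exact absurd rfl huv
  | .cons h1 .nil, _ => simp [far, adjInd, h1]
  | .cons (v := x) h1 (.cons h2 .nil), _ =>
    rw [far, Finset.prod_eq_zero (Finset.mem_univ x), mul_zero]
    simp [noPath, adjInd, h1, h2.symm]
  | .cons h1 (.cons h2 (.cons h3 W)), h => simp at h

variable [DecidableEq V]

/-- The unordered pairs of distinct vertices. -/
def potentialEdges (V : Type*) [Fintype V] [DecidableEq V] : Finset (Sym2 V) :=
  univ.filter fun e => ¬ e.IsDiag

/-- The probability of the graph `G` when each edge is present independently with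
probability `p`. -/
noncomputable def weight (p : ℝ) (G : SimpleGraph V) : ℝ :=
  ∏ e ∈ potentialEdges V, if e ∈ G.edgeSet then p else 1 - p

/-- The expectation of `f` over the binomial random graph with edge probability `p`. -/
noncomputable def expect (p : ℝ) (f : SimpleGraph V → ℝ) : ℝ :=
  ∑ G : SimpleGraph V, weight p G * f G

lemma sum_prod_ite (a b : Sym2 V → ℝ) :
    ∑ G : SimpleGraph V, ∏ e ∈ potentialEdges V, (if e ∈ G.edgeSet then a e else b e) =
      ∏ e ∈ potentialEdges V, (a e + b e) := by
  rw [Finset.prod_add]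
  refine Finset.sum_bij' (fun G _ => (potentialEdges V).filter fun e => e ∈ G.edgeSet)
    (fun t _ => SimpleGraph.fromEdgeSet (t : Set (Sym2 V))) ?_ ?_ ?_ ?_ ?_
  · intro G _
    simp
  · intro t _
    simp
  · intro G _
    ext u v
    simp only [SimpleGraph.fromEdgeSet_adj, coe_filter, Set.mem_ofPred_eq, potentialEdges,
      mem_filter, mem_univ, true_and, Sym2.mk_isDiag_iff, SimpleGraph.mem_edgeSet]
    exact ⟨fun h => h.1.2, fun h => ⟨⟨h.ne, h⟩, h.ne⟩⟩
  · intro t ht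
    ext e
    have ht' := Finset.mem_powerset.1 ht
    simp only [mem_filter, SimpleGraph.edgeSet_fromEdgeSet, Set.mem_sdiff, mem_coe,
      Sym2.mem_diagSet]
    constructor
    · exact fun h => h.2.1
    · intro h
      exact ⟨ht' h, h, by simpa [potentialEdges] using ht' h⟩
  · intro G _
    rw [Finset.prod_ite, Finset.filter_not]

lemma weight_nonneg {p : ℝ} (h0 : 0 ≤ p) (h1 : p ≤ 1) (G : SimpleGraph V) : 0 ≤ weight p G := by
  refine Finset.prod_nonneg fun e _ => ?_
  split_ifs <;> linarith

lemma expect_mono {p : ℝ} (h0 : 0 ≤ p) (h1 : p ≤ 1) {f g : SimpleGraph V → ℝ}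
    (h : ∀ G, f G ≤ g G) : expect p f ≤ expect p g :=
  Finset.sum_le_sum fun G _ => mul_le_mul_of_nonneg_left (h G) (weight_nonneg h0 h1 G)

lemma expect_add (p : ℝ) (f g : SimpleGraph V → ℝ) :
    expect p (fun G => f G + g G) = expect p f + expect p g := by
  simp only [expect, mul_add, Finset.sum_add_distrib]

lemma expect_sub (p : ℝ) (f g : SimpleGraph V → ℝ) :
    expect p (fun G => f G - g G) = expect p f - expect p g := by
  simp only [expect, mul_sub, Finset.sum_sub_distrib]

lemma expect_const_mul (p c : ℝ) (f : SimpleGraph V → ℝ) :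
    expect p (fun G => c * f G) = c * expect p f := by
  simp only [expect, Finset.mul_sum]
  exact Finset.sum_congr rfl fun _ _ => by ring

lemma expect_sum {ι : Type*} (p : ℝ) (s : Finset ι) (f : ι → SimpleGraph V → ℝ) :
    expect p (fun G => ∑ i ∈ s, f i G) = ∑ i ∈ s, expect p (f i) := by
  simp only [expect, Finset.mul_sum]
  exact Finset.sum_comm

lemma expect_prod_edges (p : ℝ) (s : Finset (Sym2 V)) (hs : s ⊆ potentialEdges V) :
    expect p (fun G => ∏ e ∈ s, if e ∈ G.edgeSet then (1 : ℝ) else 0) = p ^ s.card := by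
  have h := sum_prod_ite (V := V) (fun _ => p) (fun e => if e ∈ s then 0 else 1 - p)
  have h2 : ∏ e ∈ potentialEdges V, (p + if e ∈ s then 0 else 1 - p) = p ^ s.card := by
    rw [← Finset.prod_subset hs, Finset.prod_congr rfl (g := fun _ => p), Finset.prod_const]
    · intro e he; simp [he]
    · intro e _ he; simp [he]
  rw [← h2, ← h, expect]
  refine Finset.sum_congr rfl fun G _ => ?_
  have h3 : ∏ e ∈ s, (if e ∈ G.edgeSet then (1 : ℝ) else 0) =
      ∏ e ∈ potentialEdges V, if e ∈ s then (if e ∈ G.edgeSet then (1 : ℝ) else 0) else 1 := by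
    rw [Finset.prod_ite_mem, Finset.inter_eq_right.2 hs]
  rw [weight, h3, ← Finset.prod_mul_distrib]
  refine Finset.prod_congr rfl fun e _ => ?_
  split_ifs <;> simp

lemma expect_one (p : ℝ) : expect p (fun _ : SimpleGraph V => (1 : ℝ)) = 1 := by
  simpa using expect_prod_edges (V := V) p ∅ (by simp)

lemma weight_splice (p : ℝ) (S : Set (Sym2 V)) (G H : SimpleGraph V) :
    weight p (splice S G H) * weight p (splice S H G) = weight p G * weight p H := by
  simp only [weight, ← Finset.prod_mul_distrib, mem_edgeSet_splice]
  refine Finset.prod_congr rfl fun e _ => ?_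
  by_cases h : e ∈ S <;> simp [h, mul_comm]

lemma expect_mul (p : ℝ) {f g : SimpleGraph V → ℝ} {S T : Set (Sym2 V)}
    (hf : DependsOnPairs f S) (hg : DependsOnPairs g T) (hST : Disjoint S T) :
    expect p (fun G => f G * g G) = expect p f * expect p g := by
  have key : expect p f * expect p g =
      expect p (fun G => f G * g G) * expect p (fun _ : SimpleGraph V => (1 : ℝ)) := by
    simp only [expect, Finset.sum_mul_sum, ← Finset.sum_product']
    refine Finset.sum_nbij' (fun x => (splice S x.1 x.2, splice S x.2 x.1))
      (fun x => (splice S x.1 x.2, splice S x.2 x.1)) (by simp) (by simp) ?_ ?_ ?_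
    · intro x _; simp [splice_splice]
    · intro x _; simp [splice_splice]
    · rintro ⟨G, H⟩ _
      have h1 : f (splice S G H) = f G := hf _ _ fun e he => by
        simp [mem_edgeSet_splice, he]
      have h2 : g (splice S G H) = g H := hg _ _ fun e he => by
        simp [mem_edgeSet_splice, hST.notMem_of_mem_right he]
      have h3 := weight_splice p S G H
      simp only [h1, h2]
      linear_combination (-(f G * g H)) * h3
  rw [key, expect_one, mul_one]

lemma expect_prod {ι : Type*} [DecidableEq ι] (p : ℝ) {s : Finset ι}
    {f : ι → SimpleGraph V → ℝ} {S : ι → Set (Sym2 V)}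
    (h : ∀ i ∈ s, DependsOnPairs (f i) (S i))
    (hS : ∀ i ∈ s, ∀ j ∈ s, i ≠ j → Disjoint (S i) (S j)) :
    expect p (fun G => ∏ i ∈ s, f i G) = ∏ i ∈ s, expect p (f i) := by
  induction s using Finset.induction_on with
  | empty => simpa using expect_one p
  | insert a s ha ih =>
    simp only [Finset.prod_insert ha]
    rw [expect_mul p (h a (by simp)) (DependsOnPairs.prod fun i hi => h i (by simp [hi])),
      ih (fun i hi => h i (by simp [hi])) fun i hi j hj => hS i (by simp [hi]) j (by simp [hj])]
    simp only [Set.disjoint_iUnion_right]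
    intro i hi
    exact hS a (by simp) i (by simp [hi]) fun hai => ha (hai ▸ hi)

lemma expect_mul_prod_compl (p : ℝ) (T : Finset V) {f : SimpleGraph V → ℝ}
    {g : V → SimpleGraph V → ℝ} (hf : DependsOnPairs f (pairsInside T))
    (hg : ∀ z ∉ T, DependsOnPairs (g z) (pairsTo T z)) :
    expect p (fun G => f G * ∏ z ∈ Tᶜ, g z G) = expect p f * ∏ z ∈ Tᶜ, expect p (g z) := by
  have hg' : ∀ z ∈ Tᶜ, DependsOnPairs (g z) (pairsTo T z) := fun z hz => hg z (by simpa using hz)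
  rw [expect_mul p hf (DependsOnPairs.prod hg'), expect_prod p hg']
  · intro z hz w hw hzw
    rw [Set.disjoint_left]
    rintro e ⟨t, ht, rfl⟩ ⟨t', ht', h⟩
    rcases Sym2.eq_iff.1 h with ⟨_, h⟩ | ⟨h, _⟩
    · exact hzw h
    · exact (Finset.mem_compl.1 hw) (h ▸ ht)
  · simp only [Set.disjoint_iUnion_right]
    intro z hz
    rw [Set.disjoint_left]
    rintro e he ⟨t, ht, rfl⟩
    exact (Finset.mem_compl.1 hz) (he z (by simp))

lemma expect_prod_adjInd {ι : Type*} [Fintype ι] (p : ℝ) (a b : ι → V) (hab : ∀ i, a i ≠ b i)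
    (hinj : Function.Injective fun i => s(a i, b i)) :
    expect p (fun G => ∏ i, adjInd G (a i) (b i)) = p ^ Fintype.card ι := by
  have h := expect_prod_edges p (univ.map ⟨_, hinj⟩) (by
    intro e he
    obtain ⟨i, _, rfl⟩ := Finset.mem_map.1 he
    simpa [potentialEdges] using hab i)
  simpa [adjInd] using h

lemma expect_adjInd (p : ℝ) {u v : V} (h : u ≠ v) : expect p (fun G => adjInd G u v) = p := by
  simpa using expect_prod_adjInd (ι := Unit) p (fun _ => u) (fun _ => v) (fun _ => h)
    (fun _ _ _ => rfl)

lemma expect_adjInd_mul (p : ℝ) {a b c d : V} (hab : a ≠ b) (hcd : c ≠ d)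
    (h : s(a, b) ≠ s(c, d)) :
    expect p (fun G => adjInd G a b * adjInd G c d) = p ^ 2 := by
  have := expect_prod_adjInd (ι := Fin 2) p ![a, c] ![b, d] (by simp [Fin.forall_fin_two, *])
    (by
      intro i j hij
      fin_cases i <;> fin_cases j <;> simp_all <;> grind)
  simpa [Fin.prod_univ_two] using this

lemma expect_adjInd_mul_mul (p : ℝ) {z u v w : V} (hu : u ≠ z) (hv : v ≠ z) (hw : w ≠ z)
    (huv : u ≠ v) (huw : u ≠ w) (hvw : v ≠ w) :
    expect p (fun G => adjInd G u z * adjInd G v z * adjInd G w z) = p ^ 3 := by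
  have := expect_prod_adjInd (ι := Fin 3) p ![u, v, w] ![z, z, z]
    (by intro i; fin_cases i <;> simp [*])
    (by
      intro i j hij
      fin_cases i <;> fin_cases j <;> simp_all)
  simpa [Fin.prod_univ_three] using this

lemma expect_one_sub (p : ℝ) (f : SimpleGraph V → ℝ) :
    expect p (fun G => 1 - f G) = 1 - expect p f := by
  rw [expect_sub, expect_one]

lemma expect_noPath (p : ℝ) {u v z : V} (hu : u ≠ z) (hv : v ≠ z) (huv : u ≠ v) :
    expect p (fun G => noPath G u v z) = 1 - p ^ 2 := by
  simp only [noPath]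
  rw [expect_one_sub, expect_adjInd_mul p hu hv (by simp [huv, hu])]

lemma expect_far (p : ℝ) {u v : V} (huv : u ≠ v) :
    expect p (fun G => far G u v) = (1 - p) * (1 - p ^ 2) ^ (Fintype.card V - 2) := by
  have h1 : ∀ G, far G u v = (1 - adjInd G u v) * ∏ z ∈ ({u, v} : Finset V)ᶜ, noPath G u v z := by
    intro G
    rw [far, ← Finset.prod_mul_prod_compl {u, v}, Finset.prod_pair huv, noPath_left, noPath_right]
    ring
  simp only [h1]
  rw [expect_mul_prod_compl p {u, v} (f := fun G => 1 - adjInd G u v)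
    (g := fun z G => noPath G u v z), expect_one_sub, expect_adjInd p huv,
    Finset.prod_congr rfl (g := fun _ => 1 - p ^ 2), Finset.prod_const, Finset.card_compl,
    Finset.card_pair huv]
  · intro z hz
    simp only [mem_compl, mem_insert, mem_singleton, not_or] at hz
    exact expect_noPath p (Ne.symm hz.1) (Ne.symm hz.2) huv
  · refine dependsOnPairs_congr_adj fun G H h => ?_
    rw [h u v (by simp [pairsInside])]
  · intro z _
    refine dependsOnPairs_congr_adj fun G H h => ?_
    rw [noPath, noPath, h u z ⟨u, by simp, rfl⟩, h v z ⟨v, by simp, rfl⟩]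

lemma expect_noPath_mul_noPath_shared (p : ℝ) {u v w z : V} (hu : u ≠ z) (hv : v ≠ z)
    (hw : w ≠ z) (huv : u ≠ v) (huw : u ≠ w) (hvw : v ≠ w) :
    expect p (fun G => noPath G u v z * noPath G u w z) = 1 - 2 * p ^ 2 + p ^ 3 := by
  have h : ∀ G, noPath G u v z * noPath G u w z = 1 -
      ((adjInd G u z * adjInd G v z + adjInd G u z * adjInd G w z) -
        adjInd G u z * adjInd G v z * adjInd G w z) := by
    intro G
    rcases adjInd_eq G u z with h | h <;> simp only [noPath, h] <;> ring
  simp only [h]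
  rw [expect_one_sub, expect_sub, expect_add, expect_adjInd_mul p hu hv (by simp [huv, hu]),
    expect_adjInd_mul p hu hw (by simp [huw, hu]),
    expect_adjInd_mul_mul p hu hv hw huv huw hvw]
  ring

lemma far_mul_far_shared_le (G : SimpleGraph V) (u v w : V) :
    far G u v * far G u w ≤
      1 * ∏ z ∈ ({u, v, w} : Finset V)ᶜ, noPath G u v z * noPath G u w z := by
  rw [far, far, mul_mul_mul_comm, ← Finset.prod_mul_distrib,
    ← Finset.prod_mul_prod_compl {u, v, w}, ← mul_assoc]
  have h0 : ∀ z, 0 ≤ noPath G u v z * noPath G u w z := fun z =>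
    mul_nonneg (noPath_nonneg ..) (noPath_nonneg ..)
  refine mul_le_mul_of_nonneg_right ?_ (Finset.prod_nonneg fun z _ => h0 z)
  have h1 : ∏ z ∈ ({u, v, w} : Finset V), noPath G u v z * noPath G u w z ≤ 1 :=
    Finset.prod_le_one (fun z _ => h0 z) fun z _ =>
      mul_le_one₀ (noPath_le_one ..) (noPath_nonneg ..) (noPath_le_one ..)
  rcases adjInd_eq G u v with h | h <;> rcases adjInd_eq G u w with h' | h' <;>
    simp [h, h', h1]

lemma expect_far_mul_far_shared_le {p : ℝ} (h0 : 0 ≤ p) (h1 : p ≤ 1) {u v w : V} (huv : u ≠ v)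
    (huw : u ≠ w) (hvw : v ≠ w) :
    expect p (fun G => far G u v * far G u w) ≤
      (1 - 2 * p ^ 2 + p ^ 3) ^ (Fintype.card V - 3) := by
  refine (expect_mono h0 h1 fun G => far_mul_far_shared_le G u v w).trans_eq ?_
  rw [expect_mul_prod_compl p {u, v, w} (f := fun _ => 1)
    (g := fun z G => noPath G u v z * noPath G u w z), expect_one,
    Finset.prod_congr rfl (g := fun _ => 1 - 2 * p ^ 2 + p ^ 3), Finset.prod_const,
    Finset.card_compl, Finset.card_eq_three.2 ⟨u, v, w, huv, huw, hvw, rfl⟩, one_mul]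
  · intro z hz
    simp only [mem_compl, mem_insert, mem_singleton, not_or] at hz
    exact expect_noPath_mul_noPath_shared p (Ne.symm hz.1) (Ne.symm hz.2.1) (Ne.symm hz.2.2)
      huv huw hvw
  · exact fun _ _ _ => rfl
  · intro z _
    refine dependsOnPairs_congr_adj fun G H h => ?_
    simp only [noPath, h u z ⟨u, by simp, rfl⟩, h v z ⟨v, by simp, rfl⟩, h w z ⟨w, by simp, rfl⟩]

lemma expect_union {p : ℝ} {a b c d : V} (hab : a ≠ b) (hcd : c ≠ d) (h : s(a, b) ≠ s(c, d)) :
    expect p (fun G => adjInd G a b + adjInd G c d - adjInd G a b * adjInd G c d) =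
      2 * p - p ^ 2 := by
  rw [expect_sub, expect_add, expect_adjInd p hab, expect_adjInd p hcd,
    expect_adjInd_mul p hab hcd h]
  ring

lemma expect_core (p : ℝ) {u v w x : V} (huv : u ≠ v) (huw : u ≠ w) (hux : u ≠ x)
    (hvw : v ≠ w) (hvx : v ≠ x) (hwx : w ≠ x) :
    expect p (fun G => core G u v w x) = (1 - p) ^ 2 * (1 - (2 * p - p ^ 2) ^ 2) := by
  simp only [core_eq]
  rw [expect_mul p (S := {s(u, v), s(w, x)}) (T := {s(u, w), s(v, x), s(v, w), s(u, x)}),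
    expect_one_sub, expect_union huv hwx, expect_one_sub,
    expect_mul p (S := {s(u, w), s(v, x)}) (T := {s(v, w), s(u, x)}),
    expect_union huw hvx, expect_union hvw hux]
  · ring
  · simp [*]
  · simp [*]
  · refine dependsOnPairs_congr_adj fun G H h => ?_
    rw [h u w (by simp), h v x (by simp)]
  · refine dependsOnPairs_congr_adj fun G H h => ?_
    rw [h v w (by simp), h u x (by simp)]
  · simp [*, Ne.symm]
  · simp [*]
  · refine dependsOnPairs_congr_adj fun G H h => ?_
    rw [h u v (by simp), h w x (by simp)]
  · refine dependsOnPairs_congr_adj fun G H h => ?_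
    rw [h u w (by simp), h v x (by simp), h v w (by simp), h u x (by simp)]
  · simp [*, Ne.symm]

lemma far_mul_far_disjoint (G : SimpleGraph V) {u v w x : V} (huv : u ≠ v) (huw : u ≠ w)
    (hux : u ≠ x) (hvw : v ≠ w) (hvx : v ≠ x) (hwx : w ≠ x) :
    far G u v * far G w x =
      core G u v w x * ∏ z ∈ ({u, v, w, x} : Finset V)ᶜ, noPath G u v z * noPath G w x z := by
  rw [far, far, mul_mul_mul_comm, ← Finset.prod_mul_distrib,
    ← Finset.prod_mul_prod_compl {u, v, w, x}, ← mul_assoc]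
  congr 1
  rw [Finset.prod_insert (by simp [*]), Finset.prod_insert (by simp [*]), Finset.prod_pair hwx,
    core]
  simp only [noPath_left, noPath_right]
  ring

lemma expect_far_mul_far_disjoint (p : ℝ) {u v w x : V} (huv : u ≠ v) (huw : u ≠ w)
    (hux : u ≠ x) (hvw : v ≠ w) (hvx : v ≠ x) (hwx : w ≠ x) :
    expect p (fun G => far G u v * far G w x) =
      (1 - p) ^ 2 * (1 - (2 * p - p ^ 2) ^ 2) * ((1 - p ^ 2) ^ 2) ^ (Fintype.card V - 4) := by
  simp only [far_mul_far_disjoint _ huv huw hux hvw hvx hwx]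
  have hcard : ({u, v, w, x} : Finset V).card = 4 := by
    rw [Finset.card_insert_of_notMem (by simp [*]),
      Finset.card_eq_three.2 ⟨v, w, x, hvw, hvx, hwx, rfl⟩]
  rw [expect_mul_prod_compl p {u, v, w, x} (f := fun G => core G u v w x)
    (g := fun z G => noPath G u v z * noPath G w x z), expect_core p huv huw hux hvw hvx hwx,
    Finset.prod_congr rfl (g := fun _ => (1 - p ^ 2) ^ 2), Finset.prod_const,
    Finset.card_compl, hcard]
  · intro z hz
    simp only [mem_compl, mem_insert, mem_singleton, not_or] at hz
    obtain ⟨hzu, hzv, hzw, hzx⟩ := hz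
    rw [expect_mul p (S := {s(u, z), s(v, z)}) (T := {s(w, z), s(x, z)}),
      expect_noPath p (Ne.symm hzu) (Ne.symm hzv) huv,
      expect_noPath p (Ne.symm hzw) (Ne.symm hzx) hwx]
    · ring
    · refine dependsOnPairs_congr_adj fun G H h => ?_
      rw [noPath, noPath, h u z (by simp), h v z (by simp)]
    · refine dependsOnPairs_congr_adj fun G H h => ?_
      rw [noPath, noPath, h w z (by simp), h x z (by simp)]
    · simp [*, Ne.symm]
  · refine dependsOnPairs_congr_adj fun G H h => ?_
    simp only [core, noPath]
    rw [h u v (by simp [pairsInside]), h w x (by simp [pairsInside]),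
      h u w (by simp [pairsInside]), h v w (by simp [pairsInside]),
      h u x (by simp [pairsInside]), h v x (by simp [pairsInside]),
      h w u (by simp [pairsInside]), h x u (by simp [pairsInside]),
      h w v (by simp [pairsInside]), h x v (by simp [pairsInside])]
  · intro z _
    refine dependsOnPairs_congr_adj fun G H h => ?_
    simp only [noPath, h u z ⟨u, by simp, rfl⟩, h v z ⟨v, by simp, rfl⟩, h w z ⟨w, by simp, rfl⟩,
      h x z ⟨x, by simp, rfl⟩]

lemma card_offDiag_filter_fst_le (u : V) :
    (((univ : Finset V).offDiag.filter fun q => q.1 = u).card : ℝ) ≤ Fintype.card V - 1 := by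
  have h : ((univ : Finset V).offDiag.filter fun q => q.1 = u).card ≤ (univ.erase u).card := by
    refine Finset.card_le_card_of_injOn Prod.snd ?_ ?_
    · rintro ⟨x, y⟩ hq
      simp only [coe_filter, mem_offDiag, Set.mem_ofPred_eq] at hq
      simpa using fun h : y = u => hq.1.2.2 (hq.2.trans h.symm)
    · rintro ⟨x, y⟩ hq ⟨x', y'⟩ hq' h
      simp only [coe_filter, mem_offDiag, Set.mem_ofPred_eq] at hq hq' h
      rw [hq.2, hq'.2, h]
  rw [Finset.card_erase_of_mem (Finset.mem_univ u), Finset.card_univ] at h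
  have hpos : 1 ≤ Fintype.card V := Fintype.card_pos_iff.2 ⟨u⟩
  calc (((univ : Finset V).offDiag.filter fun q => q.1 = u).card : ℝ)
      ≤ ((Fintype.card V - 1 : ℕ) : ℝ) := by exact_mod_cast h
    _ = _ := by push_cast [Nat.cast_sub hpos]; ring

lemma card_offDiag_filter_snd_le (u : V) :
    (((univ : Finset V).offDiag.filter fun q => q.2 = u).card : ℝ) ≤ Fintype.card V - 1 := by
  refine le_trans ?_ (card_offDiag_filter_fst_le u)
  norm_cast
  refine Finset.card_le_card_of_injOn Prod.swap ?_ Prod.swap_injective.injOn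
  rintro ⟨x, y⟩ hq
  simp only [coe_filter, mem_offDiag, Set.mem_ofPred_eq] at hq
  simpa using ⟨Ne.symm hq.1.2.2, hq.2⟩

lemma card_offDiag_filter_eq_le (q₀ : V × V) :
    (((univ : Finset V).offDiag.filter fun q => q = q₀).card : ℝ) ≤ 1 := by
  norm_cast
  refine Finset.card_le_one.2 ?_
  rintro x hx y hy
  rw [(Finset.mem_filter.1 hx).2, (Finset.mem_filter.1 hy).2]

lemma expect_far_mul_far_le {p a b c : ℝ} (h0 : 0 ≤ p) (h1 : p ≤ 1)
    (ha : a = (1 - p) * (1 - p ^ 2) ^ (Fintype.card V - 2))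
    (hb : b = (1 - 2 * p ^ 2 + p ^ 3) ^ (Fintype.card V - 3))
    (hc : c = (1 - p) ^ 2 * (1 - (2 * p - p ^ 2) ^ 2) *
      ((1 - p ^ 2) ^ 2) ^ (Fintype.card V - 4))
    {u v w x : V} (huv : u ≠ v) (hwx : w ≠ x) :
    expect p (fun G => far G u v * far G w x) ≤
      c + b * ((if w = u then 1 else 0) + (if w = v then 1 else 0) + (if x = u then 1 else 0) +
        (if x = v then 1 else 0)) +
      a * ((if (w, x) = (u, v) then 1 else 0) + (if (w, x) = (v, u) then 1 else 0)) := by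
  have ha0 : 0 ≤ a := by
    rw [ha]
    exact mul_nonneg (by linarith) (pow_nonneg (by nlinarith) _)
  have hb0 : 0 ≤ b := by
    rw [hb]
    refine pow_nonneg ?_ _
    nlinarith [mul_nonneg (sub_nonneg.2 h1) (mul_nonneg h0 (sub_nonneg.2 h1))]
  have hc0 : 0 ≤ c := by
    rw [hc]
    have : 0 ≤ 1 - (2 * p - p ^ 2) ^ 2 := by
      have h2 : 0 ≤ (1 - p) ^ 2 := sq_nonneg _
      nlinarith [mul_nonneg h0 (sub_nonneg.2 h1)]
    positivity
  have hshared : ∀ {r s t : V}, r ≠ s → r ≠ t → s ≠ t →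
      expect p (fun G => far G r s * far G r t) ≤ b := fun h h' h'' =>
    hb ▸ expect_far_mul_far_shared_le h0 h1 h h' h''
  have hself : ∀ {r s : V}, r ≠ s → expect p (fun G => far G r s * far G r s) = a := by
    intro r s h
    simp only [far_mul_self, expect_far p h, ha]
  by_cases hwu : w = u
  · subst hwu
    by_cases hxv : x = v
    · subst hxv
      rw [hself huv]
      simp [huv, huv.symm]
      linarith
    · have := hshared huv hwx (Ne.symm hxv)
      simp [huv, hxv, hwx.symm]
      linarith
  by_cases hwv : w = v
  · subst hwv
    simp only [far_comm _ u w]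
    by_cases hxu : x = u
    · subst hxu
      rw [hself hwx]
      simp [huv, huv.symm]
      linarith
    · have := hshared huv.symm hwx (Ne.symm hxu)
      simp [huv.symm, hxu, hwx.symm]
      linarith
  by_cases hxu : x = u
  · subst hxu
    simp only [far_comm _ w x]
    have := hshared huv (Ne.symm hwu) (Ne.symm hwv)
    simp [hwu, hwv, huv]
    linarith
  by_cases hxv : x = v
  · subst hxv
    simp only [far_comm _ w x, far_comm _ u x]
    have := hshared huv.symm (Ne.symm hwv) (Ne.symm hwu)
    simp [hwu, hwv, huv.symm]
    linarith
  rw [expect_far_mul_far_disjoint p huv (Ne.symm hwu) (Ne.symm hxu) (Ne.symm hwv)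
    (Ne.symm hxv) hwx, ← hc]
  simp [hwu, hwv, hxu, hxv]

lemma expect_farCount (p : ℝ) :
    expect p (fun G : SimpleGraph V => farCount G) =
      Fintype.card V * (Fintype.card V - 1) *
        ((1 - p) * (1 - p ^ 2) ^ (Fintype.card V - 2)) := by
  simp only [farCount]
  rw [expect_sum, Finset.sum_congr rfl
    (g := fun _ => (1 - p) * (1 - p ^ 2) ^ (Fintype.card V - 2)), Finset.sum_const,
    nsmul_eq_mul, card_offDiag_univ]
  intro q hq
  exact expect_far p (Finset.mem_offDiag.1 hq).2.2

lemma expect_farCount_sq_le {p a b c : ℝ} (h0 : 0 ≤ p) (h1 : p ≤ 1)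
    (ha : a = (1 - p) * (1 - p ^ 2) ^ (Fintype.card V - 2))
    (hb : b = (1 - 2 * p ^ 2 + p ^ 3) ^ (Fintype.card V - 3))
    (hc : c = (1 - p) ^ 2 * (1 - (2 * p - p ^ 2) ^ 2) *
      ((1 - p ^ 2) ^ 2) ^ (Fintype.card V - 4)) :
    expect p (fun G : SimpleGraph V => farCount G ^ 2) ≤
      Fintype.card V * (Fintype.card V - 1) *
        (Fintype.card V * (Fintype.card V - 1) * c + 4 * (Fintype.card V - 1) * b + 2 * a) := by
  have ha0 : 0 ≤ a := by
    rw [ha]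
    exact mul_nonneg (by linarith) (pow_nonneg (by nlinarith) _)
  have hb0 : 0 ≤ b := by
    rw [hb]
    refine pow_nonneg ?_ _
    nlinarith [mul_nonneg (sub_nonneg.2 h1) (mul_nonneg h0 (sub_nonneg.2 h1))]
  simp only [farCount, sq, Finset.sum_mul_sum]
  rw [expect_sum]
  simp only [expect_sum]
  rw [← card_offDiag_univ, ← nsmul_eq_mul]
  refine Finset.sum_le_card_nsmul _ _ _ ?_
  rintro ⟨u, v⟩ huv
  have huv' := (Finset.mem_offDiag.1 huv).2.2
  refine (Finset.sum_le_sum fun q hq => expect_far_mul_far_le h0 h1 ha hb hc huv'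
    (Finset.mem_offDiag.1 hq).2.2).trans ?_
  simp only [Finset.sum_add_distrib, ← Finset.mul_sum, Finset.sum_boole, Finset.sum_const,
    nsmul_eq_mul]
  have hb1 := mul_le_mul_of_nonneg_left (add_le_add (add_le_add (add_le_add
    (card_offDiag_filter_fst_le u) (card_offDiag_filter_fst_le v))
    (card_offDiag_filter_snd_le u)) (card_offDiag_filter_snd_le v)) hb0
  have ha1 := mul_le_mul_of_nonneg_left (add_le_add (card_offDiag_filter_eq_le (u, v))
    (card_offDiag_filter_eq_le (v, u))) ha0
  simp only [Prod.mk.eta]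
  linarith

lemma card_potentialEdges : (potentialEdges V).card = (Fintype.card V).choose 2 := by
  rw [← Sym2.card_subtype_not_diag, Fintype.card_subtype, potentialEdges]

lemma weight_eq (p : ℝ) (G : SimpleGraph V) :
    weight p G = p ^ Nat.card G.edgeSet *
      (1 - p) ^ ((Fintype.card V).choose 2 - Nat.card G.edgeSet) := by
  have h : Nat.card G.edgeSet = ((potentialEdges V).filter fun e => e ∈ G.edgeSet).card := by
    rw [Nat.card_eq_fintype_card, Fintype.card_subtype]
    congr 1
    ext e
    simp only [potentialEdges, mem_filter, mem_univ, true_and]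
    exact ⟨fun h => ⟨G.not_isDiag_of_mem_edgeSet h, h⟩, fun h => h.2⟩
  have h2 := Finset.card_filter_add_card_filter_not (s := potentialEdges V)
    (fun e => e ∈ G.edgeSet)
  rw [card_potentialEdges] at h2
  rw [weight, Finset.prod_ite, Finset.prod_const, Finset.prod_const, h]
  congr 2
  omega

lemma diam2Prob_eq_expect (n : ℕ) (p : ℝ) :
    diam2Prob n p = expect p fun G : SimpleGraph (Fin n) =>
      if G.Connected ∧ ∀ u v : Fin n, G.dist u v ≤ 2 then 1 else 0 := by
  rw [diam2Prob, expect]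
  refine Finset.sum_congr (by ext; simp) fun G _ => ?_
  rw [weight_eq, Fintype.card_fin]
  split_ifs <;> simp

lemma diam2Prob_le_one {n : ℕ} {p : ℝ} (h0 : 0 ≤ p) (h1 : p ≤ 1) : diam2Prob n p ≤ 1 := by
  rw [diam2Prob_eq_expect]
  refine (expect_mono h0 h1 fun G => ?_).trans_eq (expect_one p)
  split_ifs <;> norm_num

lemma diam2Prob_mul_sq_le {n : ℕ} {p a b c : ℝ} (h0 : 0 ≤ p) (h1 : p ≤ 1)
    (ha : a = (1 - p) * (1 - p ^ 2) ^ (n - 2))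
    (hb : b = (1 - 2 * p ^ 2 + p ^ 3) ^ (n - 3))
    (hc : c = (1 - p) ^ 2 * (1 - (2 * p - p ^ 2) ^ 2) * ((1 - p ^ 2) ^ 2) ^ (n - 4)) :
    (n * (n - 1) * a) ^ 2 * diam2Prob n p ≤
      n * (n - 1) * (n * (n - 1) * c + 4 * (n - 1) * b + 2 * a) - (n * (n - 1) * a) ^ 2 := by
  have hsq := expect_farCount_sq_le (V := Fin n) h0 h1 (by simpa using ha) (by simpa using hb)
    (by simpa using hc)
  have hmean := expect_farCount (V := Fin n) p
  simp only [Fintype.card_fin, ← ha] at hsq hmean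
  set m : ℝ := n * (n - 1) * a with hm
  have hvar : expect p (fun G : SimpleGraph (Fin n) => farCount G ^ 2 - 2 * m * farCount G +
      m ^ 2 * 1) = expect p (fun G : SimpleGraph (Fin n) => farCount G ^ 2) - m ^ 2 := by
    rw [expect_add, expect_sub, expect_const_mul, expect_const_mul, hmean, expect_one]
    ring
  rw [diam2Prob_eq_expect, ← expect_const_mul]
  refine le_trans (expect_mono h0 h1 fun G => ?_) (hvar.trans_le (sub_le_sub_right hsq _))
  split_ifs with h
  · rw [farCount_eq_zero h.1 h.2]
    linarith
  · nlinarith [sq_nonneg (farCount G - m)]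

lemma one_sub_sq_pow_mul_exp_ge {p δ : ℝ} {n : ℕ} (h0 : 0 ≤ p) (hp : p ≤ 1 / 100)
    (hnp : n * p ^ 3 ≤ δ) : 1 - 2 * δ ≤ (1 - p ^ 2) ^ n * Real.exp (n * p ^ 2) := by
  have hp2 : p ^ 2 ≤ 1 / 100 := by nlinarith
  have h1 : 1 ≤ (1 - p ^ 2) * Real.exp (p ^ 2 + 2 * p ^ 4) := by
    have h := Real.add_one_le_exp (p ^ 2 + 2 * p ^ 4)
    have h2 := mul_le_mul_of_nonneg_left h (show 0 ≤ 1 - p ^ 2 by linarith)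
    nlinarith [mul_nonneg (pow_nonneg h0 4) (show 0 ≤ 1 / 2 - p ^ 2 by linarith)]
  have h2 : 1 ≤ (1 - p ^ 2) ^ n * Real.exp (n * p ^ 2) * Real.exp (2 * (n * p ^ 4)) := by
    have h := one_le_pow₀ h1 (n := n)
    rwa [mul_pow, ← Real.exp_nat_mul, show (n : ℝ) * (p ^ 2 + 2 * p ^ 4) =
      n * p ^ 2 + 2 * (n * p ^ 4) by ring, Real.exp_add, ← mul_assoc] at h
  have h3 : (n : ℝ) * p ^ 4 ≤ δ := by
    have : 0 ≤ (n : ℝ) * p ^ 3 := by positivity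
    nlinarith
  have h4 := Real.add_one_le_exp (-(2 * (n * p ^ 4)))
  rw [Real.exp_neg] at h4
  have h5 : (Real.exp (2 * (n * p ^ 4)))⁻¹ ≤ (1 - p ^ 2) ^ n * Real.exp (n * p ^ 2) := by
    rw [inv_le_iff_one_le_mul₀ (Real.exp_pos _)]
    exact h2
  linarith

lemma shared_bound {p δ : ℝ} {k : ℕ} (h0 : 0 ≤ p) (hp : p ≤ 1 / 100) (hδ : δ ≤ 1 / 100)
    (hnp : ((k + 4 : ℕ) : ℝ) * p ^ 3 ≤ δ) :
    (1 - 2 * p ^ 2 + p ^ 3) ^ (k + 1) ≤ 3 / 2 * ((1 - p) * (1 - p ^ 2) ^ (k + 2)) ^ 2 := by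
  have hp2 : p ^ 2 ≤ 1 / 10000 := by nlinarith
  have hp3 : 0 ≤ p ^ 3 := by positivity
  have hbase0 : 0 ≤ 1 - 2 * p ^ 2 + p ^ 3 := by nlinarith
  have hbase : 1 - 2 * p ^ 2 + p ^ 3 ≤ (1 - p ^ 2) ^ 2 * (1 + 2 * p ^ 3) := by
    nlinarith [mul_nonneg hp3 (show 0 ≤ 1 - 4 * p ^ 2 by linarith), pow_nonneg h0 4,
      pow_nonneg h0 7]
  have hexp : (1 + 2 * p ^ 3) ^ (k + 1) ≤ 104 / 100 := by
    have h := pow_le_pow_left₀ (by positivity) (Real.add_one_le_exp (2 * p ^ 3)) (k + 1)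
    rw [← Real.exp_nat_mul, add_comm (2 * p ^ 3)] at h
    refine h.trans ?_
    have hx : ((k + 1 : ℕ) : ℝ) * (2 * p ^ 3) ≤ 2 / 100 := by
      push_cast at hnp ⊢
      nlinarith
    have h2 := Real.add_one_le_exp (-(((k + 1 : ℕ) : ℝ) * (2 * p ^ 3)))
    rw [Real.exp_neg] at h2
    have h3 : 98 / 100 ≤ (Real.exp (((k + 1 : ℕ) : ℝ) * (2 * p ^ 3)))⁻¹ := by linarith
    rw [le_inv_comm₀ (by norm_num) (Real.exp_pos _)] at h3
    exact h3.trans (by norm_num)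
  have hconst : 104 / 100 ≤ 3 / 2 * ((1 - p) ^ 2 * (1 - p ^ 2) ^ 2) := by
    have h1 : 98 / 100 ≤ (1 - p) ^ 2 := by nlinarith
    have h2 : 98 / 100 ≤ (1 - p ^ 2) ^ 2 := by nlinarith
    nlinarith
  calc (1 - 2 * p ^ 2 + p ^ 3) ^ (k + 1)
      ≤ ((1 - p ^ 2) ^ 2 * (1 + 2 * p ^ 3)) ^ (k + 1) := pow_le_pow_left₀ hbase0 hbase _
    _ = ((1 - p ^ 2) ^ 2) ^ (k + 1) * (1 + 2 * p ^ 3) ^ (k + 1) := mul_pow _ _ _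
    _ ≤ ((1 - p ^ 2) ^ 2) ^ (k + 1) * (3 / 2 * ((1 - p) ^ 2 * (1 - p ^ 2) ^ 2)) :=
        mul_le_mul_of_nonneg_left (hexp.trans hconst) (by positivity)
    _ = _ := by
        generalize 1 - p ^ 2 = q
        ring

lemma disjoint_bound {p : ℝ} {k : ℕ} (h0 : 0 ≤ p) (hp : p ≤ 1 / 100)
    (hnp : ((k + 4 : ℕ) : ℝ) * p ^ 3 ≤ 1 / 100) :
    ((k + 4 : ℕ) : ℝ) * ((1 - p) ^ 2 * (1 - (2 * p - p ^ 2) ^ 2) * ((1 - p ^ 2) ^ 2) ^ k) ≤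
      (((k + 4 : ℕ) : ℝ) + 2) * ((1 - p) * (1 - p ^ 2) ^ (k + 2)) ^ 2 := by
  have hp2 : p ^ 2 ≤ 1 / 10000 := by nlinarith
  have hp3 : 0 ≤ p ^ 3 := by positivity
  have h1 : 1 - 4 * p ^ 2 ≤ (1 - p ^ 2) ^ 4 := by
    have := one_add_mul_le_pow (show -2 ≤ -p ^ 2 by linarith) 4
    push_cast at this
    rw [← sub_eq_add_neg] at this
    linarith
  have h2 : 1 - (2 * p - p ^ 2) ^ 2 ≤ (1 + 8 * p ^ 3) * (1 - p ^ 2) ^ 4 := by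
    refine le_trans ?_ (mul_le_mul_of_nonneg_left h1 (by positivity))
    nlinarith [mul_nonneg hp3 (show 0 ≤ 1 - 8 * p ^ 2 by linarith), pow_nonneg h0 4]
  have h3 : ((k + 4 : ℕ) : ℝ) * (1 - (2 * p - p ^ 2) ^ 2) ≤
      (((k + 4 : ℕ) : ℝ) + 2) * (1 - p ^ 2) ^ 4 := by
    have h4 := mul_le_mul_of_nonneg_left h2 (Nat.cast_nonneg (α := ℝ) (k + 4))
    have h5 : (0 : ℝ) ≤ (1 - p ^ 2) ^ 4 := by positivity
    nlinarith
  have h6 := mul_le_mul_of_nonneg_left h3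
    (show 0 ≤ (1 - p) ^ 2 * ((1 - p ^ 2) ^ 2) ^ k by positivity)
  calc _ = (1 - p) ^ 2 * ((1 - p ^ 2) ^ 2) ^ k *
        (((k + 4 : ℕ) : ℝ) * (1 - (2 * p - p ^ 2) ^ 2)) := by ring
    _ ≤ _ := h6
    _ = _ := by
        generalize 1 - p ^ 2 = q
        ring

lemma mean_bound {ε δ x y E : ℝ} (hδ0 : 0 < δ) (hδ : δ ≤ 1 / 100) (hδε : 124 * δ ≤ ε)
    (hx : 4 ≤ x) (hxδ : 1 ≤ δ * x) (hE : (1 - δ) * (1 - 2 * δ) ≤ y * E) :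
    x ≤ (1 + ε) * E * (x - 1) * y := by
  have h1 : (1 - δ) * x ≤ x - 1 := by linarith
  have h2 : ((1 - δ) * x) * ((1 - δ) * (1 - 2 * δ)) ≤ (x - 1) * (y * E) :=
    mul_le_mul h1 hE (mul_nonneg (by linarith) (by linarith)) (by linarith)
  have h3 : 1 - 4 * δ ≤ (1 - δ) * ((1 - δ) * (1 - 2 * δ)) := by
    nlinarith [mul_nonneg (sq_nonneg δ) (show 0 ≤ 5 - 2 * δ by linarith)]
  have h4 : 1 ≤ (1 + ε) * (1 - 4 * δ) := by nlinarith
  calc x ≤ x * ((1 + ε) * (1 - 4 * δ)) := le_mul_of_one_le_right (by linarith) h4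
    _ ≤ x * ((1 + ε) * ((1 - δ) * ((1 - δ) * (1 - 2 * δ)))) :=
        mul_le_mul_of_nonneg_left (mul_le_mul_of_nonneg_left h3 (by linarith)) (by linarith)
    _ = (1 + ε) * (((1 - δ) * x) * ((1 - δ) * (1 - 2 * δ))) := by ring
    _ ≤ (1 + ε) * ((x - 1) * (y * E)) := mul_le_mul_of_nonneg_left h2 (by linarith)
    _ = _ := by ring

lemma le_of_second_moment_bounds {x a b c R P : ℝ} (hx : 4 ≤ x) (ha : 0 < a)
    (hb : b ≤ 3 / 2 * a ^ 2) (hc : x * c ≤ (x + 2) * a ^ 2) (hR : 2 ≤ R * (x * (x - 1) * a))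
    (hP : (x * (x - 1) * a) ^ 2 * P ≤
      x * (x - 1) * (x * (x - 1) * c + 4 * (x - 1) * b + 2 * a) - (x * (x - 1) * a) ^ 2) :
    P ≤ R + 8 / x := by
  have hx0 : 0 < x := by linarith
  have hm : 0 < x * (x - 1) * a := mul_pos (mul_pos hx0 (by linarith)) ha
  refine le_of_mul_le_mul_left (hP.trans ?_) (pow_pos hm 2)
  have h1 := mul_le_mul_of_nonneg_left hc (show 0 ≤ x * (x - 1) ^ 2 by positivity)
  have h2 := mul_le_mul_of_nonneg_left hb (show 0 ≤ 4 * x * (x - 1) ^ 2 by positivity)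
  have h3 := mul_le_mul_of_nonneg_left hR hm.le
  have h4 : (x * (x - 1) * a) ^ 2 * (8 / x) = 8 * x * (x - 1) ^ 2 * a ^ 2 := by
    field_simp
  rw [mul_add (_ ^ 2), h4]
  linarith

lemma add_le_target {ε x t : ℝ} (hε : 0 ≤ ε) (hx : 0 < x) :
    (1 + ε) * (2 / x ^ 2) * Real.exp (x * t ^ 2) + 8 / x ≤
      (1 + ε) * (2 / x ^ 2) * Real.exp (x * t ^ 2) *
        (1 + 4 * x * Real.exp (x * t ^ 2 * (t ^ 2 - 1))) := by
  rw [mul_add, mul_one]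
  refine add_le_add le_rfl ?_
  have h : (1 + ε) * (2 / x ^ 2) * Real.exp (x * t ^ 2) *
      (4 * x * Real.exp (x * t ^ 2 * (t ^ 2 - 1))) =
      8 / x * ((1 + ε) * Real.exp (x * t ^ 4)) := by
    rw [show x * t ^ 4 = x * t ^ 2 + x * t ^ 2 * (t ^ 2 - 1) by ring, Real.exp_add]
    field_simp
    ring
  rw [h]
  refine le_mul_of_one_le_right (by positivity) ?_
  exact one_le_mul_of_one_le_of_one_le (by linarith) (Real.one_le_exp (by positivity))

lemma diam2Prob_le_of_small {ε δ p : ℝ} {n : ℕ} (h0 : 0 < p) (hδ0 : 0 < δ) (hδ : δ ≤ 1 / 100)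
    (hδε : 124 * δ ≤ ε) (hn : 4 ≤ n) (hnδ : 1 ≤ δ * n) (hp : p ≤ δ) (hnp : n * p ^ 3 ≤ δ) :
    diam2Prob n p ≤ (1 + ε) * (2 / (n : ℝ) ^ 2) * Real.exp (n * p ^ 2) *
      (1 + 4 * (n : ℝ) * Real.exp (n * p ^ 2 * (p ^ 2 - 1))) := by
  have hp' : p ≤ 1 / 100 := hp.trans hδ
  have hn4 : (4 : ℝ) ≤ n := by exact_mod_cast hn
  have hnpos : (0 : ℝ) < n := by linarith
  have hq0 : 0 < 1 - p ^ 2 := by nlinarith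
  have hq1 : 1 - p ^ 2 ≤ 1 := by nlinarith
  refine le_trans ?_ (add_le_target (by linarith) hnpos)
  obtain ⟨k, rfl⟩ := Nat.exists_eq_add_of_le' hn
  have haE : (1 - δ) * (1 - 2 * δ) ≤
      (1 - p) * (1 - p ^ 2) ^ (k + 2) * Real.exp (((k + 4 : ℕ) : ℝ) * p ^ 2) := by
    rw [mul_assoc]
    refine mul_le_mul (by linarith) ((one_sub_sq_pow_mul_exp_ge h0.le hp' hnp).trans ?_)
      (by linarith) (by linarith)
    exact mul_le_mul_of_nonneg_right (pow_le_pow_of_le_one hq0.le hq1 (by omega))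
      (Real.exp_pos _).le
  refine le_of_second_moment_bounds hn4 (mul_pos (by linarith) (pow_pos hq0 (k + 2)))
    (shared_bound h0.le hp' hδ hnp) (disjoint_bound h0.le hp' (hnp.trans hδ)) ?_
    (diam2Prob_mul_sq_le h0.le (by linarith) rfl rfl rfl)
  have hfirst := mean_bound hδ0 hδ hδε hn4 hnδ haE
  generalize ((k + 4 : ℕ) : ℝ) = x at hfirst hnpos ⊢
  generalize (1 - p) * (1 - p ^ 2) ^ (k + 2) = a at hfirst ⊢
  generalize Real.exp (x * p ^ 2) = E at hfirst ⊢
  have h : (1 + ε) * (2 / x ^ 2) * E * (x * (x - 1) * a) =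
      2 * (((1 + ε) * E * (x - 1) * a) / x) := by
    field_simp
  rw [h]
  linarith [(one_le_div hnpos).2 hfirst]

lemma eventually_mul_cube_le {δ : ℝ} (hδ : 0 < δ) :
    ∀ᶠ n : ℕ in Filter.atTop, ∀ p : ℝ, 0 < p → Real.exp (n * p ^ 2) ≤ (n : ℝ) ^ 2 →
      n * p ^ 3 ≤ δ := by
  have hlog := (Real.isLittleO_pow_log_id_atTop (n := 3)).comp_tendsto
    (tendsto_natCast_atTop_atTop (R := ℝ))
  have hev := hlog.def (show 0 < δ ^ 2 / 8 by positivity)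
  filter_upwards [hev, Filter.eventually_ge_atTop 1] with n hn hn1 p hp hexp
  have hnpos : (0 : ℝ) < n := by exact_mod_cast hn1
  simp only [Function.comp, id, Real.norm_eq_abs, abs_of_pos hnpos] at hn
  have h1 : n * p ^ 2 ≤ 2 * Real.log n := by
    have := (Real.le_log_iff_exp_le (by positivity)).2 hexp
    rwa [Real.log_pow] at this
  have h2 : (n * p ^ 2) ^ 3 ≤ δ ^ 2 * n := by
    have h3 := pow_le_pow_left₀ (by positivity) h1 3
    have h4 := (le_abs_self _).trans hn
    nlinarith
  refine le_of_sq_le_sq ?_ hδ.le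
  refine le_of_mul_le_mul_right ?_ hnpos
  calc (n * p ^ 3) ^ 2 * n = (n * p ^ 2) ^ 3 := by ring
    _ ≤ _ := h2

end RandomGraph

/-- If `p(n) → 0`, then for every `ε > 0`, for all large `n`,
`P(n,p(n)) ≤ (1+ε)(2/n²)e^{n p(n)²}(1 + 4n e^{n p(n)² (p(n)² - 1)})`. -/
theorem diam2Prob_upper_asymptotic (p : ℕ → ℝ) (hp : ∀ n, p n ∈ Set.Ioo (0 : ℝ) 1)
    (hp0 : Filter.Tendsto p Filter.atTop (nhds 0)) :
    ∀ ε > (0 : ℝ), ∃ N : ℕ, ∀ n ≥ N,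
      diam2Prob n (p n) ≤
        (1 + ε) * (2 / (n : ℝ) ^ 2) * Real.exp (n * (p n) ^ 2) *
          (1 + 4 * (n : ℝ) * Real.exp (n * (p n) ^ 2 * ((p n) ^ 2 - 1))) := by
  intro ε hε
  rw [← Filter.eventually_atTop]
  set δ := min (1 / 100) (ε / 124) with hδ
  have hδ0 : 0 < δ := lt_min (by norm_num) (by positivity)
  have hδ1 : δ ≤ 1 / 100 := min_le_left _ _
  have hδ2 : δ ≤ ε / 124 := min_le_right _ _
  have hlarge : ∀ᶠ n : ℕ in Filter.atTop, 1 / δ ≤ (n : ℝ) :=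
    tendsto_natCast_atTop_atTop.eventually_ge_atTop _
  filter_upwards [RandomGraph.eventually_mul_cube_le hδ0, Filter.eventually_ge_atTop 4, hlarge,
    hp0.eventually_le_const hδ0] with n hcube hn4 hnδ hpδ
  obtain ⟨h0, h1⟩ := hp n
  rw [div_le_iff₀' hδ0] at hnδ
  rcases le_total (Real.exp (n * p n ^ 2)) ((n : ℝ) ^ 2) with h | h
  · exact RandomGraph.diam2Prob_le_of_small h0 hδ0 hδ1 (by linarith) hn4 hnδ hpδ (hcube _ h0 h)
  · refine (RandomGraph.diam2Prob_le_one h0.le h1.le).trans ?_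
    have hn : (0 : ℝ) < (n : ℝ) ^ 2 := by positivity
    have h2 : 1 ≤ Real.exp (n * p n ^ 2) / (n : ℝ) ^ 2 := (one_le_div hn).2 h
    have h3 : 1 ≤ (1 + ε) * (2 / (n : ℝ) ^ 2) * Real.exp (n * p n ^ 2) := by
      rw [show (1 + ε) * (2 / (n : ℝ) ^ 2) * Real.exp (n * p n ^ 2) =
        (1 + ε) * 2 * (Real.exp (n * p n ^ 2) / (n : ℝ) ^ 2) by ring]
      nlinarith
    refine one_le_mul_of_one_le_of_one_le h3 ?_
    exact le_add_of_nonneg_right (by positivity)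
end

section
/- Let p : ℕ → (0,1) be a sequence of edge probabilities with p(n) → 0 as n → ∞, and suppose that the sequence 2·log n − n·p(n)² − log 2 converges to some real number c with c > 0. Then for every ε > 0 there exists N such that for all n ≥ N, P(n,p(n)) ≤ (1+ε)·e^{−c}. -/
open scoped Classical

open MeasureTheory ProbabilityTheory

/-- The Bernoulli measure on `Bool` giving mass `p` to `true`. -/
noncomputable def coinMeasure (p : ℝ) : Measure Bool :=
  ENNReal.ofReal p • Measure.dirac true + ENNReal.ofReal (1 - p) • Measure.dirac false

/-- Independent coin flips, with success probability `p`, indexed by `ι`. -/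
noncomputable def coinsMeasure (ι : Type*) [Fintype ι] (p : ℝ) : Measure (ι → Bool) :=
  Measure.pi fun _ => coinMeasure p

lemma isProbabilityMeasure_coinMeasure {p : ℝ} (hp : p ∈ Set.Icc (0 : ℝ) 1) :
    IsProbabilityMeasure (coinMeasure p) := by
  refine ⟨?_⟩
  simp only [coinMeasure, Measure.coe_add, Measure.coe_smul, Pi.add_apply, Pi.smul_apply,
    measure_univ, smul_eq_mul, mul_one]
  rw [← ENNReal.ofReal_add hp.1 (by linarith [hp.2])]
  simp

lemma coinMeasure_real_true {p : ℝ} (hp : p ∈ Set.Icc (0 : ℝ) 1) :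
    (coinMeasure p).real {true} = p := by
  simp [coinMeasure, measureReal_def, hp.1]

lemma coinMeasure_real_false {p : ℝ} (hp : p ∈ Set.Icc (0 : ℝ) 1) :
    (coinMeasure p).real {false} = 1 - p := by
  simp [coinMeasure, measureReal_def, hp.2]

/-- The event `A` is determined by the coordinates in `S`. -/
def DeterminedBy {ι : Type*} (A : Set (ι → Bool)) (S : Finset ι) : Prop :=
  ∀ ω ω' : ι → Bool, (∀ e ∈ S, ω e = ω' e) → ω ∈ A → ω' ∈ A

lemma DeterminedBy.eq_preimage {ι : Type*} {A : Set (ι → Bool)} {S : Finset ι} (h : DeterminedBy A S) :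
    A = (fun (ω : ι → Bool) (e : S) => ω e) ⁻¹' ((fun (ω : ι → Bool) (e : S) => ω e) '' A) := by
  ext ω
  refine ⟨fun hω => ⟨ω, hω, rfl⟩, ?_⟩
  rintro ⟨ω', hω', he⟩
  exact h ω' ω (fun e heS => congrFun he ⟨e, heS⟩) hω'

lemma DeterminedBy.biInter {ι κ : Type*} [DecidableEq ι] {T : Finset κ} {A : κ → Set (ι → Bool)}
    {F : κ → Finset ι} (hA : ∀ i ∈ T, DeterminedBy (A i) (F i)) :
    DeterminedBy (⋂ i ∈ T, A i) (T.biUnion F) := by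
  intro ω ω' h hω
  simp only [Set.mem_iInter] at hω ⊢
  exact fun i hi => hA i hi ω ω' (fun e he => h e (Finset.mem_biUnion.2 ⟨i, hi, he⟩)) (hω i hi)

section Coins

variable {ι : Type*} [Fintype ι] {p : ℝ}

lemma isProbabilityMeasure_coinsMeasure (hp : p ∈ Set.Icc (0 : ℝ) 1) :
    IsProbabilityMeasure (coinsMeasure ι p) := by
  have := isProbabilityMeasure_coinMeasure hp
  unfold coinsMeasure
  infer_instance

lemma coinsMeasure_real_inter (hp : p ∈ Set.Icc (0 : ℝ) 1) {A B : Set (ι → Bool)}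
    {S T : Finset ι} (hST : Disjoint S T) (hA : DeterminedBy A S) (hB : DeterminedBy B T) :
    (coinsMeasure ι p).real (A ∩ B) =
      (coinsMeasure ι p).real A * (coinsMeasure ι p).real B := by
  have := isProbabilityMeasure_coinMeasure hp
  have hind : iIndepFun (fun (e : ι) (ω : ι → Bool) => ω e) (coinsMeasure ι p) :=
    iIndepFun_pi (X := fun _ : ι => (id : Bool → Bool)) fun _ => aemeasurable_id
  have h := hind.indepFun_finset S T hST fun e => measurable_pi_apply e
  rw [hA.eq_preimage, hB.eq_preimage]
  simp only [measureReal_def, ← ENNReal.toReal_mul]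
  rw [h.measure_inter_preimage_eq_mul _ _ (Set.toFinite _).measurableSet
    (Set.toFinite _).measurableSet]

lemma coinsMeasure_real_biInter (hp : p ∈ Set.Icc (0 : ℝ) 1) {κ : Type*} (T : Finset κ)
    (A : κ → Set (ι → Bool)) (F : κ → Finset ι)
    (hF : (T : Set κ).PairwiseDisjoint F) (hA : ∀ i ∈ T, DeterminedBy (A i) (F i)) :
    (coinsMeasure ι p).real (⋂ i ∈ T, A i) = ∏ i ∈ T, (coinsMeasure ι p).real (A i) := by
  have := isProbabilityMeasure_coinsMeasure (ι := ι) hp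
  induction T using Finset.induction_on with
  | empty => simp
  | insert a T ha ih =>
    rw [Finset.set_biInter_insert, Finset.prod_insert ha,
      coinsMeasure_real_inter hp (S := F a) (T := T.biUnion F), ih]
    · exact hF.subset (by simp)
    · exact fun i hi => hA i (Finset.mem_insert_of_mem hi)
    · rw [Finset.disjoint_biUnion_right]
      intro i hi
      exact hF (by simp) (by simp [hi]) (by rintro rfl; exact ha hi)
    · exact hA a (by simp)
    · exact DeterminedBy.biInter fun i hi => hA i (Finset.mem_insert_of_mem hi)

lemma coinsMeasure_real_cylinder (hp : p ∈ Set.Icc (0 : ℝ) 1) (s : ι → Set Bool) :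
    (coinsMeasure ι p).real (Set.univ.pi s) = ∏ e, (coinMeasure p).real (s e) := by
  have := isProbabilityMeasure_coinMeasure hp
  simp [coinsMeasure, measureReal_def, Measure.pi_pi, ENNReal.toReal_prod]

lemma coinsMeasure_real_forall_true (hp : p ∈ Set.Icc (0 : ℝ) 1) (S : Finset ι) :
    (coinsMeasure ι p).real {ω | ∀ e ∈ S, ω e = true} = p ^ S.card := by
  have := isProbabilityMeasure_coinMeasure hp
  have h : {ω : ι → Bool | ∀ e ∈ S, ω e = true} =
      Set.univ.pi fun e => if e ∈ S then {true} else Set.univ := by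
    ext ω
    simp only [Set.mem_ofPred_eq, Set.mem_univ_pi]
    refine forall_congr' fun e => ?_
    by_cases he : e ∈ S <;> simp [he]
  rw [h, coinsMeasure_real_cylinder hp, ← Finset.prod_const]
  rw [← Finset.prod_subset (Finset.subset_univ S)]
  · exact Finset.prod_congr rfl fun e he => by simp [he, coinMeasure_real_true hp]
  · intro e _ he
    simp only [if_neg he, probReal_univ]

lemma coinsMeasure_real_false (hp : p ∈ Set.Icc (0 : ℝ) 1) (a : ι) :
    (coinsMeasure ι p).real {ω | ω a = false} = 1 - p := by
  have := isProbabilityMeasure_coinsMeasure (ι := ι) hp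
  have h := coinsMeasure_real_forall_true hp {a}
  have h' : {ω : ι → Bool | ω a = false} = {ω | ∀ e ∈ ({a} : Finset ι), ω e = true}ᶜ := by
    ext; simp
  rw [h', probReal_compl_eq_one_sub (Set.toFinite _).measurableSet, h]
  simp

lemma coinsMeasure_real_not_both (hp : p ∈ Set.Icc (0 : ℝ) 1) {a b : ι} (hab : a ≠ b) :
    (coinsMeasure ι p).real {ω | ¬(ω a = true ∧ ω b = true)} = 1 - p ^ 2 := by
  have := isProbabilityMeasure_coinsMeasure (ι := ι) hp
  have h := coinsMeasure_real_forall_true hp {a, b}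
  have h' : {ω : ι → Bool | ¬(ω a = true ∧ ω b = true)} =
      {ω | ∀ e ∈ ({a, b} : Finset ι), ω e = true}ᶜ := by
    ext; simp
  rw [h', probReal_compl_eq_one_sub (Set.toFinite _).measurableSet, h, Finset.card_pair hab]

lemma coinsMeasure_real_not_both_not_both (hp : p ∈ Set.Icc (0 : ℝ) 1) {a b c : ι}
    (hab : a ≠ b) (hac : a ≠ c) (hbc : b ≠ c) :
    (coinsMeasure ι p).real {ω | ¬(ω a = true ∧ ω b = true) ∧ ¬(ω a = true ∧ ω c = true)} =
      1 - 2 * p ^ 2 + p ^ 3 := by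
  have := isProbabilityMeasure_coinsMeasure (ι := ι) hp
  have h1 := coinsMeasure_real_forall_true hp {a, b}
  have h2 := coinsMeasure_real_forall_true hp {a, c}
  have h3 := coinsMeasure_real_forall_true hp {a, b, c}
  rw [Finset.card_pair hab] at h1
  rw [Finset.card_pair hac] at h2
  rw [Finset.card_eq_three.2 ⟨a, b, c, hab, hac, hbc, rfl⟩] at h3
  set E₁ := {ω : ι → Bool | ∀ e ∈ ({a, b} : Finset ι), ω e = true}
  set E₂ := {ω : ι → Bool | ∀ e ∈ ({a, c} : Finset ι), ω e = true}
  have h' : {ω : ι → Bool | ¬(ω a = true ∧ ω b = true) ∧ ¬(ω a = true ∧ ω c = true)} =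
      (E₁ ∪ E₂)ᶜ := by
    ext; simp [E₁, E₂]
  have h'' : E₁ ∩ E₂ = {ω | ∀ e ∈ ({a, b, c} : Finset ι), ω e = true} := by
    ext; simp [E₁, E₂]; tauto
  have := measureReal_union_add_inter (μ := coinsMeasure ι p) (s := E₁) (t := E₂)
    (Set.toFinite _).measurableSet
  rw [h'', h3, h1, h2] at this
  rw [h', probReal_compl_eq_one_sub (Set.toFinite _).measurableSet]
  linarith

end Coins

/-- The event that `u` and `v` are neither adjacent nor joined by a path of length two. -/
def farApart {V : Type*} (u v : V) : Set (Sym2 V → Bool) :=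
  {ω | ω s(u, v) = false ∧
    ∀ z, z ≠ u → z ≠ v → ¬(ω s(z, u) = true ∧ ω s(z, v) = true)}

lemma farApart_comm {V : Type*} (u v : V) : farApart u v = farApart v u := by
  ext ω
  simp only [farApart, Set.mem_ofPred_eq, Sym2.eq_swap (a := u) (b := v)]
  grind

lemma SimpleGraph.adj_or_exists_adj_adj_of_dist_le_two {V : Type*} {G : SimpleGraph V}
    (hG : G.Connected) {u v : V} (huv : u ≠ v) (h : G.dist u v ≤ 2) :
    G.Adj u v ∨ ∃ z, G.Adj z u ∧ G.Adj z v := by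
  obtain ⟨w, hw⟩ := hG.exists_walk_length_eq_dist u v
  rw [← hw] at h
  match w, h with
  | .nil, _ => exact absurd rfl huv
  | .cons h₁ .nil, _ => exact Or.inl h₁
  | .cons h₁ (.cons h₂ .nil), _ => exact Or.inr ⟨_, h₁.symm, h₂⟩
  | .cons _ (.cons _ (.cons _ _)), h => simp at h

/-- The coin flips on non-loops which produce exactly the edges of `G`. -/
noncomputable def graphCylinder {V : Type*} (G : SimpleGraph V) : Set (Sym2 V → Bool) :=
  Set.univ.pi fun e => if e.IsDiag then Set.univ else {decide (e ∈ G.edgeSet)}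

lemma mem_graphCylinder {V : Type*} {G : SimpleGraph V} {ω : Sym2 V → Bool}
    (hω : ω ∈ graphCylinder G) {u v : V} (huv : u ≠ v) : ω s(u, v) = decide (G.Adj u v) := by
  simpa [huv] using hω s(u, v) (Set.mem_univ _)

lemma graphCylinder_eq_of_mem {V : Type*} {G H : SimpleGraph V} {ω : Sym2 V → Bool}
    (hG : ω ∈ graphCylinder G) (hH : ω ∈ graphCylinder H) : G = H := by
  ext u v
  by_cases huv : u = v
  · simp [huv]
  · have := (mem_graphCylinder hG huv).symm.trans (mem_graphCylinder hH huv)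
    simpa using this

lemma coinsMeasure_real_graphCylinder {p : ℝ} (hp : p ∈ Set.Icc (0 : ℝ) 1) {n : ℕ}
    (G : SimpleGraph (Fin n)) :
    (coinsMeasure (Sym2 (Fin n)) p).real (graphCylinder G) =
      p ^ Nat.card G.edgeSet * (1 - p) ^ (n.choose 2 - Nat.card G.edgeSet) := by
  have := isProbabilityMeasure_coinMeasure hp
  have hsub : G.edgeFinset ⊆ (⊤ : SimpleGraph (Fin n)).edgeFinset :=
    SimpleGraph.edgeFinset_mono le_top
  have hcard : Nat.card G.edgeSet = G.edgeFinset.card := by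
    rw [SimpleGraph.edgeFinset_card, Nat.card_eq_fintype_card]
  rw [graphCylinder, coinsMeasure_real_cylinder hp,
    ← Finset.prod_subset (Finset.subset_univ (⊤ : SimpleGraph (Fin n)).edgeFinset),
    ← Finset.prod_sdiff hsub, mul_comm, hcard]
  · have hc : ((⊤ : SimpleGraph (Fin n)).edgeFinset \ G.edgeFinset).card =
        n.choose 2 - G.edgeFinset.card := by
      rw [Finset.card_sdiff_of_subset hsub, SimpleGraph.card_edgeFinset_top_eq_card_choose_two,
        Fintype.card_fin]
    rw [← hc, ← Finset.prod_const, ← Finset.prod_const]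
    congr 1
    · refine Finset.prod_congr rfl fun e he => ?_
      have he' : e ∈ G.edgeSet := by simpa using he
      rw [if_neg (G.not_isDiag_of_mem_edgeSet he')]
      simp only [he', decide_true, coinMeasure_real_true hp]
    · refine Finset.prod_congr rfl fun e he => ?_
      simp only [Finset.mem_sdiff, SimpleGraph.mem_edgeFinset, SimpleGraph.edgeSet_top,
        Set.mem_compl_iff, Sym2.mem_diagSet] at he
      rw [if_neg (by simpa using he.1)]
      simp only [he.2, decide_false, coinMeasure_real_false hp]
  · intro e _ he
    have he' : e.IsDiag := by simpa using he
    rw [if_pos he', probReal_univ]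

lemma diam2Prob_le {p : ℝ} (hp : p ∈ Set.Icc (0 : ℝ) 1) (n : ℕ) :
    diam2Prob n p ≤ (coinsMeasure (Sym2 (Fin n)) p).real
      {ω | ∀ u v : Fin n, u ≠ v → ω ∉ farApart u v} := by
  have := isProbabilityMeasure_coinsMeasure (ι := Sym2 (Fin n)) hp
  unfold diam2Prob
  rw [← Finset.sum_filter, Finset.sum_congr rfl
    fun G _ => (coinsMeasure_real_graphCylinder hp G).symm, ← measureReal_biUnion_finset]
  · refine measureReal_mono ?_
    intro ω hω
    simp only [Finset.mem_filter, Finset.mem_univ, true_and, Set.mem_iUnion, exists_prop] at hω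
    obtain ⟨G, ⟨hG, hd⟩, hω⟩ := hω
    rintro u v huv ⟨hf, hz⟩
    rw [mem_graphCylinder hω huv, decide_eq_false_iff_not] at hf
    rcases SimpleGraph.adj_or_exists_adj_adj_of_dist_le_two hG huv (hd u v) with h | ⟨z, hu, hv⟩
    · exact hf h
    · refine hz z hu.ne hv.ne ?_
      rw [mem_graphCylinder hω hu.ne, mem_graphCylinder hω hv.ne]
      simp [hu, hv]
  · intro G _ H _ hGH
    exact Set.disjoint_left.2 fun ω h₁ h₂ => hGH (graphCylinder_eq_of_mem h₁ h₂)
  · exact fun G _ => (Set.toFinite _).measurableSet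

/-- The second moment method: an upper bound for the probability that no event of a finite
family occurs. -/
lemma measureReal_forall_notMem_mul_sq_le {Ω κ : Type*} [Finite Ω] [MeasurableSpace Ω]
    [MeasurableSingletonClass Ω] (μ : Measure Ω) [IsProbabilityMeasure μ] (I : Finset κ)
    (B : κ → Set Ω) :
    μ.real {ω | ∀ i ∈ I, ω ∉ B i} * (∑ i ∈ I, μ.real (B i)) ^ 2 ≤
      ∑ i ∈ I, ∑ j ∈ I, μ.real (B i ∩ B j) - (∑ i ∈ I, μ.real (B i)) ^ 2 := by
  set m := ∑ i ∈ I, μ.real (B i) with hm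
  have hint : ∀ f : Ω → ℝ, Integrable f μ := fun f => Integrable.of_finite
  have hind : ∀ s : Set Ω, ∫ ω, s.indicator (1 : Ω → ℝ) ω ∂μ = μ.real s := fun s =>
    integral_indicator_one (Set.toFinite _).measurableSet
  set Y : Ω → ℝ := fun ω => ∑ i ∈ I, (B i).indicator (1 : Ω → ℝ) ω with hY
  have hY1 : ∫ ω, Y ω ∂μ = m := by
    rw [hY, integral_finsetSum _ fun i _ => hint _]
    exact Finset.sum_congr rfl fun i _ => hind _
  have hY2 : ∫ ω, Y ω ^ 2 ∂μ = ∑ i ∈ I, ∑ j ∈ I, μ.real (B i ∩ B j) := by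
    have : ∀ ω, Y ω ^ 2 = ∑ i ∈ I, ∑ j ∈ I, (B i ∩ B j).indicator (1 : Ω → ℝ) ω := by
      intro ω
      simp only [hY, sq, Finset.sum_mul_sum, Set.inter_indicator_one, Pi.mul_apply]
    simp only [this]
    rw [integral_finsetSum _ fun i _ => hint _]
    refine Finset.sum_congr rfl fun i _ => ?_
    rw [integral_finsetSum _ fun i _ => hint _]
    exact Finset.sum_congr rfl fun j _ => hind _
  have key : ∫ ω, {ω | ∀ i ∈ I, ω ∉ B i}.indicator (1 : Ω → ℝ) ω * m ^ 2 ∂μ ≤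
      ∫ ω, (Y ω ^ 2 - 2 * m * Y ω + m ^ 2) ∂μ := by
    refine integral_mono (hint _) (hint _) fun ω => ?_
    by_cases h : ω ∈ {ω | ∀ i ∈ I, ω ∉ B i}
    · have : Y ω = 0 := Finset.sum_eq_zero fun i hi => Set.indicator_of_notMem (h i hi) _
      simp [Set.indicator_of_mem h, this]
    · simp only [Set.indicator_of_notMem h, zero_mul]
      nlinarith [sq_nonneg (Y ω - m)]
  rw [integral_mul_const, hind, integral_add (hint _) (hint _), integral_sub (hint _) (hint _),
    integral_const_mul, hY1, hY2, integral_const, probReal_univ] at key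
  simp only [smul_eq_mul, one_mul] at key
  linarith

lemma one_sub_two_mul_sq_add_cube_nonneg {p : ℝ} (hp : p ∈ Set.Icc (0 : ℝ) 1) :
    0 ≤ 1 - 2 * p ^ 2 + p ^ 3 := by
  have h : 1 - 2 * p ^ 2 + p ^ 3 = (1 - p) * (1 + p * (1 - p)) := by ring
  have := sub_nonneg.2 hp.2
  have := hp.1
  rw [h]
  positivity

section Probabilities

variable {p : ℝ} {n : ℕ}

lemma coinsMeasure_real_farApart (hp : p ∈ Set.Icc (0 : ℝ) 1) {u v : Fin n} (huv : u ≠ v) :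
    (coinsMeasure (Sym2 (Fin n)) p).real (farApart u v) = (1 - p) * (1 - p ^ 2) ^ (n - 2) := by
  set T : Finset (Fin n) := Finset.univ \ {u, v} with hT
  have hcard : T.card = n - 2 := by
    rw [hT, Finset.card_sdiff_of_subset (Finset.subset_univ _), Finset.card_pair huv]; simp
  set A : Fin n → Set (Sym2 (Fin n) → Bool) := fun z =>
    {ω | ¬(ω s(z, u) = true ∧ ω s(z, v) = true)} with hA
  set F : Fin n → Finset (Sym2 (Fin n)) := fun z => {s(z, u), s(z, v)} with hF
  have hdet : ∀ z ∈ T, DeterminedBy (A z) (F z) := by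
    intro z _ ω ω' h hω
    simpa [hA, ← h s(z, u) (by simp [hF]), ← h s(z, v) (by simp [hF])] using hω
  have hset : farApart u v = {ω | ω s(u, v) = false} ∩ ⋂ z ∈ T, A z := by
    ext ω
    simp [farApart, hA, hT]
  have hdisj : (T : Set (Fin n)).PairwiseDisjoint F := by
    intro z hz z' hz' hzz'
    simp only [hT, Finset.coe_sdiff, Set.mem_sdiff, Finset.mem_coe, Finset.mem_insert,
      Finset.mem_singleton, not_or] at hz hz'
    simp only [hF, Function.onFun, Finset.disjoint_left]
    aesop
  rw [hset, coinsMeasure_real_inter hp (S := {s(u, v)}) (T := T.biUnion F) _ _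
    (DeterminedBy.biInter hdet), coinsMeasure_real_false hp,
    coinsMeasure_real_biInter hp T A F hdisj hdet, ← hcard, ← Finset.prod_const]
  · congr 1
    refine Finset.prod_congr rfl fun z hz => coinsMeasure_real_not_both hp ?_
    simp only [hT] at hz
    aesop
  · rw [Finset.disjoint_singleton_left]
    simp only [hF, hT]
    aesop
  · intro ω ω' h hω
    have := h s(u, v) (by simp)
    simp only [Set.mem_ofPred_eq] at hω ⊢
    rw [← this, hω]

lemma coinsMeasure_real_farApart_inter_of_shared (hp : p ∈ Set.Icc (0 : ℝ) 1) {u v w : Fin n}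
    (huv : u ≠ v) (huw : u ≠ w) (hvw : v ≠ w) :
    (coinsMeasure (Sym2 (Fin n)) p).real (farApart u v ∩ farApart u w) ≤
      (1 - 2 * p ^ 2 + p ^ 3) ^ (n - 3) := by
  have := isProbabilityMeasure_coinsMeasure (ι := Sym2 (Fin n)) hp
  set T : Finset (Fin n) := Finset.univ \ {u, v, w} with hT
  have hcard : T.card = n - 3 := by
    rw [hT, Finset.card_sdiff_of_subset (Finset.subset_univ _),
      Finset.card_eq_three.2 ⟨u, v, w, huv, huw, hvw, rfl⟩]
    simp
  set A : Fin n → Set (Sym2 (Fin n) → Bool) := fun z =>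
    {ω | ¬(ω s(z, u) = true ∧ ω s(z, v) = true) ∧ ¬(ω s(z, u) = true ∧ ω s(z, w) = true)} with hA
  set F : Fin n → Finset (Sym2 (Fin n)) := fun z => {s(z, u), s(z, v), s(z, w)} with hF
  have hdet : ∀ z ∈ T, DeterminedBy (A z) (F z) := by
    intro z _ ω ω' h hω
    simpa [hA, ← h s(z, u) (by simp [hF]), ← h s(z, v) (by simp [hF]),
      ← h s(z, w) (by simp [hF])] using hω
  have hset : farApart u v ∩ farApart u w ⊆ ⋂ z ∈ T, A z := by
    intro ω hω
    simp only [Set.mem_iInter]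
    intro z hz
    simp only [hT, Finset.mem_sdiff, Finset.mem_insert, Finset.mem_singleton, not_or] at hz
    exact ⟨hω.1.2 z hz.2.1 hz.2.2.1, hω.2.2 z hz.2.1 hz.2.2.2⟩
  have hdisj : (T : Set (Fin n)).PairwiseDisjoint F := by
    intro z hz z' hz' hzz'
    simp only [hT, Finset.coe_sdiff, Set.mem_sdiff, Finset.mem_coe, Finset.mem_insert,
      Finset.mem_singleton, not_or] at hz hz'
    simp only [hF, Function.onFun, Finset.disjoint_left]
    aesop
  refine (measureReal_mono hset).trans_eq ?_
  rw [coinsMeasure_real_biInter hp T A F hdisj hdet, ← hcard, ← Finset.prod_const]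
  refine Finset.prod_congr rfl fun z hz => ?_
  simp only [hT, Finset.mem_sdiff, Finset.mem_insert, Finset.mem_singleton, not_or] at hz
  exact coinsMeasure_real_not_both_not_both hp (by aesop) (by aesop) (by aesop)

lemma coinsMeasure_real_farApart_inter_of_disjoint (hp : p ∈ Set.Icc (0 : ℝ) 1)
    {u v w x : Fin n} (huv : u ≠ v) (huw : u ≠ w) (hux : u ≠ x) (hvw : v ≠ w) (hvx : v ≠ x)
    (hwx : w ≠ x) :
    (coinsMeasure (Sym2 (Fin n)) p).real (farApart u v ∩ farApart w x) ≤
      (1 - p ^ 2) ^ (2 * (n - 4)) := by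
  have := isProbabilityMeasure_coinsMeasure (ι := Sym2 (Fin n)) hp
  set T : Finset (Fin n × Bool) := (Finset.univ \ {u, v, w, x}) ×ˢ Finset.univ with hT
  have hcard : T.card = 2 * (n - 4) := by
    have h4 : ({u, v, w, x} : Finset (Fin n)).card = 4 := by
      simp [huv, huw, hux, hvw, hvx, hwx]
    rw [hT, Finset.card_product, Finset.card_sdiff_of_subset (Finset.subset_univ _), h4]
    simp [mul_comm]
  set A : Fin n × Bool → Set (Sym2 (Fin n) → Bool) := fun z =>
    {ω | ¬(ω s(z.1, if z.2 then u else w) = true ∧ ω s(z.1, if z.2 then v else x) = true)} with hA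
  set F : Fin n × Bool → Finset (Sym2 (Fin n)) := fun z =>
    {s(z.1, if z.2 then u else w), s(z.1, if z.2 then v else x)} with hF
  have hdet : ∀ z ∈ T, DeterminedBy (A z) (F z) := by
    intro z _ ω ω' h hω
    simpa only [hA, Set.mem_ofPred_eq, ← h s(z.1, if z.2 then u else w) (by simp [hF]),
      ← h s(z.1, if z.2 then v else x) (by simp [hF])] using hω
  have hset : farApart u v ∩ farApart w x ⊆ ⋂ z ∈ T, A z := by
    intro ω hω
    simp only [Set.mem_iInter]
    rintro ⟨z, b⟩ hz
    simp only [hT, Finset.mem_product, Finset.mem_sdiff, Finset.mem_insert,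
      Finset.mem_singleton, not_or] at hz
    obtain ⟨⟨-, h1, h2, h3, h4⟩, -⟩ := hz
    cases b
    · exact hω.2.2 z h3 h4
    · exact hω.1.2 z h1 h2
  have hdisj : (T : Set (Fin n × Bool)).PairwiseDisjoint F := by
    rintro ⟨z, b⟩ hz ⟨z', b'⟩ hz' hzz'
    simp only [hT, Finset.mem_coe, Finset.mem_product, Finset.mem_sdiff, Finset.mem_insert,
      Finset.mem_singleton, not_or] at hz hz'
    simp only [hF, Function.onFun, Finset.disjoint_left]
    intro e he he'
    cases b <;> cases b' <;>
      simp only [if_true, if_false, Bool.false_eq_true, Finset.mem_insert,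
        Finset.mem_singleton] at he he' <;>
      rcases he with rfl | rfl <;> simp only [Sym2.eq_iff] at he' <;> grind
  refine (measureReal_mono hset).trans_eq ?_
  rw [coinsMeasure_real_biInter hp T A F hdisj hdet, ← hcard, ← Finset.prod_const]
  refine Finset.prod_congr rfl fun z hz => ?_
  simp only [hT, Finset.mem_product, Finset.mem_sdiff, Finset.mem_insert, Finset.mem_singleton,
    not_or] at hz
  refine coinsMeasure_real_not_both hp ?_
  cases z.2 <;> simp only [if_true, if_false, Bool.false_eq_true, ne_eq, Sym2.eq_iff] <;> grind

lemma coinsMeasure_real_farApart_inter_le (hp : p ∈ Set.Icc (0 : ℝ) 1) {u v w x : Fin n}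
    (huv : u ≠ v) (hwx : w ≠ x) :
    (coinsMeasure (Sym2 (Fin n)) p).real (farApart u v ∩ farApart w x) ≤
      (1 - p) * (1 - p ^ 2) ^ (n - 2) *
          ((if w = u ∧ x = v then 1 else 0) + (if w = v ∧ x = u then 1 else 0)) +
        (1 - 2 * p ^ 2 + p ^ 3) ^ (n - 3) *
          ((if w = u then 1 else 0) + (if w = v then 1 else 0) +
            (if x = u then 1 else 0) + (if x = v then 1 else 0)) +
        (1 - p ^ 2) ^ (2 * (n - 4)) := by
  have := isProbabilityMeasure_coinsMeasure (ι := Sym2 (Fin n)) hp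
  obtain ⟨h0, h1⟩ := hp
  have hq : 0 ≤ (1 - p) * (1 - p ^ 2) ^ (n - 2) :=
    mul_nonneg (by linarith) (pow_nonneg (by nlinarith) _)
  have hr : 0 ≤ (1 - 2 * p ^ 2 + p ^ 3) ^ (n - 3) :=
    pow_nonneg (one_sub_two_mul_sq_add_cube_nonneg ⟨h0, h1⟩) _
  have hs : 0 ≤ (1 - p ^ 2) ^ (2 * (n - 4)) := pow_nonneg (by nlinarith) _
  have hp : p ∈ Set.Icc (0 : ℝ) 1 := ⟨h0, h1⟩
  have hsame : (coinsMeasure (Sym2 (Fin n)) p).real (farApart u v ∩ farApart w x) ≤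
      (1 - p) * (1 - p ^ 2) ^ (n - 2) :=
    (measureReal_mono Set.inter_subset_left).trans_eq (coinsMeasure_real_farApart hp huv)
  have hshare : ∀ a b c d : Fin n, a ≠ b → a ≠ d → b ≠ d → a = c →
      (coinsMeasure (Sym2 (Fin n)) p).real (farApart a b ∩ farApart c d) ≤
        (1 - 2 * p ^ 2 + p ^ 3) ^ (n - 3) := by
    rintro a b c d hab had hbd rfl
    exact coinsMeasure_real_farApart_inter_of_shared hp hab had hbd
  by_cases hwu : w = u
  · by_cases hxv : x = v
    · split_ifs <;> first | (exfalso; tauto) | nlinarith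
    · have := hshare u v w x huv (by grind) (by grind) hwu.symm
      split_ifs <;> first | (exfalso; tauto) | nlinarith
  by_cases hwv : w = v
  · by_cases hxu : x = u
    · split_ifs <;> first | (exfalso; tauto) | nlinarith
    · have := hshare v u w x huv.symm (by grind) (by grind) hwv.symm
      rw [farApart_comm v u] at this
      split_ifs <;> first | (exfalso; tauto) | nlinarith
  by_cases hxu : x = u
  · have := hshare u v x w huv (by grind) (by grind) hxu.symm
    rw [farApart_comm x w] at this
    split_ifs <;> first | (exfalso; tauto) | nlinarith
  by_cases hxv : x = v
  · have := hshare v u x w huv.symm (by grind) (by grind) hxv.symm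
    rw [farApart_comm x w, farApart_comm v u] at this
    split_ifs <;> first | (exfalso; tauto) | nlinarith
  have := coinsMeasure_real_farApart_inter_of_disjoint hp huv (Ne.symm hwu) (Ne.symm hxu)
    (Ne.symm hwv) (Ne.symm hxv) hwx
  split_ifs <;> first | (exfalso; tauto) | nlinarith

end Probabilities

/-- The second moment bound for `diam2Prob`, in terms of the expected number
`n (n - 1) (1 - p) (1 - p²) ^ (n - 2)` of ordered pairs at distance greater than two. -/
lemma diam2Prob_mul_sq_le {p : ℝ} (hp : p ∈ Set.Icc (0 : ℝ) 1) (n : ℕ) :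
    diam2Prob n p * (n * (n - 1) * ((1 - p) * (1 - p ^ 2) ^ (n - 2))) ^ 2 ≤
      2 * (n * (n - 1) * ((1 - p) * (1 - p ^ 2) ^ (n - 2))) +
        4 * (n ^ 3 * (1 - 2 * p ^ 2 + p ^ 3) ^ (n - 3)) +
        n ^ 4 * (1 - p ^ 2) ^ (2 * (n - 4)) -
        (n * (n - 1) * ((1 - p) * (1 - p ^ 2) ^ (n - 2))) ^ 2 := by
  have := isProbabilityMeasure_coinsMeasure (ι := Sym2 (Fin n)) hp
  set q := (1 - p) * (1 - p ^ 2) ^ (n - 2)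
  set r := (1 - 2 * p ^ 2 + p ^ 3) ^ (n - 3)
  set s := (1 - p ^ 2) ^ (2 * (n - 4))
  set I : Finset (Fin n × Fin n) := Finset.univ.offDiag with hI
  have hcard : (I.card : ℝ) = n * (n - 1) := by
    rw [hI, Finset.offDiag_card, Finset.card_univ, Fintype.card_fin,
      Nat.cast_sub (Nat.le_mul_self n)]
    push_cast
    ring
  obtain ⟨h0, h1⟩ := hp
  have hr : 0 ≤ r :=
    pow_nonneg (one_sub_two_mul_sq_add_cube_nonneg ⟨h0, h1⟩) _
  have hs : 0 ≤ s := pow_nonneg (by nlinarith) _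
  have hq : 0 ≤ q := mul_nonneg (by linarith) (pow_nonneg (by nlinarith) _)
  have hp : p ∈ Set.Icc (0 : ℝ) 1 := ⟨h0, h1⟩
  have hmean : ∑ i ∈ I, (coinsMeasure (Sym2 (Fin n)) p).real (farApart i.1 i.2) =
      n * (n - 1) * q := by
    rw [← hcard, ← nsmul_eq_mul]
    refine Finset.sum_eq_card_nsmul fun i hi => coinsMeasure_real_farApart hp ?_
    simpa [hI] using hi
  have hinner : ∀ i ∈ I, ∑ j ∈ I, (coinsMeasure (Sym2 (Fin n)) p).real
      (farApart i.1 i.2 ∩ farApart j.1 j.2) ≤ 2 * q + 4 * n * r + n ^ 2 * s := by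
    intro i hi
    have hi' : i.1 ≠ i.2 := by simpa [hI] using hi
    calc _ ≤ ∑ j ∈ I, (q * ((if j.1 = i.1 ∧ j.2 = i.2 then 1 else 0) +
            (if j.1 = i.2 ∧ j.2 = i.1 then 1 else 0)) +
          r * ((if j.1 = i.1 then 1 else 0) + (if j.1 = i.2 then 1 else 0) +
            (if j.2 = i.1 then 1 else 0) + (if j.2 = i.2 then 1 else 0)) + s) :=
          Finset.sum_le_sum fun j hj =>
            coinsMeasure_real_farApart_inter_le hp hi' (by simpa [hI] using hj)
      _ ≤ ∑ j : Fin n × Fin n, (q * ((if j.1 = i.1 ∧ j.2 = i.2 then 1 else 0) +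
            (if j.1 = i.2 ∧ j.2 = i.1 then 1 else 0)) +
          r * ((if j.1 = i.1 then 1 else 0) + (if j.1 = i.2 then 1 else 0) +
            (if j.2 = i.1 then 1 else 0) + (if j.2 = i.2 then 1 else 0)) + s) := by
          refine Finset.sum_le_sum_of_subset_of_nonneg (Finset.subset_univ _) fun j _ _ => ?_
          positivity
      _ = 2 * q + 4 * n * r + n ^ 2 * s := by
          simp only [Finset.sum_add_distrib, ← Finset.mul_sum, Fintype.sum_prod_type, ite_and]
          simp [apply_ite Finset.card]
          ring
  have hsum : ∑ i ∈ I, ∑ j ∈ I, (coinsMeasure (Sym2 (Fin n)) p).real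
      (farApart i.1 i.2 ∩ farApart j.1 j.2) ≤
      n * (n - 1) * (2 * q + 4 * n * r + n ^ 2 * s) := by
    rw [← hcard, ← nsmul_eq_mul]
    exact Finset.sum_le_card_nsmul _ _ _ hinner
  have hsq : ((n : ℝ) * (n - 1)) * (4 * n * r + n ^ 2 * s) ≤
      n ^ 2 * (4 * n * r + n ^ 2 * s) := by
    have : (n : ℝ) * (n - 1) ≤ n ^ 2 := by nlinarith [n.cast_nonneg (α := ℝ)]
    gcongr
  have h2 := measureReal_forall_notMem_mul_sq_le (coinsMeasure (Sym2 (Fin n)) p) I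
    fun i => farApart i.1 i.2
  rw [hmean] at h2
  have h3 : diam2Prob n p ≤ (coinsMeasure (Sym2 (Fin n)) p).real
      {ω | ∀ i ∈ I, ω ∉ farApart i.1 i.2} := by
    refine (diam2Prob_le hp n).trans (measureReal_mono ?_)
    intro ω hω i hi
    exact hω i.1 i.2 (by simpa [hI] using hi)
  have h4 := mul_le_mul_of_nonneg_right h3 (sq_nonneg (n * (n - 1) * q))
  nlinarith

open Filter Topology

section Asymptotics

variable {p : ℕ → ℝ} {c : ℝ}

lemma tendsto_sq_mul_exp_neg (hconv : Tendsto
    (fun n : ℕ => 2 * Real.log n - n * (p n) ^ 2 - Real.log 2) atTop (𝓝 c)) :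
    Tendsto (fun n : ℕ => (n : ℝ) ^ 2 * Real.exp (-(n * p n ^ 2))) atTop
      (𝓝 (2 * Real.exp c)) := by
  have h := (Real.continuous_exp.tendsto _).comp (hconv.add_const (Real.log 2))
  rw [Real.exp_add, Real.exp_log two_pos, mul_comm] at h
  refine h.congr' ?_
  filter_upwards [eventually_gt_atTop 0] with n hn
  have hn' : (0 : ℝ) < n := by exact_mod_cast hn
  have : (n : ℝ) ^ 2 = Real.exp (2 * Real.log n) := by
    rw [two_mul, Real.exp_add, Real.exp_log hn', sq]
  rw [this, ← Real.exp_add, Function.comp_apply]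
  ring_nf

lemma tendsto_mul_cube_zero (hp : ∀ n, p n ∈ Set.Ioo (0 : ℝ) 1) (hconv : Tendsto
    (fun n : ℕ => 2 * Real.log n - n * (p n) ^ 2 - Real.log 2) atTop (𝓝 c)) :
    Tendsto (fun n : ℕ => (n : ℝ) * p n ^ 3) atTop (𝓝 0) := by
  have hbound : ∀ᶠ n : ℕ in atTop, (n : ℝ) * p n ^ 2 ≤ 3 * Real.log n := by
    have h1 : ∀ᶠ n : ℕ in atTop,
        c - 1 < 2 * Real.log n - n * (p n) ^ 2 - Real.log 2 :=
      hconv.eventually (lt_mem_nhds (by linarith))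
    have h2 : ∀ᶠ n : ℕ in atTop, 1 - c - Real.log 2 ≤ Real.log n :=
      (Real.tendsto_log_atTop.comp tendsto_natCast_atTop_atTop).eventually_ge_atTop _
    filter_upwards [h1, h2] with n h1 h2
    linarith
  have hlog : Tendsto (fun n : ℕ => 27 * (Real.log n ^ 3 / n)) atTop (𝓝 0) := by
    have := (Real.isLittleO_pow_log_id_atTop (n := 3)).tendsto_div_nhds_zero.comp
      (tendsto_natCast_atTop_atTop (R := ℝ))
    simpa using this.const_mul 27
  have hsq : Tendsto (fun n : ℕ => ((n : ℝ) * p n ^ 3) ^ 2) atTop (𝓝 0) := by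
    refine tendsto_of_tendsto_of_tendsto_of_le_of_le' tendsto_const_nhds hlog
      (Eventually.of_forall fun n => sq_nonneg _) ?_
    filter_upwards [hbound, eventually_gt_atTop 0] with n hb hn
    have hn' : (0 : ℝ) < n := by exact_mod_cast hn
    calc ((n : ℝ) * p n ^ 3) ^ 2 = (n * p n ^ 2) ^ 3 / n := by field_simp
      _ ≤ (3 * Real.log n) ^ 3 / n := by gcongr
      _ = 27 * (Real.log n ^ 3 / n) := by ring
  have h := (Real.continuous_sqrt.tendsto _).comp hsq
  rw [Real.sqrt_zero] at h
  refine h.congr fun n => ?_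
  exact Real.sqrt_sq (mul_nonneg n.cast_nonneg (pow_nonneg (hp n).1.le 3))

lemma tendsto_mul_log_add_sq_zero (hp : ∀ n, p n ∈ Set.Ioo (0 : ℝ) 1)
    (hp0 : Tendsto p atTop (𝓝 0))
    (hcube : Tendsto (fun n : ℕ => (n : ℝ) * p n ^ 3) atTop (𝓝 0)) :
    Tendsto (fun n : ℕ => (n : ℝ) * (Real.log (1 - p n ^ 2) + p n ^ 2)) atTop (𝓝 0) := by
  have hlow : Tendsto (fun n : ℕ => -2 * ((n : ℝ) * p n ^ 3)) atTop (𝓝 0) := by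
    simpa using hcube.const_mul (-2)
  refine tendsto_of_tendsto_of_tendsto_of_le_of_le' hlow tendsto_const_nhds ?_ ?_
  · filter_upwards [hp0.eventually (gt_mem_nhds (show (0 : ℝ) < 1 / 2 by norm_num))] with n hn
    have h0 := (hp n).1
    have hpos : 0 < 1 - p n ^ 2 := by nlinarith
    have hlog := Real.one_sub_inv_le_log_of_pos hpos
    have hinv : (1 - p n ^ 2)⁻¹ ≤ 1 + p n ^ 2 + 2 * p n ^ 3 := by
      rw [inv_le_iff_one_le_mul₀ hpos]
      have h3 : 0 ≤ p n ^ 3 := by positivity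
      have h4 : p n ^ 4 ≤ p n ^ 3 / 2 := by nlinarith
      have h5 : p n ^ 5 ≤ p n ^ 3 / 4 := by
        have : p n ^ 5 = p n * p n ^ 4 := by ring
        have : 0 ≤ p n ^ 4 := by positivity
        nlinarith
      nlinarith
    have : -2 * p n ^ 3 ≤ Real.log (1 - p n ^ 2) + p n ^ 2 := by linarith
    calc -2 * ((n : ℝ) * p n ^ 3) = n * (-2 * p n ^ 3) := by ring
      _ ≤ _ := by gcongr
  · refine Eventually.of_forall fun n => ?_
    have hpos : 0 < 1 - p n ^ 2 := by nlinarith [(hp n).1, (hp n).2]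
    have := Real.log_le_sub_one_of_pos hpos
    exact mul_nonpos_of_nonneg_of_nonpos n.cast_nonneg (by linarith)

lemma tendsto_sq_mul_one_sub_sq_pow (hp : ∀ n, p n ∈ Set.Ioo (0 : ℝ) 1)
    (hp0 : Tendsto p atTop (𝓝 0)) (hconv : Tendsto
    (fun n : ℕ => 2 * Real.log n - n * (p n) ^ 2 - Real.log 2) atTop (𝓝 c)) :
    Tendsto (fun n : ℕ => (n : ℝ) ^ 2 * (1 - p n ^ 2) ^ n) atTop (𝓝 (2 * Real.exp c)) := by
  have h1 := tendsto_mul_log_add_sq_zero hp hp0 (tendsto_mul_cube_zero hp hconv)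
  have h2 := (tendsto_sq_mul_exp_neg hconv).mul ((Real.continuous_exp.tendsto _).comp h1)
  rw [Real.exp_zero, mul_one] at h2
  refine h2.congr fun n => ?_
  have hpos : 0 < 1 - p n ^ 2 := by nlinarith [(hp n).1, (hp n).2]
  rw [Function.comp_apply, mul_assoc, ← Real.exp_add]
  congr 1
  rw [show -((n : ℝ) * p n ^ 2) + n * (Real.log (1 - p n ^ 2) + p n ^ 2) =
    n * Real.log (1 - p n ^ 2) by ring, Real.exp_nat_mul, Real.exp_log hpos]

lemma tendsto_expected_pairs (hp : ∀ n, p n ∈ Set.Ioo (0 : ℝ) 1)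
    (hp0 : Tendsto p atTop (𝓝 0)) (hconv : Tendsto
    (fun n : ℕ => 2 * Real.log n - n * (p n) ^ 2 - Real.log 2) atTop (𝓝 c)) :
    Tendsto (fun n : ℕ => (n : ℝ) * (n - 1) * ((1 - p n) * (1 - p n ^ 2) ^ (n - 2))) atTop
      (𝓝 (2 * Real.exp c)) := by
  have h1 := tendsto_sq_mul_one_sub_sq_pow hp hp0 hconv
  have h2 : Tendsto (fun n : ℕ => 1 - (n : ℝ)⁻¹) atTop (𝓝 (1 - 0)) :=
    tendsto_const_nhds.sub tendsto_inv_atTop_nhds_zero_nat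
  have h3 : Tendsto (fun n : ℕ => (1 - p n) / (1 - p n ^ 2) ^ 2) atTop
      (𝓝 ((1 - 0) / (1 - 0 ^ 2) ^ 2)) :=
    (hp0.const_sub 1).div (((hp0.pow 2).const_sub 1).pow 2) (by norm_num)
  have h := (h1.mul h2).mul h3
  norm_num only [mul_one] at h
  refine h.congr' ?_
  filter_upwards [eventually_ge_atTop 2] with n hn
  have hpos : 0 < 1 - p n ^ 2 := by nlinarith [(hp n).1, (hp n).2]
  have hn' : (n : ℝ) ≠ 0 := by positivity
  rw [pow_sub₀ _ hpos.ne' hn]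
  field_simp

lemma tendsto_disjoint_pairs (hp : ∀ n, p n ∈ Set.Ioo (0 : ℝ) 1)
    (hp0 : Tendsto p atTop (𝓝 0)) (hconv : Tendsto
    (fun n : ℕ => 2 * Real.log n - n * (p n) ^ 2 - Real.log 2) atTop (𝓝 c)) :
    Tendsto (fun n : ℕ => (n : ℝ) ^ 4 * (1 - p n ^ 2) ^ (2 * (n - 4))) atTop
      (𝓝 ((2 * Real.exp c) ^ 2)) := by
  have h1 := (tendsto_sq_mul_one_sub_sq_pow hp hp0 hconv).pow 2
  have h2 : Tendsto (fun n : ℕ => (1 - p n ^ 2) ^ 8) atTop (𝓝 ((1 - 0 ^ 2) ^ 8)) :=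
    ((hp0.pow 2).const_sub 1).pow 8
  have h := h1.div h2 (by norm_num)
  norm_num only [div_one] at h
  refine h.congr' ?_
  filter_upwards [eventually_ge_atTop 4] with n hn
  have hpos : 0 < 1 - p n ^ 2 := by nlinarith [(hp n).1, (hp n).2]
  rw [Nat.mul_sub, pow_sub₀ _ hpos.ne' (by lia)]
  simp only [Pi.div_apply]
  field_simp
  ring

lemma tendsto_sharing_pairs (hp : ∀ n, p n ∈ Set.Ioo (0 : ℝ) 1)
    (hp0 : Tendsto p atTop (𝓝 0)) (hconv : Tendsto
    (fun n : ℕ => 2 * Real.log n - n * (p n) ^ 2 - Real.log 2) atTop (𝓝 c)) :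
    Tendsto (fun n : ℕ => (n : ℝ) ^ 3 * (1 - 2 * p n ^ 2 + p n ^ 3) ^ (n - 3)) atTop
      (𝓝 0) := by
  have h1 := (tendsto_sq_mul_exp_neg hconv).pow 2
  have h2 := (Real.continuous_exp.tendsto _).comp (tendsto_mul_cube_zero hp hconv)
  have hbase : Tendsto (fun n : ℕ => 1 - 2 * p n ^ 2 + p n ^ 3) atTop
      (𝓝 (1 - 2 * 0 ^ 2 + 0 ^ 3)) :=
    (((hp0.pow 2).const_mul 2).const_sub 1).add (hp0.pow 3)
  have h := ((h1.mul h2).mul (tendsto_inv_atTop_nhds_zero_nat (𝕜 := ℝ))).div (hbase.pow 3)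
    (by norm_num)
  rw [mul_zero, zero_div] at h
  refine tendsto_of_tendsto_of_tendsto_of_le_of_le' tendsto_const_nhds h ?_ ?_
  · refine Eventually.of_forall fun n => ?_
    have := one_sub_two_mul_sq_add_cube_nonneg (Set.Ioo_subset_Icc_self (hp n))
    positivity
  · filter_upwards [eventually_ge_atTop 3,
      hbase.eventually (lt_mem_nhds (show (0 : ℝ) < 1 - 2 * 0 ^ 2 + 0 ^ 3 by norm_num))]
      with n hn hpos
    have hn' : (n : ℝ) ≠ 0 := by positivity
    have hle : (1 - 2 * p n ^ 2 + p n ^ 3) ^ n ≤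
        Real.exp (-(n * p n ^ 2)) ^ 2 * Real.exp (n * p n ^ 3) := by
      have : 1 - 2 * p n ^ 2 + p n ^ 3 ≤ Real.exp (-2 * p n ^ 2 + p n ^ 3) := by
        have := Real.add_one_le_exp (-2 * p n ^ 2 + p n ^ 3)
        linarith
      refine (pow_le_pow_left₀ hpos.le this n).trans_eq ?_
      rw [← Real.exp_nat_mul, ← Real.exp_nat_mul, ← Real.exp_add]
      congr 1
      push_cast
      ring
    rw [pow_sub₀ _ hpos.ne' hn, ← div_eq_mul_inv, ← mul_div_assoc]
    simp only [Pi.div_apply, Function.comp_apply]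
    refine div_le_div_of_nonneg_right ?_ (by positivity)
    calc (n : ℝ) ^ 3 * (1 - 2 * p n ^ 2 + p n ^ 3) ^ n
        ≤ n ^ 3 * (Real.exp (-(n * p n ^ 2)) ^ 2 * Real.exp (n * p n ^ 3)) := by gcongr
      _ = _ := by field_simp

end Asymptotics

/-- If `p(n) → 0` and `2 log n - n p(n)² - log 2 → c > 0`, then for every `ε > 0`, for
all large `n`, `P(n,p(n)) ≤ (1+ε)e^{-c}`. -/
theorem diam2Prob_upper_critical (p : ℕ → ℝ) (hp : ∀ n, p n ∈ Set.Ioo (0 : ℝ) 1)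
    (hp0 : Filter.Tendsto p Filter.atTop (nhds 0)) (c : ℝ) (hc : 0 < c)
    (hconv : Filter.Tendsto
      (fun n : ℕ => 2 * Real.log n - n * (p n) ^ 2 - Real.log 2) Filter.atTop (nhds c)) :
    ∀ ε > (0 : ℝ), ∃ N : ℕ, ∀ n ≥ N,
      diam2Prob n (p n) ≤ (1 + ε) * Real.exp (-c) := by
  intro ε hε
  have hM := tendsto_expected_pairs hp hp0 hconv
  have hR := tendsto_sharing_pairs hp hp0 hconv
  have hS := tendsto_disjoint_pairs hp hp0 hconv
  have hexp := Real.exp_pos c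
  have h := ((((hM.const_mul 2).add (hR.const_mul 4)).add hS).sub (hM.pow 2)).div (hM.pow 2)
    (by positivity)
  have hlim : (2 * (2 * Real.exp c) + 4 * 0 + (2 * Real.exp c) ^ 2 - (2 * Real.exp c) ^ 2) /
      (2 * Real.exp c) ^ 2 < (1 + ε) * Real.exp (-c) := by
    have : (2 * (2 * Real.exp c) + 4 * 0 + (2 * Real.exp c) ^ 2 - (2 * Real.exp c) ^ 2) /
        (2 * Real.exp c) ^ 2 = Real.exp (-c) := by
      rw [Real.exp_neg]
      field_simp
      ring
    rw [this]
    nlinarith [Real.exp_pos (-c)]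
  obtain ⟨N, hN⟩ := eventually_atTop.1 ((h.eventually (gt_mem_nhds hlim)).and
    (hM.eventually (lt_mem_nhds (show 0 < 2 * Real.exp c by positivity))))
  refine ⟨N, fun n hn => le_trans ?_ (hN n hn).1.le⟩
  have hpos := (hN n hn).2
  simp only [Pi.div_apply]
  rw [le_div_iff₀ (by positivity)]
  exact diam2Prob_mul_sq_le (Set.Ioo_subset_Icc_self (hp n)) n
end
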